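/- arXiv:2106.05548 — 3 statements merged into one kernel-verified Lean document; each statement's English description precedes it below -/
import Mathlib

section
/- Let R be a commutative ring, m < n, n ≥ 3. The action by left multiplication of E_m(R) on the orbit set Um_{m,n}(R)/E_n(R) is trivial: for every right invertible matrix S ∈ Um_{m,n}(R) and every γ ∈ E_m(R), there exists δ ∈ E_n(R) such that γS = Sδ. -/
/-- A row `v` of length `n` over a commutative ring is *unimodular* if there is a row `w`
with `∑ i, v i * w i = 1`. -/
def IsUnimodular {R : Type*} [CommRing R] {n : ℕ} (v : Fin n → R) : Prop :=
  ∃ w : Fin n → R, ∑ i, v i * w i = 1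

/-- `ε` lies in the elementary group `E_n(R)`, i.e. the (sub)group of `GL_n(R)` generated by
the elementary matrices `e_{ij}(λ) = I + λ E_{ij}` (`i ≠ j`).  Since the generating set is
closed under inverses, this coincides with the multiplicative closure. -/
def IsElementary {R : Type*} [CommRing R] {n : ℕ} (ε : Matrix (Fin n) (Fin n) R) : Prop :=
  ε ∈ Submonoid.closure {M : Matrix (Fin n) (Fin n) R |
    ∃ (i j : Fin n) (c : R), i ≠ j ∧ M = Matrix.transvection i j c}

/-- An `m × n` matrix is right invertible (i.e. lies in `Um_{m,n}(R)`) if it has a right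
inverse. -/
def RightInvertible {R : Type*} [CommRing R] {m n : ℕ} (A : Matrix (Fin m) (Fin n) R) : Prop :=
  ∃ B : Matrix (Fin n) (Fin m) R, A * B = 1

/-- The stable range condition `sr_k(R)`. -/
def SRCond (R : Type*) [CommRing R] (k : ℕ) : Prop :=
  ∀ a : Fin (k + 1) → R, IsUnimodular a →
    ∃ c : Fin k → R, IsUnimodular (fun i : Fin k => a i.castSucc + c i * a (Fin.last k))

lemma vk_one {R : Type*} [CommRing R] {n : ℕ} :
    IsElementary (1 : Matrix (Fin n) (Fin n) R) := Submonoid.one_mem _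

open Matrix in
lemma vk_mul {R : Type*} [CommRing R] {n : ℕ} (p q w z : Fin n → R) (h : w ⬝ᵥ q = 0) :
    (1 + vecMulVec p w) * (1 + vecMulVec q z) = 1 + vecMulVec p w + vecMulVec q z := by
  rw [mul_add, add_mul, add_mul, vecMulVec_mul_vecMulVec, h]
  simp

open Matrix in
lemma vk_sum_left {R : Type*} [CommRing R] {n : ℕ} {ι : Type*} (s : Finset ι)
    (f : ι → Fin n → R) (w : Fin n → R) (h0 : ∀ i ∈ s, w ⬝ᵥ f i = 0)
    (h : ∀ i ∈ s, IsElementary (1 + vecMulVec (f i) w)) :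
    IsElementary (1 + vecMulVec (∑ i ∈ s, f i) w) := by
  classical
  induction s using Finset.induction_on with
  | empty => simpa using vk_one
  | insert a s ha ih =>
    have h1 := ih (fun i hi => h0 i (Finset.mem_insert_of_mem hi))
      (fun i hi => h i (Finset.mem_insert_of_mem hi))
    have h2 := Submonoid.mul_mem _ h1 (h a (Finset.mem_insert_self a s))
    rw [vk_mul _ _ _ _ (h0 a (Finset.mem_insert_self a s))] at h2
    rw [Finset.sum_insert ha, add_vecMulVec, add_comm (vecMulVec _ _), ← add_assoc]
    exact h2

open Matrix in
lemma vk_sum_right {R : Type*} [CommRing R] {n : ℕ} {ι : Type*} (s : Finset ι)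
    (f : ι → Fin n → R) (p : Fin n → R) (h0 : ∀ i ∈ s, f i ⬝ᵥ p = 0)
    (h : ∀ i ∈ s, IsElementary (1 + vecMulVec p (f i))) :
    IsElementary (1 + vecMulVec p (∑ i ∈ s, f i)) := by
  classical
  induction s using Finset.induction_on with
  | empty => simpa using vk_one
  | insert a s ha ih =>
    have h1 := ih (fun i hi => h0 i (Finset.mem_insert_of_mem hi))
      (fun i hi => h i (Finset.mem_insert_of_mem hi))
    have h2 := Submonoid.mul_mem _ (h a (Finset.mem_insert_self a s)) h1
    rw [vk_mul _ _ _ _ (h0 a (Finset.mem_insert_self a s))] at h2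
    rw [Finset.sum_insert ha, vecMulVec_add, ← add_assoc]
    exact h2

open Matrix in
lemma vk_single {R : Type*} [CommRing R] {n : ℕ} (i j : Fin n) (a b : R)
    (h : i ≠ j ∨ a * b = 0) :
    IsElementary (1 + vecMulVec (Pi.single i a) (Pi.single j b)) := by
  have hs : vecMulVec (Pi.single i a) (Pi.single j b) = Matrix.single i j (a * b) := by
    ext x y
    simp only [vecMulVec_apply, Matrix.single_apply, Pi.single_apply]
    split_ifs <;> grind
  rw [hs]
  by_cases hij : i = j
  · have : a * b = 0 := by tauto
    rw [this]
    simpa using vk_one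
  · exact Submonoid.subset_closure ⟨i, j, a * b, hij, rfl⟩

open Matrix in
lemma vk_col {R : Type*} [CommRing R] {n : ℕ} (k : Fin n) (p : Fin n → R) (c : R)
    (hp : p k = 0) : IsElementary (1 + vecMulVec p (Pi.single k c)) := by
  rw [← Finset.univ_sum_single p]
  apply vk_sum_left
  · intro i _
    by_cases hi : i = k
    · subst hi; simp [hp]
    · simp [Pi.single_apply, hi]
  · intro i _
    apply vk_single
    by_cases hi : i = k
    · subst hi; simp [hp]
    · exact Or.inl hi

open Matrix in
lemma vk_row {R : Type*} [CommRing R] {n : ℕ} (k : Fin n) (w : Fin n → R) (c : R)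
    (hp : w k = 0) : IsElementary (1 + vecMulVec (Pi.single k c) w) := by
  rw [← Finset.univ_sum_single w]
  apply vk_sum_right
  · intro i _
    by_cases hi : i = k
    · subst hi; simp [hp]
    · simp [Pi.single_apply, Ne.symm hi]
  · intro i _
    apply vk_single
    by_cases hi : i = k
    · subst hi; simp [hp]
    · exact Or.inl (Ne.symm hi)

open Matrix in
lemma vk_comm {R : Type*} [CommRing R] {n : ℕ} (k : Fin n) (p w : Fin n → R)
    (hp : p k = 0) (hw : w k = 0) (h : w ⬝ᵥ p = 0) : IsElementary (1 + vecMulVec p w) := by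
  have e1 := vk_col k p 1 hp
  have e2 := vk_row k w 1 hw
  have e3 := vk_col k p (-1) hp
  have e4 := vk_row k w (-1) hw
  have e := Submonoid.mul_mem _ (Submonoid.mul_mem _ e1 e2) (Submonoid.mul_mem _ e3 e4)
  have hA : vecMulVec p (Pi.single k (-1 : R)) = -vecMulVec p (Pi.single k 1) := by
    rw [Pi.single_neg, vecMulVec_neg]
  have hB : vecMulVec (Pi.single k (-1 : R)) w = -vecMulVec (Pi.single k 1) w := by
    rw [Pi.single_neg, neg_vecMulVec]
  rw [hA, hB] at e
  have hAB : vecMulVec p (Pi.single k (1 : R)) * vecMulVec (Pi.single k 1) w = vecMulVec p w := by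
    rw [vecMulVec_mul_vecMulVec]; simp
  have hBA : vecMulVec (Pi.single k 1) w * vecMulVec p (Pi.single k (1 : R)) = 0 := by
    rw [vecMulVec_mul_vecMulVec]; simp [h]
  have hAA : vecMulVec p (Pi.single k 1) * vecMulVec p (Pi.single k (1 : R)) = 0 := by
    rw [vecMulVec_mul_vecMulVec]; simp [hp]
  have hBB : vecMulVec (Pi.single k (1 : R)) w * vecMulVec (Pi.single k 1) w = 0 := by
    rw [vecMulVec_mul_vecMulVec]; simp [hw]
  rw [← hAB]
  change _ ∈ Submonoid.closure _
  convert e using 1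
  generalize vecMulVec p (Pi.single k (1 : R)) = A at *
  generalize vecMulVec (Pi.single k (1 : R)) w = B at *
  have : (1 + A) * (1 + B) * ((1 + -A) * (1 + -B)) =
      1 + A * B - A * A - B * A - B * B + A * A * B + B * A * B - A * (B * A) - A * (B * B)
        + A * (B * A) * B := by noncomm_ring
  rw [this, hBA, hAA, hBB]
  simp

open Matrix in
lemma vk_missing {R : Type*} [CommRing R] {n : ℕ} (k : Fin n) (v w : Fin n → R)
    (hw : w k = 0) (h : w ⬝ᵥ v = 0) : IsElementary (1 + vecMulVec v w) := by
  have hs : w ⬝ᵥ Pi.single k (v k) = 0 := by simp [hw]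
  have e1 := vk_comm k (v - Pi.single k (v k)) w (by simp) hw (by rw [dotProduct_sub, h, hs, sub_zero])
  have e := Submonoid.mul_mem _ e1 (vk_row k w (v k) hw)
  rw [vk_mul _ _ _ _ hs, add_assoc, ← add_vecMulVec, sub_add_cancel] at e
  exact e

open Matrix in
/-- Suslin: `1 + v w` is elementary if `w v = 0` and `v` is unimodular, `n ≥ 3`. -/
lemma vk_suslin {R : Type*} [CommRing R] {n : ℕ} (hn : 3 ≤ n) (v w u : Fin n → R)
    (hu : u ⬝ᵥ v = 1) (h : w ⬝ᵥ v = 0) : IsElementary (1 + vecMulVec v w) := by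
  let f : Fin n × Fin n → Fin n → R := fun x =>
    Pi.single x.1 (w x.1 * u x.2 * v x.2) - Pi.single x.2 (w x.1 * u x.2 * v x.1)
  have hf : ∀ x, f x ⬝ᵥ v = 0 := by
    intro x
    simp only [f, sub_dotProduct, single_dotProduct]
    ring
  have hw : w = ∑ x, f x := by
    rw [Fintype.sum_prod_type]
    have h1 : ∀ i, ∑ j, f (i, j) = Pi.single i (w i) - (w i * v i) • u := by
      intro i
      simp only [f, Finset.sum_sub_distrib]
      congr 1
      · have : w i = ∑ j, w i * u j * v j := by
          simp only [mul_assoc]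
          rw [← Finset.mul_sum]
          change w i = w i * (u ⬝ᵥ v)
          rw [hu, mul_one]
        conv_rhs => rw [this]
        exact (map_sum (AddMonoidHom.single (fun _ : Fin n => R) i) _ _).symm
      · rw [Finset.univ_sum_single (fun j => w i * u j * v i)]
        ext j
        simp only [Pi.smul_apply, smul_eq_mul]
        ring
    simp only [h1, Finset.sum_sub_distrib, Finset.univ_sum_single, ← Finset.sum_smul]
    change w = w - (w ⬝ᵥ v) • u
    rw [h]; simp
  rw [hw]
  apply vk_sum_right _ _ _ (fun x _ => hf x)
  rintro ⟨i, j⟩ -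
  obtain ⟨k, hk⟩ : ∃ k, k ∉ ({i, j} : Finset (Fin n)) := by
    by_contra! hc
    have h2 : (Finset.univ : Finset (Fin n)) ⊆ {i, j} := fun k _ => hc k
    have h3 := Finset.card_le_card h2
    have h4 := Finset.card_le_two (a := i) (b := j)
    simp at h3
    omega
  simp only [Finset.mem_insert, Finset.mem_singleton, not_or] at hk
  exact vk_missing k _ _ (by simp [f, hk.1, hk.2]) (hf _)

open Matrix in
lemma vk_step {R : Type*} [CommRing R] {m n : ℕ} (hn : 3 ≤ n)
    (S : Matrix (Fin m) (Fin n) R) (hS : RightInvertible S) (i j : Fin m) (c : R) (hij : i ≠ j) :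
    ∃ δ : Matrix (Fin n) (Fin n) R, IsElementary δ ∧ transvection i j c * S = S * δ := by
  obtain ⟨T, hT⟩ := hS
  refine ⟨1 + vecMulVec (T.col i) (c • S.row j), vk_suslin hn _ _ (S.row i) ?_ ?_, ?_⟩
  · have := congrFun (congrFun hT i) i
    rw [Matrix.one_apply_eq] at this
    exact this
  · have := congrFun (congrFun hT j) i
    rw [Matrix.one_apply_ne hij.symm] at this
    rw [smul_dotProduct]
    have h' : S.row j ⬝ᵥ T.col i = 0 := this
    rw [h', smul_zero]
  · have h1 : vecMulVec (T.col i) (c • S.row j) = T * Matrix.single i j c * S := by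
      ext a b
      simp [vecMulVec_apply, Matrix.mul_apply, Matrix.single_apply, ite_and, mul_assoc]
    rw [h1, transvection, Matrix.mul_add, Matrix.add_mul, Matrix.mul_assoc T, ← Matrix.mul_assoc S, hT]
    simp

/-- (van der Kallen) Let `R` be a commutative ring, `m < n`, `n ≥ 3`.  The action by left
multiplication of `E_m(R)` on `Um_{m,n}(R)/E_n(R)` is trivial: for every right invertible
`S ∈ Um_{m,n}(R)` and every `γ ∈ E_m(R)` there is `δ ∈ E_n(R)` with `γS = Sδ`. -/
theorem left_elementary_action_trivial {R : Type*} [CommRing R]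
    (m n : ℕ) (hmn : m < n) (hn : 3 ≤ n)
    (S : Matrix (Fin m) (Fin n) R) (hS : RightInvertible S)
    (γ : Matrix (Fin m) (Fin m) R) (hγ : IsElementary γ) :
    ∃ δ : Matrix (Fin n) (Fin n) R, IsElementary δ ∧ γ * S = S * δ := by
  induction hγ using Submonoid.closure_induction with
  | mem x hx =>
    obtain ⟨i, j, c, hij, rfl⟩ := hx
    exact vk_step hn S hS i j c hij
  | one => exact ⟨1, Submonoid.one_mem _, by simp⟩
  | mul x y _ _ hx hy =>
    obtain ⟨δ, hδ, h1⟩ := hx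
    obtain ⟨ε, hε, h2⟩ := hy
    refine ⟨δ * ε, Submonoid.mul_mem _ hδ hε, ?_⟩
    rw [Matrix.mul_assoc, h2, ← Matrix.mul_assoc, h1, Matrix.mul_assoc]
end

section
/- (Generalised Mennicke–Newman lemma) Let R be a commutative noetherian ring with sdim(R) = d ≤ 2(n−m)−1, m ≥ 2, n > m. Let S, T ∈ Um_{m,n}(R) be right invertible m×n matrices. Then there exist ε₁, ε₂ ∈ E_n(R) such that Sε₁ = (X, α) and Tε₂ = (I_m − X, α) for some X ∈ M_{m×m}(R) and α ∈ M_{m×(n−m)}(R), where (X, α) denotes the m×n matrix whose first m columns form X and whose last n−m columns form α. -/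
/-- The `m × (p + q)` matrix `(X, α)` whose first `p` columns form `X` and whose last `q`
columns form `α`. -/
def appendCols {R : Type*} [CommRing R] {m p q : ℕ}
    (X : Matrix (Fin m) (Fin p) R) (α : Matrix (Fin m) (Fin q) R) :
    Matrix (Fin m) (Fin (p + q)) R :=
  Matrix.of fun i => Fin.append (X i) (α i)

/-- Elementary matrices over an arbitrary finite index type. -/
def ElemMat {R : Type*} [CommRing R] {ι : Type*} [Fintype ι] [DecidableEq ι]
    (ε : Matrix ι ι R) : Prop :=
  ε ∈ Submonoid.closure {M : Matrix ι ι R |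
    ∃ (i j : ι) (c : R), i ≠ j ∧ M = Matrix.transvection i j c}

section helpers
open Matrix

variable {R : Type*} [CommRing R] {ι κ : Type*} [Fintype ι] [DecidableEq ι]
  [Fintype κ] [DecidableEq κ]

lemma ElemMat.one : ElemMat (1 : Matrix ι ι R) := Submonoid.one_mem _

lemma ElemMat.mul {A B : Matrix ι ι R} (hA : ElemMat A) (hB : ElemMat B) : ElemMat (A * B) :=
  Submonoid.mul_mem _ hA hB

lemma ElemMat.transv {i j : ι} (h : i ≠ j) (c : R) : ElemMat (transvection i j c) :=
  Submonoid.subset_closure ⟨i, j, c, h, rfl⟩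

lemma ElemMat.exists_inv {A : Matrix ι ι R} (hA : ElemMat A) :
    ∃ B, ElemMat B ∧ A * B = 1 ∧ B * A = 1 := by
  unfold ElemMat at hA
  induction hA using Submonoid.closure_induction with
  | mem x hx =>
    obtain ⟨i, j, c, hij, rfl⟩ := hx
    refine ⟨transvection i j (-c), ElemMat.transv hij _, ?_, ?_⟩ <;>
    rw [transvection_mul_transvection_same _ _ hij] <;> simp
  | one => exact ⟨1, ElemMat.one, by simp, by simp⟩
  | mul x y _ _ hx hy =>
    obtain ⟨x', hx', h1, h2⟩ := hx
    obtain ⟨y', hy', h3, h4⟩ := hy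
    refine ⟨y' * x', hy'.mul hx', ?_, ?_⟩
    · rw [show x * y * (y' * x') = x * (y * y') * x' by simp only [Matrix.mul_assoc], h3]
      simpa using h1
    · rw [show y' * x' * (x * y) = y' * (x' * x) * y by simp only [Matrix.mul_assoc], h2]
      simpa using h4

lemma ElemMat.reindex (e : ι ≃ κ) {A : Matrix ι ι R} (hA : ElemMat A) :
    ElemMat (A.submatrix e.symm e.symm) := by
  unfold ElemMat at hA
  induction hA using Submonoid.closure_induction with
  | mem x hx =>
    obtain ⟨i, j, c, hij, rfl⟩ := hx
    have : (transvection i j c).submatrix e.symm e.symm = transvection (e i) (e j) c := by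
      ext a b
      simp [transvection, Matrix.single_apply, Matrix.one_apply, Equiv.eq_symm_apply]
    rw [this]
    exact ElemMat.transv (by simpa using hij) _
  | one => simpa using ElemMat.one
  | mul x y _ _ hx hy =>
    rw [← Matrix.submatrix_mul_equiv x y e.symm e.symm e.symm]
    exact hx.mul hy

lemma ElemMat.upper (C : Matrix ι κ R) : ElemMat (fromBlocks 1 C 0 1) := by
  induction C using Matrix.induction_on' with
  | h_zero => simpa using ElemMat.one
  | h_add p q hp hq =>
    have := hp.mul hq
    rw [fromBlocks_multiply] at this
    simpa [add_comm] using this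
  | h_std_basis i j c =>
    have : fromBlocks (1 : Matrix ι ι R) (Matrix.single i j c) 0 (1 : Matrix κ κ R)
        = transvection (Sum.inl i) (Sum.inr j) c := by
      ext (a | a) (b | b) <;>
      simp [transvection, Matrix.single_apply, Matrix.one_apply]
    rw [this]
    exact ElemMat.transv (by simp) _

lemma ElemMat.lower (C : Matrix κ ι R) : ElemMat (fromBlocks 1 0 C 1) := by
  induction C using Matrix.induction_on' with
  | h_zero => simpa using ElemMat.one
  | h_add p q hp hq =>
    have := hp.mul hq
    rw [fromBlocks_multiply] at this
    simpa [add_comm] using this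
  | h_std_basis i j c =>
    have : fromBlocks (1 : Matrix ι ι R) 0 (Matrix.single i j c) (1 : Matrix κ κ R)
        = transvection (Sum.inr i) (Sum.inl j) c := by
      ext (a | a) (b | b) <;>
      simp [transvection, Matrix.single_apply, Matrix.one_apply]
    rw [this]
    exact ElemMat.transv (by simp) _

lemma ElemMat.diag {A : Matrix ι ι R} (hA : ElemMat A) :
    ElemMat (fromBlocks A 0 0 (1 : Matrix κ κ R)) := by
  unfold ElemMat at hA
  induction hA using Submonoid.closure_induction with
  | mem x hx =>
    obtain ⟨i, j, c, hij, rfl⟩ := hx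
    have : fromBlocks (transvection i j c) 0 0 (1 : Matrix κ κ R)
        = transvection (Sum.inl i) (Sum.inl j) c := by
      ext (a | a) (b | b) <;>
      simp [transvection, Matrix.single_apply, Matrix.one_apply]
    rw [this]
    exact ElemMat.transv (by simpa using hij) _
  | one => simpa using ElemMat.one
  | mul x y _ _ hx hy =>
    have := hx.mul hy
    rw [fromBlocks_multiply] at this
    simpa using this

lemma ElemMat.col (j : ι) (z : ι → R) (s : Finset ι) (hs : j ∉ s) :
    ElemMat (1 + ∑ i ∈ s, Matrix.single i j (z i)) := by
  induction s using Finset.induction_on with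
  | empty => simpa using ElemMat.one
  | insert i s his ih =>
    simp only [Finset.mem_insert, not_or] at hs
    have := (ElemMat.transv (R := R) (fun h => hs.1 h.symm : i ≠ j) (z i)).mul (ih hs.2)
    convert this using 1
    rw [Finset.sum_insert his, transvection, Matrix.add_mul, Matrix.one_mul, Matrix.mul_add,
      Matrix.mul_one, Finset.mul_sum, Finset.sum_eq_zero (s := s)
        (f := fun i_1 => Matrix.single i j (z i) * Matrix.single i_1 j (z i_1))]
    · abel
    · intro x hx
      apply Matrix.single_mul_single_of_ne
      rintro rfl
      exact hs.2 hx

lemma srcond_succ {k : ℕ} (h : SRCond R k) : SRCond R (k + 1) := by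
  intro a ⟨p, hp⟩
  set w := a 0 * p 0 + a (Fin.last _) * p (Fin.last _) with hw
  obtain ⟨c, q, hq⟩ := h (Fin.snoc (fun i : Fin k => a i.castSucc.succ) w)
    ⟨Fin.snoc (fun i : Fin k => p i.castSucc.succ) 1, by
      rw [Fin.sum_univ_castSucc]
      simp only [Fin.snoc_castSucc, Fin.snoc_last]
      rw [Fin.sum_univ_succ, Fin.sum_univ_castSucc] at hp
      simp only [Fin.succ_last, Nat.succ_eq_add_one] at hp
      rw [hw]
      linear_combination hp⟩
  simp only [Fin.snoc_castSucc, Fin.snoc_last] at hq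
  refine ⟨Fin.cons 0 (fun i => c i * p (Fin.last _)),
    Fin.cons (∑ i, c i * p 0 * q i) q, ?_⟩
  rw [Fin.sum_univ_succ]
  simp only [Fin.cons_zero, Fin.cons_succ, Fin.castSucc_zero]
  rw [← hq, Finset.mul_sum, ← Finset.sum_add_distrib]
  refine Finset.sum_congr rfl fun i _ => ?_
  rw [hw, Fin.succ_castSucc]
  simp only [zero_mul, add_zero]
  ring

lemma srcond_mono {k l : ℕ} (hkl : k ≤ l) (h : SRCond R k) : SRCond R l := by
  induction hkl with
  | refl => exact h
  | step _ ih => exact srcond_succ ih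

/-- Two-block form of the stable range condition. -/
lemma srcond_two {k : ℕ} (h : SRCond R (k + k)) (a b p q : Fin k → R) (w : R)
    (hu : a ⬝ᵥ p + b ⬝ᵥ q + w = 1) :
    ∃ c d u v : Fin k → R, (a + w • c) ⬝ᵥ u + (b + w • d) ⬝ᵥ v = 1 := by
  obtain ⟨c, q, hq⟩ := h (Fin.snoc (Fin.append a b : Fin (k + k) → R) w)
    ⟨Fin.snoc (Fin.append p q : Fin (k + k) → R) 1, by
      rw [Fin.sum_univ_castSucc]
      simp only [Fin.snoc_castSucc, Fin.snoc_last]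
      rw [Fin.sum_univ_add]
      simp only [Fin.append_left, Fin.append_right, mul_one]
      exact hu⟩
  simp only [Fin.snoc_castSucc, Fin.snoc_last] at hq
  rw [Fin.sum_univ_add] at hq
  refine ⟨fun i => c (Fin.castAdd k i), fun i => c (Fin.natAdd k i),
    fun i => q (Fin.castAdd k i), fun i => q (Fin.natAdd k i), ?_⟩
  simp only [Fin.append_left, Fin.append_right] at hq
  simpa [dotProduct, mul_comm] using hq

lemma rowStep {m k : ℕ} (h : SRCond R (k + k)) (j : Fin m)
    (A B : Matrix (Fin m) (Fin m) R) (A' B' : Matrix (Fin m) (Fin k) R)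
    (hS : ∃ (P : Matrix (Fin m) (Fin m) R) (Q : Matrix (Fin k) (Fin m) R), A * P + A' * Q = 1) (hT : ∃ (P : Matrix (Fin m) (Fin m) R) (Q : Matrix (Fin k) (Fin m) R), B * P + B' * Q = 1)
    (hj : ∀ l < j, ∀ i, (A + B) i l = (1 : Matrix (Fin m) (Fin m) R) i l) :
    ∃ (g : Matrix (Fin m) (Fin m) R) (ε₁ ε₂ : Matrix (Fin m ⊕ Fin k) (Fin m ⊕ Fin k) R)
      (A₁ B₁ : Matrix (Fin m) (Fin m) R) (A₁' B₁' : Matrix (Fin m) (Fin k) R),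
      ElemMat g ∧ ElemMat ε₁ ∧ ElemMat ε₂ ∧
      g * fromCols A A' * ε₁ = fromCols A₁ A₁' ∧ g * fromCols B B' * ε₂ = fromCols B₁ B₁' ∧
      ∀ l ≤ j, ∀ i, (A₁ + B₁) i l = (1 : Matrix (Fin m) (Fin m) R) i l := by
  obtain ⟨P, Q, hPQ⟩ := hS
  obtain ⟨P', Q', hPQ'⟩ := hT
  have e1 : A j ⬝ᵥ (fun l => P l j) + A' j ⬝ᵥ (fun l => Q l j) = 1 := by
    simpa [Matrix.mul_apply, dotProduct] using congrFun (congrFun hPQ j) j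
  have e2 : B j ⬝ᵥ (fun l => P' l j) + B' j ⬝ᵥ (fun l => Q' l j) = 1 := by
    simpa [Matrix.mul_apply, dotProduct] using congrFun (congrFun hPQ' j) j
  generalize (fun l => P l j) = p at e1
  generalize (fun l => Q l j) = q at e1
  generalize (fun l => P' l j) = p' at e2
  generalize (fun l => Q' l j) = q' at e2
  set σ := A j ⬝ᵥ p with hσ
  set τ := B j ⬝ᵥ p' with hτ
  obtain ⟨c, d, u, v, huv⟩ := srcond_two h (A' j) (B' j) q (σ • q') (σ * τ) (by
    rw [dotProduct_smul, smul_eq_mul]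
    linear_combination e1 + σ * e2)
  -- first modification
  set A2 : Matrix (Fin m) (Fin k) R := A' + A * vecMulVec (τ • p) c with hA2
  set B2 : Matrix (Fin m) (Fin k) R := B' + B * vecMulVec (σ • p') d with hB2
  have hA2j : A2 j = A' j + (σ * τ) • c := by
    ext i
    simp only [hA2, Matrix.add_apply, Matrix.mul_apply, vecMulVec_apply, Pi.add_apply,
      Pi.smul_apply, smul_eq_mul, hσ, dotProduct, Finset.sum_mul]
    congr 1
    exact Finset.sum_congr rfl fun x _ => by ring
  have hB2j : B2 j = B' j + (σ * τ) • d := by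
    ext i
    simp only [hB2, Matrix.add_apply, Matrix.mul_apply, vecMulVec_apply, Pi.add_apply,
      Pi.smul_apply, smul_eq_mul]
    rw [show σ * τ * d i = σ * d i * τ by ring, hτ, dotProduct, Finset.mul_sum]
    congr 1
    exact Finset.sum_congr rfl fun x _ => by ring
  rw [← hA2j, ← hB2j] at huv
  -- second modification
  set r : Fin m → R := fun l => (1 : Matrix (Fin m) (Fin m) R) j l - (A + B) j l with hr
  have hr0 : ∀ l < j, r l = 0 := fun l hl => by simp only [hr]; rw [hj l hl, sub_self]
  set A3 := A + A2 * vecMulVec u r with hA3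
  set B3 := B + B2 * vecMulVec v r with hB3
  have hsum : ∀ i l, (A3 + B3) i l = (A + B) i l + (A2 i ⬝ᵥ u + B2 i ⬝ᵥ v) * r l := by
    intro i l
    simp only [hA3, hB3, Matrix.add_apply, Matrix.mul_apply, vecMulVec_apply, dotProduct,
      add_mul, Finset.sum_mul, mul_assoc]
    ring
  have hrow : ∀ l, (A3 + B3) j l = (1 : Matrix (Fin m) (Fin m) R) j l := by
    intro l
    rw [hsum, huv, hr]; ring
  have hcol : ∀ l < j, ∀ i, (A3 + B3) i l = (1 : Matrix (Fin m) (Fin m) R) i l := by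
    intro l hl i
    rw [hsum, hr0 l hl, hj l hl]; ring
  set g : Matrix (Fin m) (Fin m) R :=
    1 + ∑ i ∈ Finset.univ.erase j, Matrix.single i j (-(A3 + B3) i j) with hg
  have hge : ElemMat g := ElemMat.col j (fun i => -(A3 + B3) i j) _ (by simp)
  refine ⟨g, fromBlocks 1 (vecMulVec (τ • p) c) 0 1 * fromBlocks 1 0 (vecMulVec u r) 1,
    fromBlocks 1 (vecMulVec (σ • p') d) 0 1 * fromBlocks 1 0 (vecMulVec v r) 1,
    g * A3, g * B3, g * A2, g * B2, hge, (ElemMat.upper _).mul (ElemMat.lower _),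
    (ElemMat.upper _).mul (ElemMat.lower _), ?_, ?_, ?_⟩
  · rw [Matrix.mul_assoc, ← Matrix.mul_assoc (fromCols A A'), fromCols_mul_fromBlocks,
      fromCols_mul_fromBlocks, ← mul_fromCols]
    simp [hA3, hA2, add_comm]
  · rw [Matrix.mul_assoc, ← Matrix.mul_assoc (fromCols B B'), fromCols_mul_fromBlocks,
      fromCols_mul_fromBlocks, ← mul_fromCols]
    simp [hB3, hB2, add_comm]
  · intro l hl i
    rw [← Matrix.mul_add]
    generalize A3 + B3 = M at *
    have hgM : (g * M) i l = M i l + (if i = j then 0 else -(M i j) * M j l) := by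
      rw [hg, Matrix.add_mul, Matrix.one_mul, Matrix.add_apply, Matrix.sum_mul,
        Matrix.sum_apply]
      congr 1
      split_ifs with hij
      · subst hij
        refine Finset.sum_eq_zero fun x hx => ?_
        rw [Matrix.single_mul_apply_of_ne]
        exact fun h => (Finset.ne_of_mem_erase hx) h.symm
      · rw [Finset.sum_eq_single i]
        · simp
        · intro x _ hx
          rw [Matrix.single_mul_apply_of_ne]
          exact fun h => hx h.symm
        · intro hi
          simp [hij] at hi
    rw [hgM]
    rcases eq_or_lt_of_le hl with rfl | hlt
    · split_ifs with hij
      · rw [hij, hrow]; ring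
      · rw [hrow]; simp [hij]
    · rw [hcol l hlt i, hrow, Matrix.one_apply_ne hlt.ne']
      simp

lemma rightInv_trans {m k : ℕ} {g : Matrix (Fin m) (Fin m) R}
    {ε : Matrix (Fin m ⊕ Fin k) (Fin m ⊕ Fin k) R} (hg : ElemMat g) (hε : ElemMat ε)
    {A A₁ : Matrix (Fin m) (Fin m) R} {A' A₁' : Matrix (Fin m) (Fin k) R}
    (h : g * fromCols A A' * ε = fromCols A₁ A₁') (hS : ∃ (P : Matrix (Fin m) (Fin m) R) (Q : Matrix (Fin k) (Fin m) R), A * P + A' * Q = 1) :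
    ∃ (P : Matrix (Fin m) (Fin m) R) (Q : Matrix (Fin k) (Fin m) R), A₁ * P + A₁' * Q = 1 := by
  obtain ⟨P, Q, hPQ⟩ := hS
  obtain ⟨g', -, h1, -⟩ := hg.exists_inv
  obtain ⟨ε', -, h3, -⟩ := hε.exists_inv
  rw [← fromCols_mul_fromRows] at hPQ
  set Y := ε' * fromRows P Q * g'
  refine ⟨Y.toRows₁, Y.toRows₂, ?_⟩
  rw [← fromCols_mul_fromRows, fromRows_toRows, ← h]
  calc g * fromCols A A' * ε * (ε' * fromRows P Q * g')
      = g * (fromCols A A' * ((ε * ε') * fromRows P Q)) * g' := by simp only [Matrix.mul_assoc]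
    _ = 1 := by rw [h3, Matrix.one_mul, hPQ, Matrix.mul_one, h1]

lemma iterStep {m k : ℕ} (h : SRCond R (k + k))
    (A B : Matrix (Fin m) (Fin m) R) (A' B' : Matrix (Fin m) (Fin k) R)
    (hS : ∃ (P : Matrix (Fin m) (Fin m) R) (Q : Matrix (Fin k) (Fin m) R), A * P + A' * Q = 1) (hT : ∃ (P : Matrix (Fin m) (Fin m) R) (Q : Matrix (Fin k) (Fin m) R), B * P + B' * Q = 1)
    (j : ℕ) (hjm : j ≤ m) :
    ∃ (g : Matrix (Fin m) (Fin m) R) (ε₁ ε₂ : Matrix (Fin m ⊕ Fin k) (Fin m ⊕ Fin k) R)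
      (A₁ B₁ : Matrix (Fin m) (Fin m) R) (A₁' B₁' : Matrix (Fin m) (Fin k) R),
      ElemMat g ∧ ElemMat ε₁ ∧ ElemMat ε₂ ∧
      g * fromCols A A' * ε₁ = fromCols A₁ A₁' ∧ g * fromCols B B' * ε₂ = fromCols B₁ B₁' ∧
      ∀ l : Fin m, (l : ℕ) < j → ∀ i, (A₁ + B₁) i l = (1 : Matrix (Fin m) (Fin m) R) i l := by
  induction j with
  | zero =>
    exact ⟨1, 1, 1, A, B, A', B', ElemMat.one, ElemMat.one, ElemMat.one, by simp, by simp,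
      fun l hl => absurd hl (Nat.not_lt_zero _)⟩
  | succ j ih =>
    obtain ⟨g, ε₁, ε₂, A₁, B₁, A₁', B₁', hg, h1, h2, eA, eB, hl⟩ := ih (by omega)
    obtain ⟨g', δ₁, δ₂, A₂, B₂, A₂', B₂', hg', h1', h2', eA', eB', hl'⟩ :=
      rowStep h ⟨j, hjm⟩ A₁ B₁ A₁' B₁' (rightInv_trans hg h1 eA hS) (rightInv_trans hg h2 eB hT)
        (fun l hlt => hl l hlt)
    refine ⟨g' * g, ε₁ * δ₁, ε₂ * δ₂, A₂, B₂, A₂', B₂', hg'.mul hg, h1.mul h1', h2.mul h2',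
      ?_, ?_, fun l hlt => hl' l (Fin.le_def.2 (Nat.lt_succ_iff.1 hlt))⟩
    · rw [← eA', ← eA]; simp only [Matrix.mul_assoc]
    · rw [← eB', ← eB]; simp only [Matrix.mul_assoc]

lemma mn_blocks {m k : ℕ} (h : SRCond R (k + k))
    (A B : Matrix (Fin m) (Fin m) R) (A' B' : Matrix (Fin m) (Fin k) R)
    (hS : ∃ (P : Matrix (Fin m) (Fin m) R) (Q : Matrix (Fin k) (Fin m) R), A * P + A' * Q = 1) (hT : ∃ (P : Matrix (Fin m) (Fin m) R) (Q : Matrix (Fin k) (Fin m) R), B * P + B' * Q = 1) :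
    ∃ (ε₁ ε₂ : Matrix (Fin m ⊕ Fin k) (Fin m ⊕ Fin k) R)
      (X : Matrix (Fin m) (Fin m) R) (α : Matrix (Fin m) (Fin k) R),
      ElemMat ε₁ ∧ ElemMat ε₂ ∧
      fromCols A A' * ε₁ = fromCols X α ∧ fromCols B B' * ε₂ = fromCols (1 - X) α := by
  obtain ⟨g, ε₁, ε₂, A₁, B₁, A₁', B₁', hg, h1, h2, eA, eB, hl⟩ :=
    iterStep h A B A' B' hS hT m le_rfl
  have hAB : A₁ + B₁ = 1 := by
    ext i l
    exact hl l l.2 i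
  obtain ⟨g', -, hgg', hg'g⟩ := hg.exists_inv
  set X := g' * A₁ * g with hX
  have hB : g' * B₁ * g = 1 - X := by
    rw [eq_sub_of_add_eq' hAB, Matrix.mul_sub, Matrix.sub_mul, Matrix.mul_one, hg'g]
  have cA : fromCols A A' * (ε₁ * fromBlocks g 0 0 1) = fromCols X (g' * A₁') := by
    have : fromCols A A' * ε₁ = g' * fromCols A₁ A₁' := by
      rw [← eA, ← Matrix.mul_assoc, ← Matrix.mul_assoc, hg'g, Matrix.one_mul]
    rw [← Matrix.mul_assoc, this, mul_fromCols, fromCols_mul_fromBlocks]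
    simp [hX]
  have cB : fromCols B B' * (ε₂ * fromBlocks g 0 0 1) = fromCols (1 - X) (g' * B₁') := by
    have : fromCols B B' * ε₂ = g' * fromCols B₁ B₁' := by
      rw [← eB, ← Matrix.mul_assoc, ← Matrix.mul_assoc, hg'g, Matrix.one_mul]
    rw [← Matrix.mul_assoc, this, mul_fromCols, fromCols_mul_fromBlocks, ← hB]
    simp
  generalize g' * A₁' = a at cA
  generalize g' * B₁' = b at cB
  refine ⟨ε₁ * fromBlocks g 0 0 1 * fromBlocks 1 (b - a) 0 1,
    ε₂ * fromBlocks g 0 0 1 * fromBlocks 1 (a - b) 0 1, X, a + X * (b - a),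
    (h1.mul hg.diag).mul (ElemMat.upper _), (h2.mul hg.diag).mul (ElemMat.upper _), ?_, ?_⟩
  · rw [← Matrix.mul_assoc, cA, fromCols_mul_fromBlocks]
    simp [add_comm]
  · rw [← Matrix.mul_assoc, cB, fromCols_mul_fromBlocks]
    have : (1 - X) * (a - b) + b = a + X * (b - a) := by
      simp only [Matrix.sub_mul, Matrix.mul_sub, Matrix.one_mul]; abel
    simp [this]

end helpers

/-- **Generalised Mennicke–Newman lemma.**  Let `R` be a commutative noetherian ring with
`sdim R = d ≤ 2(n−m) − 1` (so `sr_{d+1}(R)` holds), `m ≥ 2`, `n = m + k > m`.  For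
`S, T ∈ Um_{m,n}(R)` there are `ε₁, ε₂ ∈ E_n(R)` with `Sε₁ = (X, α)` and
`Tε₂ = (I_m − X, α)` for some `X ∈ M_{m×m}(R)`, `α ∈ M_{m×(n−m)}(R)`. -/
theorem mennicke_newman_matrices {R : Type*} [CommRing R] [IsNoetherianRing R]
    (d m k : ℕ) (hm : 2 ≤ m) (hk : 1 ≤ k) (hsr : SRCond R (d + 1)) (hd : d ≤ 2 * k - 1)
    (S T : Matrix (Fin m) (Fin (m + k)) R)
    (hS : RightInvertible S) (hT : RightInvertible T) :
    ∃ (ε₁ ε₂ : Matrix (Fin (m + k)) (Fin (m + k)) R)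
      (X : Matrix (Fin m) (Fin m) R) (α : Matrix (Fin m) (Fin k) R),
      IsElementary ε₁ ∧ IsElementary ε₂ ∧
      S * ε₁ = appendCols X α ∧ T * ε₂ = appendCols (1 - X) α := by
  have hsr' : SRCond R (k + k) := srcond_mono (by omega) hsr
  let e : Fin m ⊕ Fin k ≃ Fin (m + k) := finSumFinEquiv
  have key : ∀ U : Matrix (Fin m) (Fin (m + k)) R, RightInvertible U →
      ∃ (A : Matrix (Fin m) (Fin m) R) (A' : Matrix (Fin m) (Fin k) R),
        U = (Matrix.fromCols A A').submatrix id e.symm ∧ ∃ (P : Matrix (Fin m) (Fin m) R) (Q : Matrix (Fin k) (Fin m) R), A * P + A' * Q = 1 := by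
    rintro U ⟨V, hV⟩
    refine ⟨(U.submatrix id e).toCols₁, (U.submatrix id e).toCols₂, ?_,
      (V.submatrix e id).toRows₁, (V.submatrix e id).toRows₂, ?_⟩
    · rw [Matrix.fromCols_toCols]; ext i j; simp
    · rw [← Matrix.fromCols_mul_fromRows, Matrix.fromCols_toCols, Matrix.fromRows_toRows,
        Matrix.submatrix_mul_equiv, hV]
      simp
  have happ : ∀ (X : Matrix (Fin m) (Fin m) R) (α : Matrix (Fin m) (Fin k) R),
      appendCols X α = (Matrix.fromCols X α).submatrix id e.symm := by
    intro X α
    ext i j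
    obtain ⟨j, rfl⟩ := e.surjective j
    rcases j with j | j <;> simp [appendCols, e]
  obtain ⟨A, A', rfl, hA⟩ := key S hS
  obtain ⟨B, B', rfl, hB⟩ := key T hT
  obtain ⟨ε₁, ε₂, X, α, h1, h2, eA, eB⟩ := mn_blocks hsr' A B A' B' hA hB
  refine ⟨ε₁.submatrix e.symm e.symm, ε₂.submatrix e.symm e.symm, X, α,
    h1.reindex e, h2.reindex e, ?_, ?_⟩
  · rw [Matrix.submatrix_mul_equiv, eA, happ]
  · rw [Matrix.submatrix_mul_equiv, eB, happ]
end

section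
/- Let R be a local noetherian commutative ring of Krull dimension d, with d ≥ 2 and d! invertible in R, and let n ≥ d+1. Then the map Row₁ : Um_{2,n}(R[X])/E_n(R[X]) → Um_{1,n}(R[X])/E_n(R[X]), which sends the orbit of a right invertible 2×n matrix over the polynomial ring R[X] to the orbit of its first row, is surjective. Equivalently: for every unimodular row v ∈ Um_n(R[X]) there exist a right invertible matrix S ∈ Um_{2,n}(R[X]) and ε ∈ E_n(R[X]) such that the first row of S equals vε. -/
/-! ### Elementary equivalence of vectors -/

section ElemEq

/-- One elementary operation. -/
def Stp {A ι : Type*} [CommRing A] [DecidableEq ι] (v w : ι → A) : Prop :=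
  ∃ (i j : ι) (c : A), i ≠ j ∧ w = Function.update v j (v j + c * v i)

/-- Elementary equivalence. -/
def EEq {A ι : Type*} [CommRing A] [DecidableEq ι] (v w : ι → A) : Prop :=
  Relation.ReflTransGen Stp v w

/-- Unimodular vectors over any index set. -/
def Uni {A ι : Type*} [CommRing A] (v : ι → A) : Prop := Ideal.span (Set.range v) = ⊤

/-- There is a unimodular vector orthogonal to `v`. -/
def CProp {A ι : Type*} [CommRing A] [Fintype ι] (v : ι → A) : Prop :=
  ∃ x : ι → A, Uni x ∧ ∑ i, v i * x i = 0

set_option linter.unusedSectionVars false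

variable {A B ι κ : Type*} [CommRing A] [CommRing B] [DecidableEq ι] [DecidableEq κ]

theorem uni_iff [Fintype ι] {v : ι → A} : Uni v ↔ ∃ w : ι → A, ∑ i, v i * w i = 1 := by
  unfold Uni
  rw [Ideal.eq_top_iff_one, Ideal.mem_span_range_iff_exists_fun]
  constructor <;> rintro ⟨c, hc⟩ <;> exact ⟨c, by rw [← hc]; simp [mul_comm]⟩

theorem Uni.map {v : ι → A} (h : Uni v) (f : A →+* B) : Uni (fun i => f (v i)) := by
  unfold Uni at *
  have := congrArg (Ideal.map f) h
  rw [Ideal.map_span, Ideal.map_top, ← Set.range_comp] at this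
  exact this

theorem Stp.symm {v w : ι → A} (h : Stp v w) : Stp w v := by
  obtain ⟨i, j, c, hij, rfl⟩ := h
  refine ⟨i, j, -c, hij, ?_⟩
  funext k
  by_cases hk : k = j
  · subst hk; simp [hij]
  · simp [hk]

theorem EEq.refl (v : ι → A) : EEq v v := Relation.ReflTransGen.refl

theorem EEq.trans {u v w : ι → A} (h : EEq u v) (h' : EEq v w) : EEq u w :=
  Relation.ReflTransGen.trans h h'

theorem Stp.eeq {v w : ι → A} (h : Stp v w) : EEq v w := Relation.ReflTransGen.single h

theorem EEq.symm {v w : ι → A} (h : EEq v w) : EEq w v := by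
  induction h with
  | refl => exact EEq.refl _
  | tail _ h ih => exact EEq.trans (Stp.eeq h.symm) ih

theorem EEq.step (v : ι → A) {i j : ι} (c : A) (hij : i ≠ j) :
    EEq v (Function.update v j (v j + c * v i)) := Stp.eeq ⟨i, j, c, hij, rfl⟩

theorem Stp.span_le {v w : ι → A} (h : Stp v w) :
    Ideal.span (Set.range w) ≤ Ideal.span (Set.range v) := by
  obtain ⟨i, j, c, hij, rfl⟩ := h
  rw [Ideal.span_le]
  rintro _ ⟨k, rfl⟩
  have hm : ∀ l, v l ∈ Ideal.span (Set.range v) := fun l => Ideal.subset_span ⟨l, rfl⟩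
  by_cases hk : k = j
  · subst hk
    simp only [Function.update_self]
    exact add_mem (hm _) (Ideal.mul_mem_left _ _ (hm _))
  · simpa [hk] using hm k

theorem EEq.span_eq {v w : ι → A} (h : EEq v w) :
    Ideal.span (Set.range w) = Ideal.span (Set.range v) := by
  induction h with
  | refl => rfl
  | tail _ h ih => rw [← ih]; exact le_antisymm h.span_le h.symm.span_le

theorem EEq.uni {v w : ι → A} (h : EEq v w) (hv : Uni v) : Uni w := by
  unfold Uni at *; rw [h.span_eq, hv]

theorem EEq.cprop [Fintype ι] {v w : ι → A} (h : EEq v w) (hv : CProp v) : CProp w := by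
  induction h with
  | refl => exact hv
  | tail _ h ih =>
    obtain ⟨x, hx, hs⟩ := ih
    obtain ⟨i, j, c, hij, rfl⟩ := h
    rename_i v' _
    refine ⟨Function.update x i (x i + (-c) * x j), (EEq.step x (-c) hij.symm).uni hx, ?_⟩
    have e1 : ∀ k, Function.update v' j (v' j + c * v' i) k *
        Function.update x i (x i + (-c) * x j) k =
        v' k * x k + ((if k = j then c * v' i * x j else 0)
          + (if k = i then - (c * v' i * x j) else 0)) := by
      intro k
      by_cases h1 : k = j
      · subst h1
        simp [hij.symm]; ring
      · by_cases h2 : k = i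
        · subst h2; simp [h1]; ring
        · simp [h1, h2]
    simp only [e1, Finset.sum_add_distrib, hs]
    simp

theorem EEq.map {v w : ι → A} (h : EEq v w) (f : A →+* B) :
    EEq (fun i => f (v i)) (fun i => f (w i)) := by
  induction h with
  | refl => exact EEq.refl _
  | tail _ h ih =>
    refine ih.trans ?_
    obtain ⟨i, j, c, hij, rfl⟩ := h
    refine Stp.eeq ⟨i, j, f c, hij, ?_⟩
    funext k
    by_cases hk : k = j
    · subst hk; simp
    · simp [hk]

theorem EEq.lift {f : A →+* B} (hf : Function.Surjective f) {v : ι → A} {w : ι → B}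
    (h : EEq (fun i => f (v i)) w) : ∃ v', EEq v v' ∧ ∀ i, f (v' i) = w i := by
  induction h with
  | refl => exact ⟨v, EEq.refl _, fun _ => rfl⟩
  | tail _ h ih =>
    obtain ⟨v', h1, h2⟩ := ih
    obtain ⟨i, j, c, hij, rfl⟩ := h
    obtain ⟨c', rfl⟩ := hf c
    refine ⟨_, h1.trans (EEq.step v' c' hij), fun k => ?_⟩
    by_cases hk : k = j
    · subst hk; simp [h2]
    · simp [hk, h2]

theorem EEq.add_span (v : ι → A) (j : ι) (S : Set ι) (hj : j ∉ S) {s : A}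
    (hs : s ∈ Ideal.span (v '' S)) : EEq v (Function.update v j (v j + s)) := by
  have key : ∀ s ∈ Ideal.span (v '' S), ∀ (a : A) (v' : ι → A), (∀ k, k ≠ j → v' k = v k) →
      EEq v' (Function.update v' j (v' j + a * s)) := by
    intro s hs
    induction hs using Submodule.span_induction with
    | mem x hx =>
      obtain ⟨i, hi, rfl⟩ := hx
      intro a v' hv'
      have hij : i ≠ j := fun h => hj (h ▸ hi)
      have := EEq.step v' a hij
      rwa [hv' i hij] at this
    | zero => intro a v' _; simpa using EEq.refl v'
    | add x y _ _ hx hy =>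
      intro a v' hv'
      refine (hx a v' hv').trans ?_
      have := hy a (Function.update v' j (v' j + a * x)) (fun k hk => by simp [hk, hv'])
      simpa [mul_add, add_assoc] using this
    | smul b x _ hx =>
      intro a v' hv'
      simpa [mul_assoc] using hx (a * b) v' hv'
  simpa using key s hs 1 v (fun _ _ => rfl)

/-- Changing the entries in `T` by elements of the ideal generated by the other entries. -/
theorem EEq.block [Fintype ι] (v w : ι → A) (T : Finset ι) (h1 : ∀ i, i ∉ T → w i = v i)
    (h2 : ∀ i ∈ T, w i - v i ∈ Ideal.span (v '' {k | k ∉ T})) : EEq v w := by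
  have key : ∀ s : Finset ι, s ⊆ T → EEq v (fun i => if i ∈ s then w i else v i) := by
    intro s
    induction s using Finset.induction_on with
    | empty => intro _; simpa using EEq.refl v
    | insert j s hj ih =>
      intro hs
      have hs' : s ⊆ T := fun x hx => hs (Finset.mem_insert_of_mem hx)
      have hjT : j ∈ T := hs (Finset.mem_insert_self _ _)
      refine (ih hs').trans ?_
      have := EEq.add_span (fun i => if i ∈ s then w i else v i) j {k | k ∉ T}
        (by simpa using hjT) (s := w j - v j) (by
          have e : (fun i => if i ∈ s then w i else v i) '' {k | k ∉ T} = v '' {k | k ∉ T} := by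
            apply Set.image_congr
            intro a ha
            rw [if_neg (fun h => ha (hs' h))]
          rw [e]; exact h2 j hjT)
      convert this using 1
      funext k
      by_cases hk : k = j
      · subst hk; simp [hj]
      · simp [hk]
  have := key T (subset_refl _)
  convert this using 1
  funext k
  by_cases hk : k ∈ T
  · simp [hk]
  · simp [hk, h1]

/-- prepend an entry -/
def ocons (a : A) (x : ι → A) : Option ι → A := fun o => o.elim a x

@[simp] theorem ocons_none (a : A) (x : ι → A) : ocons a x none = a := rfl
@[simp] theorem ocons_some (a : A) (x : ι → A) (i : ι) : ocons a x (some i) = x i := rfl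

theorem EEq.ocons {v w : ι → A} (h : EEq v w) (a : A) : EEq (ocons a v) (_root_.ocons a w) := by
  induction h with
  | refl => exact EEq.refl _
  | tail _ h ih =>
    refine ih.trans ?_
    obtain ⟨i, j, c, hij, rfl⟩ := h
    refine Stp.eeq ⟨some i, some j, c, by simpa using hij, ?_⟩
    funext k
    rcases k with _ | k
    · simp
    · by_cases hk : k = j
      · subst hk; simp
      · simp [hk]

theorem EEq.ocons_lift [Fintype ι] {f : A →+* B} (hf : Function.Surjective f) {a : A}
    (hk : ∀ y, f y = 0 → y ∈ Ideal.span {a}) {x x' : ι → A}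
    (h : EEq (fun i => f (x i)) (fun i => f (x' i))) :
    EEq (_root_.ocons a x) (_root_.ocons a x') := by
  obtain ⟨x2, h1, h2⟩ := h.lift hf
  refine (h1.ocons a).trans ?_
  refine EEq.block _ _ (Finset.univ.filter (fun o => o ≠ none)) ?_ ?_
  · intro i hi
    simp at hi; subst hi; rfl
  · rintro (_ | i) hi
    · simp at hi
    · have : x' i - x2 i ∈ Ideal.span {a} := hk _ (by simp [h2])
      refine Ideal.span_mono ?_ this
      rintro _ rfl
      exact ⟨none, by simp, rfl⟩

/-- reindexing -/
theorem EEq.reindex {v w : ι → A} (h : EEq v w) (e : κ ≃ ι) : EEq (v ∘ e) (w ∘ e) := by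
  induction h with
  | refl => exact EEq.refl _
  | tail _ h ih =>
    refine ih.trans ?_
    obtain ⟨i, j, c, hij, rfl⟩ := h
    refine Stp.eeq ⟨e.symm i, e.symm j, c, by simpa using hij, ?_⟩
    funext k
    by_cases hk : k = e.symm j
    · subst hk; simp
    · have : e k ≠ j := fun h => hk (by simp [← h])
      simp [hk, this]

theorem EEq.of_reindex {v w : ι → A} (e : κ ≃ ι) (h : EEq (v ∘ e) (w ∘ e)) : EEq v w := by
  have := h.reindex e.symm
  simpa [Function.comp_assoc] using this

theorem CProp.of_reindex [Fintype ι] [Fintype κ] {v : ι → A} (e : κ ≃ ι) (h : CProp (v ∘ e)) :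
    CProp v := by
  obtain ⟨x, hx, hs⟩ := h
  refine ⟨x ∘ e.symm, ?_, ?_⟩
  · unfold Uni at *
    rwa [Set.range_comp, e.symm.range_eq_univ, Set.image_univ]
  · rw [← hs, ← e.sum_comp]
    simp

theorem Uni.reindex {v : ι → A} (h : Uni v) (e : κ ≃ ι) : Uni (v ∘ e) := by
  unfold Uni at *
  rwa [Set.range_comp, e.range_eq_univ, Set.image_univ]

/-- Swapping with a sign. -/
theorem EEq.swap (v : ι → A) {i j : ι} (hij : i ≠ j) :
    EEq v (Function.update (Function.update v i (v j)) j (- v i)) := by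
  have h1 := EEq.step v 1 hij.symm
  refine h1.trans ?_
  have h2 := EEq.step (Function.update v i (v i + 1 * v j)) (-1) hij
  refine h2.trans ?_
  have h3 := EEq.step (Function.update (Function.update v i (v i + 1 * v j)) j
    (Function.update v i (v i + 1 * v j) j + (-1) * Function.update v i (v i + 1 * v j) i))
      1 hij.symm
  convert h3 using 1
  funext k
  by_cases h1 : k = i
  · subst h1; simp [hij, hij.symm]
  · by_cases h2 : k = j
    · subst h2; simp [hij.symm]
    · simp [h1, h2]

/-- Whitehead: scaling two entries by mutually inverse units. -/
theorem EEq.whitehead (v : ι → A) {i j : ι} (hij : i ≠ j) (u u' : A) (huu : u * u' = 1) :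
    EEq v (Function.update (Function.update v i (u * v i)) j (u' * v j)) := by
  have h1 := EEq.step v u hij
  set v1 := Function.update v j (v j + u * v i) with hv1
  have h2 := EEq.step v1 (-u') hij.symm
  set v2 := Function.update v1 i (v1 i + (-u') * v1 j) with hv2
  have h3 := EEq.step v2 u hij
  set v3 := Function.update v2 j (v2 j + u * v2 i) with hv3
  have h4 := EEq.swap v3 hij
  refine ((h1.trans h2).trans (h3.trans h4)).trans ?_
  have e : Function.update (Function.update v3 i (v3 j)) j (- v3 i) =
      Function.update (Function.update v i (u * v i)) j (u' * v j) := by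
    funext k
    by_cases h1 : k = j
    · subst h1
      simp [hv3, hv2, hv1, hij]
      linear_combination v i * huu
    · by_cases h2 : k = i
      · subst h2
        simp [hv3, hv2, hv1, hij, hij.symm]
        linear_combination (-(v j) - u * v k) * huu
      · simp [h1, h2, hv3, hv2, hv1]
  rw [e]
  exact EEq.refl _

theorem EEq.single_single (i j : ι) : EEq (Pi.single i 1 : ι → A) (Pi.single j 1 : ι → A) := by
  by_cases hij : i = j
  · subst hij; exact EEq.refl _
  have h := (EEq.step (Pi.single i 1 : ι → A) 1 hij)
  refine h.trans ?_
  have h2 := EEq.step (Function.update (Pi.single i 1 : ι → A) j ((Pi.single i 1 : ι → A) j +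
    1 * (Pi.single i 1 : ι → A) i)) (-1) (Ne.symm hij)
  convert h2 using 1
  funext k
  by_cases h1 : k = i
  · subst h1; simp [hij]
  · by_cases h2 : k = j
    · subst h2; simp [h1]
    · simp [h1, h2]

theorem EEq.of_unit_entry [Fintype ι] (v : ι → A) (i j k : ι) (hij : i ≠ j)
    (hu : IsUnit (v i)) : EEq v (Pi.single k 1) := by
  obtain ⟨u, hu⟩ := hu
  have h1 := EEq.step v ((1 - v j) * ((u⁻¹ : Aˣ) : A)) hij
  have e : v j + (1 - v j) * ((u⁻¹ : Aˣ) : A) * v i = 1 := by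
    rw [← hu, mul_assoc, Units.inv_mul]; ring
  rw [e] at h1
  refine h1.trans (EEq.trans ?_ (EEq.single_single j k))
  refine EEq.block _ _ (Finset.univ.erase j) ?_ ?_
  · intro l hl
    simp at hl; subst hl; simp
  · intro l hl
    have : Ideal.span ((Function.update v j 1) '' {k | k ∉ Finset.univ.erase j}) = ⊤ := by
      rw [Ideal.eq_top_iff_one]
      exact Ideal.subset_span ⟨j, by simp, by simp⟩
    rw [this]; trivial

theorem CProp.single [Fintype ι] (i j : ι) (hij : i ≠ j) : CProp (Pi.single i 1 : ι → A) := by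
  refine ⟨Pi.single j 1, ?_, ?_⟩
  · unfold Uni
    rw [Ideal.eq_top_iff_one]
    exact Ideal.subset_span ⟨j, by simp⟩
  · apply Finset.sum_eq_zero
    intro k _
    by_cases hk : k = i
    · subst hk; simp [hij]
    · simp [hk]

end ElemEq

section GeneralPosition

theorem even_lemma {A κ : Type*} [CommRing A] [Fintype κ] (hκ : Even (Fintype.card κ))
    (c : κ → A) : ∃ x : κ → A, ∑ i, c i * x i = 0 ∧ ∀ i, c i ∈ Ideal.span (Set.range x) := by
  obtain ⟨k, hk⟩ := hκ
  have e : κ ≃ Fin k ⊕ Fin k := Fintype.equivOfCardEq (by simp [hk])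
  let x' : Fin k ⊕ Fin k → A := Sum.elim (fun i => c (e.symm (Sum.inr i)))
    (fun i => - c (e.symm (Sum.inl i)))
  refine ⟨x' ∘ e, ?_, ?_⟩
  · rw [← e.symm.sum_comp, Fintype.sum_sum_type]
    simp only [Function.comp, Equiv.apply_symm_apply]
    simp only [x', Sum.elim_inl, Sum.elim_inr]
    rw [← Finset.sum_add_distrib]
    apply Finset.sum_eq_zero
    intro i _
    ring
  · intro i
    have hm : ∀ l, x' l ∈ Ideal.span (Set.range (x' ∘ e)) := fun l =>
      Ideal.subset_span ⟨e.symm l, by simp⟩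
    obtain ⟨l, rfl⟩ := e.symm.surjective i
    rcases l with l | l
    · have := hm (Sum.inr l)
      simpa [x'] using this
    · have := hm (Sum.inl l)
      simpa [x'] using this

theorem avoid {S : Type*} [CommRing S] (x y : S) (T : Finset (Ideal S))
    (hT : ∀ P ∈ T, P.IsPrime ∧ (x ∉ P ∨ y ∉ P)) : ∃ l : S, ∀ P ∈ T, x + l * y ∉ P := by
  classical
  induction hn : T.card using Nat.strong_induction_on generalizing T with
  | _ n ih =>
    rcases T.eq_empty_or_nonempty with rfl | hne
    · exact ⟨0, by simp⟩
    obtain ⟨P0, hP0⟩ := T.exists_minimal hne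
    obtain ⟨hP0T, hmin⟩ := hP0
    obtain ⟨l, hl⟩ := ih (T.erase P0).card (by rw [← hn]; exact Finset.card_erase_lt_of_mem hP0T)
      (T.erase P0) (fun P hP => hT P (Finset.mem_of_mem_erase hP)) rfl
    by_cases h0 : x + l * y ∈ P0
    · have hy : y ∉ P0 := by
        rcases (hT P0 hP0T).2 with h | h
        · intro hy
          exact h (by simpa using sub_mem h0 (P0.mul_mem_left l hy))
        · exact h
      have : ¬ (T.erase P0).inf id ≤ P0 := by
        intro hle
        have := (hT P0 hP0T).1
        obtain ⟨Q, hQ, hQP⟩ := (Ideal.IsPrime.inf_le' this).1 hle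
        have h2 := hmin (Finset.mem_of_mem_erase hQ) hQP
        exact (Finset.ne_of_mem_erase hQ) (le_antisymm hQP h2)
      obtain ⟨μ, hμ, hμ0⟩ := SetLike.not_le_iff_exists.1 this
      refine ⟨l + μ, fun P hP => ?_⟩
      by_cases hPP : P = P0
      · subst hPP
        intro hmem
        have h3 : μ * y ∈ P := by
          have := sub_mem hmem h0
          convert this using 1; ring
        rcases (hT P hP).1.mem_or_mem h3 with h | h
        · exact hμ0 h
        · exact hy h
      · intro hmem
        have hPe : P ∈ T.erase P0 := Finset.mem_erase.2 ⟨hPP, hP⟩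
        have hμP : μ ∈ P := (Finset.inf_le (f := id) hPe) hμ
        apply hl P hPe
        have := sub_mem hmem (P.mul_mem_right y hμP)
        convert this using 1; ring
    · refine ⟨l, fun P hP => ?_⟩
      by_cases hPP : P = P0
      · subst hPP; exact h0
      · exact hl P (Finset.mem_erase.2 ⟨hPP, hP⟩)

theorem gp1 {S κ : Type*} [CommRing S] [IsNoetherianRing S] [Fintype κ] (I : Ideal S) (h : ℕ)
    (hI : ∀ P : Ideal S, P.IsPrime → I ≤ P → (h : ℕ∞) ≤ P.height) (y : κ → S) (z : S)
    (htop : I ⊔ Ideal.span (Set.range y) ⊔ Ideal.span {z} = ⊤) :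
    ∃ l : κ → S, ∀ P : Ideal S, P.IsPrime → I ≤ P → (∀ i, y i + l i * z ∈ P) →
      ((h + Fintype.card κ : ℕ) : ℕ∞) ≤ P.height := by
  classical
  have key : ∀ s : Finset κ, ∃ l : κ → S, ∀ P : Ideal S, P.IsPrime → I ≤ P →
      (∀ i ∈ s, y i + l i * z ∈ P) → z ∉ P → ((h + s.card : ℕ) : ℕ∞) ≤ P.height := by
    intro s
    induction s using Finset.induction_on with
    | empty => exact ⟨0, fun P hP hIP _ _ => by simpa using hI P hP hIP⟩
    | insert j s hj ih =>
      obtain ⟨l, hl⟩ := ih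
      set J : Ideal S := I ⊔ Ideal.span ((fun i => y i + l i * z) '' s) with hJ
      have hJle : ∀ P : Ideal S, J ≤ P ↔ I ≤ P ∧ ∀ i ∈ s, y i + l i * z ∈ P := by
        intro P
        rw [hJ, sup_le_iff, Ideal.span_le]
        simp [Set.subset_def]
      have hfin := J.finite_minimalPrimes_of_isNoetherianRing
      obtain ⟨c, hc⟩ := avoid (y j) z (hfin.toFinset.filter (fun Q => z ∉ Q)) (by
        intro P hP
        simp only [Finset.mem_filter, Set.Finite.mem_toFinset] at hP
        exact ⟨hP.1.1.1, Or.inr hP.2⟩)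
      refine ⟨Function.update l j c, fun P hP hIP hyP hzP => ?_⟩
      have hs : ∀ i ∈ s, y i + l i * z ∈ P := by
        intro i hi
        have := hyP i (Finset.mem_insert_of_mem hi)
        have hij : i ≠ j := fun h => hj (h ▸ hi)
        simpa [hij] using this
      have hjP : y j + c * z ∈ P := by simpa using hyP j (Finset.mem_insert_self _ _)
      obtain ⟨Q, hQ, hQP⟩ := Ideal.exists_minimalPrimes_le ((hJle P).2 ⟨hIP, hs⟩)
      have hzQ : z ∉ Q := fun h => hzP (hQP h)
      have hjQ : y j + c * z ∉ Q := hc Q (by simp [hQ, hzQ])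
      have hlt : Q < P := lt_of_le_of_ne hQP (fun h => hjQ (h ▸ hjP))
      have hQp : Q.IsPrime := hQ.1.1
      have hQJ := (hJle Q).1 hQ.1.2
      have h1 := hl Q hQp hQJ.1 hQJ.2 hzQ
      have h2 := Ideal.height_add_one_le_of_lt_of_isPrime hlt
      rw [Finset.card_insert_of_notMem hj]
      refine le_trans ?_ h2
      push_cast at h1 ⊢
      rw [← add_assoc]
      gcongr
  obtain ⟨l, hl⟩ := key Finset.univ
  refine ⟨l, fun P hP hIP hy => hl P hP hIP (fun i _ => hy i) ?_⟩
  intro hz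
  apply hP.ne_top
  rw [eq_top_iff, ← htop, sup_le_iff, sup_le_iff]
  refine ⟨⟨hIP, ?_⟩, ?_⟩
  · rw [Ideal.span_le]
    rintro _ ⟨i, rfl⟩
    simpa using sub_mem (hy i) (P.mul_mem_left (l i) hz)
  · rw [Ideal.span_le]; simpa using hz

end GeneralPosition

section Mon
open Polynomial

variable {S : Type*} [CommRing S]

/-- an element of `P` not in `p[X]` of minimal degree -/
theorem exists_min_elt (P : Ideal S[X]) (hne : ¬ P ≤ (P.comap C).map C) :
    ∃ f ∈ P, f.leadingCoeff ∉ P.comap C ∧ 0 < f.natDegree ∧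
      ∀ g ∈ P, g.natDegree < f.natDegree → g ∈ (P.comap C).map C := by
  classical
  obtain ⟨f0, hf0, hf0'⟩ := SetLike.not_le_iff_exists.1 hne
  have hex : ∃ n, ∃ f ∈ P, f ∉ (P.comap C).map C ∧ f.natDegree = n := ⟨_, f0, hf0, hf0', rfl⟩
  obtain ⟨f, hf, hf', hn⟩ := Nat.find_spec hex
  have hmin : ∀ g ∈ P, g.natDegree < f.natDegree → g ∈ (P.comap C).map C := by
    intro g hg hlt
    by_contra hg'
    exact Nat.find_min hex (hn ▸ hlt) ⟨g, hg, hg', rfl⟩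
  have hpos : 0 < f.natDegree := by
    rw [Nat.pos_iff_ne_zero]
    intro h0
    apply hf'
    rw [Polynomial.eq_C_of_natDegree_eq_zero h0] at hf ⊢
    exact Ideal.mem_map_of_mem _ hf
  refine ⟨f, hf, ?_, hpos, hmin⟩
  intro hlc
  apply hf'
  have hlc' : C f.leadingCoeff ∈ (P.comap C).map C := Ideal.mem_map_of_mem _ hlc
  have h1 : C f.leadingCoeff * X ^ f.natDegree ∈ P := P.mul_mem_right _ hlc
  have h2 : f.eraseLead ∈ P := by
    have := sub_mem hf h1
    rwa [self_sub_C_mul_X_pow] at this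
  have h3 := hmin _ h2 (by
    have := eraseLead_natDegree_le f
    omega)
  have := add_mem h3 (Ideal.mul_mem_right (X ^ f.natDegree) _ hlc')
  rwa [eraseLead_add_C_mul_X_pow] at this

theorem height_le_under_add_one [IsNoetherianRing S] (P : Ideal S[X]) [P.IsPrime] :
    P.height ≤ (P.comap C).height + 1 := by
  have hp : (P.under S) = P.comap C := rfl
  have h := Ideal.height_le_height_add_of_liesOver (P.under S) P
  refine h.trans ?_
  rw [hp]
  gcongr
  have halg : (algebraMap S S[X]) = C := rfl
  rw [halg]
  set J := (P.comap C).map C with hJ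
  have hJP : J ≤ P := Ideal.map_comap_le
  have hJprime : J.IsPrime := by
    rw [hJ]; exact Ideal.isPrime_map_C_of_isPrime
  have hprime : (P.map (Ideal.Quotient.mk J)).IsPrime :=
    Ideal.map_isPrime_of_surjective Ideal.Quotient.mk_surjective (by simpa using hJP)
  by_cases hle : P ≤ J
  · have : P.map (Ideal.Quotient.mk J) = ⊥ := by
      rw [← Ideal.map_quotient_self J, le_antisymm hle hJP]
    rw [this, Ideal.height_bot]
    simp
  obtain ⟨f, hf, hlc, hpos, hmin⟩ := exists_min_elt P hle
  have key : P.map (Ideal.Quotient.mk J) ∈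
      (Ideal.span {Ideal.Quotient.mk J f}).minimalPrimes := by
    refine ⟨⟨hprime, ?_⟩, ?_⟩
    · rw [Ideal.span_le, Set.singleton_subset_iff]; exact Ideal.mem_map_of_mem _ hf
    · rintro Q ⟨hQ, hfQ⟩ hQP
      rw [Ideal.map_le_iff_le_comap]
      set Q' := Q.comap (Ideal.Quotient.mk J) with hQ'
      have hQ'p : Q'.IsPrime := Ideal.comap_isPrime _ _
      have hfQ' : f ∈ Q' := by
        have := (Ideal.span_le.1 hfQ) (Set.mem_singleton _)
        exact this
      have hJQ : J ≤ Q' := by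
        intro x hx
        rw [hQ', Ideal.mem_comap, Ideal.Quotient.eq_zero_iff_mem.2 hx]
        exact Q.zero_mem
      have hQ'P : Q' ≤ P := by
        have := Ideal.comap_mono (f := Ideal.Quotient.mk J) hQP
        rwa [Ideal.comap_map_of_surjective' _ Ideal.Quotient.mk_surjective, Ideal.mk_ker,
          sup_eq_left.2 hJP] at this
      intro g hg
      induction hn : g.natDegree using Nat.strong_induction_on generalizing g with
      | _ n ih =>
        by_cases hlt : g.natDegree < f.natDegree
        · exact hJQ (hmin g hg hlt)
        push Not at hlt
        have hc := Polynomial.natDegree_cancelLeads_lt_of_natDegree_le_natDegree hlt (by omega)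
        have hcP : f.cancelLeads g ∈ P := by
          unfold cancelLeads
          exact sub_mem (P.mul_mem_left _ hg) (P.mul_mem_left _ hf)
        have := ih _ (hn ▸ hc) hcP rfl
        unfold cancelLeads at this
        have h2 := add_mem this (Q'.mul_mem_left (C g.leadingCoeff *
          X ^ (g.natDegree - f.natDegree)) hfQ')
        rw [sub_add_cancel, Nat.sub_eq_zero_of_le hlt, pow_zero, mul_one] at h2
        rcases hQ'p.mem_or_mem h2 with h3 | h3
        · exact absurd (hQ'P h3) hlc
        · exact h3
  exact Ideal.height_le_one_of_isPrincipal_of_mem_minimalPrimes _ _ key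

theorem exists_monic_of_height [IsNoetherianRing S] (k : ℕ)
    (hS : ∀ p : Ideal S, p.IsPrime → p.height ≤ k) (P : Ideal S[X]) [P.IsPrime]
    (hP : ((k + 1 : ℕ) : ℕ∞) ≤ P.height) : ∃ f ∈ P, f.Monic := by
  have h1 := height_le_under_add_one P
  have hpp : (P.comap C).IsPrime := inferInstance
  have h2 := hS _ hpp
  have h3 : (P.comap C).height = k := by
    refine le_antisymm h2 ?_
    have := hP.trans h1
    push_cast at this
    exact (ENat.add_le_add_iff_right (by simp)).1 this
  have hmax : (P.comap C).IsMaximal := by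
    obtain ⟨M, hM, hle⟩ := Ideal.exists_le_maximal _ hpp.ne_top
    rcases eq_or_lt_of_le hle with h | h
    · rwa [h]
    · have h4 := Ideal.height_add_one_le_of_lt_of_isPrime h
      rw [h3] at h4
      have h5 := h4.trans (hS M hM.isPrime)
      exfalso
      have : ((k + 1 : ℕ) : ℕ∞) ≤ (k : ℕ) := by exact_mod_cast h5
      have := Nat.cast_le.1 this
      omega
  have hne : ¬ P ≤ (P.comap C).map C := by
    intro hle
    have : P = (P.comap C).map C := le_antisymm hle Ideal.map_comap_le
    have h6 : P.height = k := by rw [this, Polynomial.height_map_C, h3]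
    rw [h6] at hP
    have := Nat.cast_le.1 hP
    omega
  obtain ⟨f, hf, hlc, hpos, -⟩ := exists_min_elt P hne
  obtain ⟨c, hc⟩ := hmax.exists_inv hlc
  obtain ⟨i, hi, hci⟩ := hc
  -- c * lc + i = 1
  refine ⟨C c * f + C i * X ^ f.natDegree, ?_, ?_⟩
  · exact add_mem (P.mul_mem_left _ hf) (P.mul_mem_right _ hi)
  · apply monic_of_natDegree_le_of_coeff_eq_one f.natDegree
    · compute_degree
    · simp only [coeff_add, coeff_C_mul, coeff_X_pow, if_true, mul_one]
      exact hci

theorem exists_monic_of_height_ideal [IsNoetherianRing S] (k : ℕ)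
    (hS : ∀ p : Ideal S, p.IsPrime → p.height ≤ k) (J : Ideal S[X])
    (hJ : ∀ P : Ideal S[X], P.IsPrime → J ≤ P → ((k + 1 : ℕ) : ℕ∞) ≤ P.height) :
    ∃ f ∈ J, f.Monic := by
  let M : Submonoid S[X] :=
    { carrier := {f | f.Monic}
      one_mem' := monic_one
      mul_mem' := fun ha hb => Monic.mul ha hb }
  by_contra hcon
  push Not at hcon
  have hd : Disjoint (J : Set S[X]) M := by
    rw [Set.disjoint_left]
    intro f hf hfM
    exact hcon f hf hfM
  obtain ⟨P, hP, hJP, hPd⟩ := Ideal.exists_le_prime_disjoint J M hd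
  obtain ⟨f, hf, hfm⟩ := exists_monic_of_height k hS P (hJ P hP hJP)
  exact Set.disjoint_left.1 hPd hf hfm

end Mon

section Horrocks
open Polynomial

variable {S : Type*} [CommRing S]

theorem ell (f : S[X]) (hfm : f.Monic) (m : ℕ) (hm : f.natDegree = m + 1) (I : Ideal S[X])
    (hf : f ∈ I) (G : Set S[X]) (hG : ∀ g ∈ G, g ∈ I ∧ g.natDegree ≤ m)
    (htop : Ideal.span {c | ∃ g ∈ G, ∃ j, g.coeff j = c} = ⊤) :
    ∃ q ∈ I, q.natDegree ≤ m ∧ q.coeff m = 1 := by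
  let L : Ideal S :=
    { carrier := {c | ∃ q ∈ I, q.natDegree ≤ m ∧ q.coeff m = c}
      zero_mem' := ⟨0, I.zero_mem, by simp, by simp⟩
      add_mem' := by
        rintro _ _ ⟨q, hq, hd, rfl⟩ ⟨q', hq', hd', rfl⟩
        exact ⟨q + q', add_mem hq hq', (natDegree_add_le _ _).trans (max_le hd hd'), by simp⟩
      smul_mem' := by
        rintro c _ ⟨q, hq, hd, rfl⟩
        exact ⟨C c * q, I.mul_mem_left _ hq, (natDegree_C_mul_le _ _).trans hd, by simp⟩ }
  have key : ∀ k ≤ m, ∀ h ∈ I, h.natDegree ≤ m → h.coeff (m - k) ∈ L := by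
    intro k
    induction k with
    | zero => intro _ h hI hd; exact ⟨h, hI, hd, by simp⟩
    | succ k ih =>
      intro hk h hI hd
      have hlm : h.coeff m ∈ L := ⟨h, hI, hd, rfl⟩
      have h1 := ih (by omega) (X * h - C (h.coeff m) * f)
        (sub_mem (I.mul_mem_left _ hI) (I.mul_mem_left _ hf)) (by
          rw [natDegree_le_iff_coeff_eq_zero]
          intro N hN
          rcases Nat.exists_eq_add_of_lt hN with ⟨t, rfl⟩
          rw [coeff_sub, coeff_X_mul, coeff_C_mul]
          rcases Nat.eq_zero_or_pos t with rfl | ht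
          · have : f.coeff (m + 0 + 1) = 1 := by
              have := hfm.coeff_natDegree
              rwa [hm] at this
            rw [this]; simp
          · rw [coeff_eq_zero_of_natDegree_lt (p := h) (by omega),
              coeff_eq_zero_of_natDegree_lt (p := f) (by omega)]
            simp)
      have e : m - k = (m - (k + 1)) + 1 := by omega
      rw [e, coeff_sub, coeff_X_mul, coeff_C_mul] at h1
      have := add_mem h1 (L.mul_mem_right (f.coeff (m - (k + 1) + 1)) hlm)
      simpa using this
  have h1 : (1 : S) ∈ L := by
    have : (⊤ : Ideal S) ≤ L := by
      rw [← htop, Ideal.span_le]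
      rintro _ ⟨g, hg, j, rfl⟩
      obtain ⟨hgI, hgd⟩ := hG g hg
      by_cases hj : j ≤ m
      · have := key (m - j) (by omega) g hgI hgd
        rwa [Nat.sub_sub_self hj] at this
      · rw [coeff_eq_zero_of_natDegree_lt (by omega)]
        exact L.zero_mem
    exact this trivial
  exact h1

theorem natDegree_modByMonic_le' {f : S[X]} (hf : f.Monic) {m : ℕ} (hm : f.natDegree = m + 1)
    (g : S[X]) : (g %ₘ f).natDegree ≤ m := by
  have h1 : f ≠ 1 := by
    rintro rfl
    simp at hm
  have := natDegree_modByMonic_lt g hf h1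
  omega

theorem monic_of_add (g q : S[X]) (m : ℕ) (hg : g.natDegree ≤ m) (hq : q.natDegree ≤ m)
    (hq1 : q.coeff m = 1) : (g + C (1 - g.coeff m) * q).Monic ∧
    (g + C (1 - g.coeff m) * q).natDegree ≤ m ∧ (g + C (1 - g.coeff m) * q).coeff m = 1 := by
  have hd : (g + C (1 - g.coeff m) * q).natDegree ≤ m :=
    (natDegree_add_le _ _).trans (max_le hg ((natDegree_C_mul_le _ _).trans hq))
  have hc : (g + C (1 - g.coeff m) * q).coeff m = 1 := by
    rw [coeff_add, coeff_C_mul, hq1]; ring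
  exact ⟨monic_of_natDegree_le_of_coeff_eq_one m hd hc, hd, hc⟩

/-- reduce all the other entries modulo a monic entry -/
theorem EEq.reduce {ι : Type*} [Fintype ι] [DecidableEq ι] (v : ι → S[X]) (i0 : ι) :
    EEq v (fun i => if i = i0 then v i0 else v i %ₘ v i0) := by
  refine EEq.block _ _ (Finset.univ.erase i0) ?_ ?_
  · intro i hi
    simp at hi; simp [hi]
  · intro i hi
    have hi' : i ≠ i0 := by simpa using hi
    simp only [hi', if_false]
    have h2 : v i0 ∈ Ideal.span (v '' {k | k ∉ Finset.univ.erase i0}) :=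
      Ideal.subset_span ⟨i0, by simp, rfl⟩
    have h3 := modByMonic_eq_sub_mul_div (v i) (v i0)
    rw [h3]
    have : v i - v i0 * (v i /ₘ v i0) - v i = - ((v i /ₘ v i0) * v i0) := by ring
    rw [this]
    exact neg_mem (Ideal.mul_mem_left _ _ h2)

variable {R : Type*} [CommRing R] [IsLocalRing R]

theorem exists_unit_coeff {ι : Type*} [Fintype ι] [DecidableEq ι] (v : ι → R[X]) (hv : Uni v)
    (i0 : ι) (hm : (v i0).Monic) (hd : 0 < (v i0).natDegree) :
    ∃ i, i ≠ i0 ∧ ∃ j, IsUnit ((v i).coeff j) := by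
  by_contra hcon
  push Not at hcon
  have h1 := hv.map (mapRingHom (IsLocalRing.residue R))
  have h0 : ∀ i, i ≠ i0 → mapRingHom (IsLocalRing.residue R) (v i) = 0 := by
    intro i hi
    ext j
    simp only [coe_mapRingHom, coeff_map, coeff_zero]
    rw [IsLocalRing.residue_eq_zero_iff]
    exact hcon i hi j
  have h2 : Ideal.span {mapRingHom (IsLocalRing.residue R) (v i0)} = ⊤ := by
    rw [eq_top_iff, ← h1, Ideal.span_le]
    rintro _ ⟨i, rfl⟩
    by_cases hi : i = i0
    · subst hi; exact Ideal.subset_span rfl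
    · simp only [h0 i hi]; exact zero_mem _
  rw [Ideal.span_singleton_eq_top] at h2
  have hm' : (mapRingHom (IsLocalRing.residue R) (v i0)).Monic := hm.map _
  have h3 := hm'.isUnit_iff.1 h2
  have h4 : (mapRingHom (IsLocalRing.residue R) (v i0)).natDegree = (v i0).natDegree :=
    hm.natDegree_map _
  rw [h3] at h4
  simp at h4
  omega

theorem horrocks_local {ι : Type*} [Fintype ι] [DecidableEq ι] (hι : 3 ≤ Fintype.card ι)
    (v : ι → R[X]) (hv : Uni v) (i0 : ι) (hm : (v i0).Monic) (k : ι) :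
    EEq v (Pi.single k 1) := by
  have hex : ∀ a b : ι, ∃ c, c ≠ a ∧ c ≠ b := by
    intro a b
    have : ({a, b} : Finset ι).card < Fintype.card ι := by
      have := Finset.card_le_two (a := a) (b := b)
      omega
    obtain ⟨c, hc⟩ := Finset.exists_mem_notMem_of_card_lt_card (s := {a, b}) (t := Finset.univ)
      (by simpa using this)
    exact ⟨c, by simpa using hc⟩
  induction hn : (v i0).natDegree generalizing v i0 with
  | zero =>
    have h1 : v i0 = 1 := hm.natDegree_eq_zero.1 hn
    obtain ⟨j, hj, -⟩ := hex i0 i0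
    exact EEq.of_unit_entry v i0 j k hj.symm (by rw [h1]; exact isUnit_one)
  | succ m ih =>
    have h1 := EEq.reduce v i0
    set w : ι → R[X] := fun i => if i = i0 then v i0 else v i %ₘ v i0 with hw
    have hwi0 : w i0 = v i0 := by simp [hw]
    have hwi : ∀ i, i ≠ i0 → (w i).natDegree ≤ m := by
      intro i hi
      simp only [hw, hi, if_false]
      exact natDegree_modByMonic_le' hm hn _
    obtain ⟨i1, hi1, j, hj⟩ := exists_unit_coeff w (h1.uni hv) i0 (hwi0 ▸ hm) (by rw [hwi0]; omega)
    obtain ⟨i2, hi20, hi21⟩ := hex i0 i1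
    obtain ⟨q, hqI, hqd, hq1⟩ := ell (v i0) hm m hn (Ideal.span (w '' {i0, i1}))
      (Ideal.subset_span ⟨i0, by simp, hwi0⟩) {w i1} (by
        rintro _ rfl
        exact ⟨Ideal.subset_span ⟨i1, by simp, rfl⟩, hwi _ hi1⟩)
      (Ideal.eq_top_of_isUnit_mem _ (Ideal.subset_span ⟨w i1, rfl, j, rfl⟩) hj)
    have h2 := EEq.add_span w i2 {i0, i1} (by simp [hi20, hi21])
      (Ideal.mul_mem_left _ (C (1 - (w i2).coeff m)) hqI)
    obtain ⟨hmon, hdeg, hco⟩ := monic_of_add (w i2) q m (hwi i2 hi20) hqd hq1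
    have hcoe : (w i2 + C (1 - (w i2).coeff m) * q).natDegree = m := by
      refine le_antisymm hdeg ?_
      apply le_natDegree_of_ne_zero
      rw [hco]; exact one_ne_zero
    refine (h1.trans h2).trans (ih _ ((h1.trans h2).uni hv) i2 ?_ ?_)
    · simpa using hmon
    · simpa using hcoe

/-- Suslin's transitivity. -/
theorem suslin_trans [IsNoetherianRing R] (d : ℕ)
    (hd : ∀ p : Ideal R, p.IsPrime → p.height ≤ d) {ι : Type*} [Fintype ι] [DecidableEq ι]
    (hι : 3 ≤ Fintype.card ι) (hι' : d + 2 ≤ Fintype.card ι) (v : ι → R[X]) (hv : Uni v) (k : ι) :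
    EEq v (Pi.single k 1) := by
  obtain ⟨l, hl⟩ := gp1 (κ := {i // i ≠ k}) (⊥ : Ideal R[X]) 0 (by simp) (fun i => v i) (v k) (by
    rw [bot_sup_eq, eq_top_iff, ← hv, Ideal.span_le]
    rintro _ ⟨i, rfl⟩
    by_cases hi : i = k
    · subst hi; exact Ideal.mem_sup_right (Ideal.subset_span rfl)
    · exact Ideal.mem_sup_left (Ideal.subset_span ⟨⟨i, hi⟩, rfl⟩))
  set w : ι → R[X] := fun i => if h : i = k then v k else v i + l ⟨i, h⟩ * v k with hw
  have hwk : w k = v k := by simp [hw]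
  have h1 : EEq v w := by
    refine EEq.block _ _ (Finset.univ.erase k) ?_ ?_
    · intro i hi
      have : i = k := by simpa using hi
      subst this; exact hwk
    · intro i hi
      have hi : i ≠ k := by simpa using hi
      simp only [hw, hi, dif_neg, not_false_eq_true, add_sub_cancel_left]
      exact Ideal.mul_mem_left _ _ (Ideal.subset_span ⟨k, by simp, rfl⟩)
  obtain ⟨q, hq, hqm⟩ := exists_monic_of_height_ideal d hd (Ideal.span (w '' {i | i ≠ k})) (by
    intro P hP hle
    refine le_trans ?_ (hl P hP bot_le ?_)
    · have : Fintype.card {i // i ≠ k} = Fintype.card ι - 1 := by simp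
      rw [this]
      exact_mod_cast (by omega : d + 1 ≤ 0 + (Fintype.card ι - 1))
    · rintro ⟨i, hi⟩
      apply hle
      exact Ideal.subset_span ⟨i, hi, by simp [hw, hi]⟩)
  set N := (w k).natDegree + 1 with hN
  have h2 := EEq.add_span w k {i | i ≠ k} (by simp) (Ideal.mul_mem_left _ (X ^ N) hq)
  refine (h1.trans h2).trans (horrocks_local hι _ ((h1.trans h2).uni hv) k ?_ k)
  simp only [Function.update_self]
  rw [add_comm]
  nontriviality R
  apply Monic.add_of_left ((monic_X_pow N).mul hqm)
  rw [degree_eq_natDegree ((monic_X_pow N).mul hqm).ne_zero,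
    (monic_X_pow N).natDegree_mul hqm, natDegree_X_pow]
  refine lt_of_le_of_lt degree_le_natDegree ?_
  exact_mod_cast (by omega)

end Horrocks

section Symplectic
open Matrix

variable {A : Type*} [CommRing A]

/-- congruence of matrices -/
def Cong {κ : Type*} [Fintype κ] [DecidableEq κ] (V W : Matrix κ κ A) : Prop :=
  ∃ ε : Matrix κ κ A, IsUnit ε.det ∧ V = εᵀ * W * ε

theorem Cong.trans {κ : Type*} [Fintype κ] [DecidableEq κ] {U V W : Matrix κ κ A}
    (h : Cong U V) (h' : Cong V W) : Cong U W := by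
  obtain ⟨a, ha, rfl⟩ := h
  obtain ⟨b, hb, rfl⟩ := h'
  exact ⟨b * a, by rw [det_mul]; exact hb.mul ha, by simp [Matrix.mul_assoc]⟩

theorem Cong.symm {κ : Type*} [Fintype κ] [DecidableEq κ] {U V : Matrix κ κ A}
    (h : Cong U V) : Cong V U := by
  obtain ⟨a, ha, rfl⟩ := h
  refine ⟨a⁻¹, isUnit_nonsing_inv_det _ ha, ?_⟩
  rw [transpose_nonsing_inv]
  have h1 : (aᵀ)⁻¹ * aᵀ = 1 := nonsing_inv_mul _ (by rwa [det_transpose])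
  have h2 : a * a⁻¹ = 1 := mul_nonsing_inv _ ha
  calc V = ((aᵀ)⁻¹ * aᵀ) * V * (a * a⁻¹) := by rw [h1, h2]; simp
    _ = _ := by simp only [Matrix.mul_assoc]

theorem Cong.submatrix {κ μ : Type*} [Fintype κ] [DecidableEq κ] [Fintype μ] [DecidableEq μ]
    {U V : Matrix κ κ A} (h : Cong U V) (e : μ ≃ κ) :
    Cong (U.submatrix e e) (V.submatrix e e) := by
  obtain ⟨a, ha, rfl⟩ := h
  refine ⟨a.submatrix e e, by rwa [det_submatrix_equiv_self], ?_⟩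
  rw [transpose_submatrix, submatrix_mul_equiv, submatrix_mul_equiv]

theorem Cong.map {B : Type*} [CommRing B] {κ : Type*} [Fintype κ] [DecidableEq κ]
    {U V : Matrix κ κ A} (h : Cong U V) (f : A →+* B) : Cong (U.map f) (V.map f) := by
  obtain ⟨a, ha, rfl⟩ := h
  refine ⟨a.map f, ?_, ?_⟩
  · have := ha.map f
    rwa [RingHom.map_det] at this
  · rw [Matrix.map_mul, Matrix.map_mul, transpose_map]

/-- The transvection-like isometry. -/
theorem isometry_gen (h2 : IsUnit (2 : A)) {ι : Type*} [Fintype ι] [DecidableEq ι]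
    (φ : Matrix ι ι A) (hφ : φᵀ = -φ) (hdet : IsUnit φ.det) (o : ι) (d : ι → A) (hd : d o = 0) :
    ∃ τ : Matrix ι ι A, τᵀ * φ * τ = φ ∧ τ *ᵥ (Pi.single o 1) = Pi.single o 1 + d := by
  set e0 : ι → A := Pi.single o 1 with he0
  set h : ι → A := φ⁻¹ *ᵥ e0 with hh
  have hskew : ∀ x y : ι → A, x ⬝ᵥ φ *ᵥ y = - (y ⬝ᵥ φ *ᵥ x) := by
    intro x y
    rw [dotProduct_mulVec, dotProduct_comm, ← mulVec_transpose, hφ, neg_mulVec, dotProduct_neg]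
  have halt : ∀ x : ι → A, x ⬝ᵥ φ *ᵥ x = 0 := by
    intro x
    have := hskew x x
    have h3 : (2 : A) * (x ⬝ᵥ φ *ᵥ x) = 0 := by linear_combination this
    exact (h2.mul_right_eq_zero).1 h3
  have hφh : φ *ᵥ h = e0 := by
    rw [hh, mulVec_mulVec, mul_nonsing_inv _ hdet, one_mulVec]
  have hxh : ∀ x : ι → A, x ⬝ᵥ φ *ᵥ h = x o := by
    intro x; rw [hφh, he0]; simp
  have hhx : ∀ x : ι → A, h ⬝ᵥ φ *ᵥ x = - x o := by
    intro x; rw [hskew, hxh]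
  have hho : h o = 0 := by
    have := hxh h
    rw [halt] at this
    exact this.symm
  set c : A := - (e0 ⬝ᵥ φ *ᵥ d) with hc
  set r : ι → A := φ *ᵥ d + c • e0 with hr
  set τ : Matrix ι ι A := 1 + vecMulVec d e0 + vecMulVec h r with hτ
  have hτx : ∀ x : ι → A, τ *ᵥ x = x + x o • d + (x ⬝ᵥ φ *ᵥ d + c * x o) • h := by
    intro x
    rw [hτ, add_mulVec, add_mulVec, one_mulVec, vecMulVec_mulVec, vecMulVec_mulVec]
    congr 1
    · congr 1
      ext i; simp [he0, mul_comm]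
    · ext i
      have : r ⬝ᵥ x = x ⬝ᵥ φ *ᵥ d + c * x o := by
        rw [hr, add_dotProduct, smul_dotProduct, he0, single_one_dotProduct, smul_eq_mul,
          dotProduct_comm]
      rw [← this]
      simp [mul_comm]
  refine ⟨τ, ?_, ?_⟩
  · have key : ∀ x y : ι → A, (τ *ᵥ x) ⬝ᵥ φ *ᵥ (τ *ᵥ y) = x ⬝ᵥ φ *ᵥ y := by
      intro x y
      rw [hτx, hτx]
      simp only [mulVec_add, mulVec_smul, dotProduct_add, add_dotProduct, smul_dotProduct,
        dotProduct_smul, smul_eq_mul, Pi.add_apply, Pi.smul_apply, hxh, hhx, halt, hd, hho]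
      rw [hskew d y]
      ring
    ext i j
    calc (τᵀ * φ * τ) i j
        = (Pi.single i 1 : ι → A) ⬝ᵥ (τᵀ * φ * τ) *ᵥ (Pi.single j 1) := by simp
      _ = (τ *ᵥ Pi.single i 1) ⬝ᵥ φ *ᵥ (τ *ᵥ Pi.single j 1) := by
          rw [← mulVec_mulVec, ← mulVec_mulVec, dotProduct_mulVec, vecMul_transpose]
      _ = (Pi.single i 1 : ι → A) ⬝ᵥ φ *ᵥ (Pi.single j 1) := key _ _
      _ = φ i j := by simp
  · rw [hτx, hc]
    have : e0 o = 1 := by simp [he0]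
    rw [this]; simp

theorem isometry_trans (h2 : IsUnit (2 : A)) {ι : Type*} [Fintype ι] [DecidableEq ι]
    (o : ι) (y : ι → A) (hy : EEq (Pi.single o 1) y) :
    ∀ (φ : Matrix ι ι A), φᵀ = -φ → IsUnit φ.det →
    ∃ σ : Matrix ι ι A, σᵀ * φ * σ = φ ∧ σ *ᵥ (Pi.single o 1) = y := by
  induction hy with
  | refl => intro φ _ _; exact ⟨1, by simp, one_mulVec _⟩
  | tail _ hs ih =>
    rename_i y' y''
    intro φ hφ hdet
    obtain ⟨i, j, c, hij, rfl⟩ := hs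
    set g := transvection j i c with hg
    have hgd : g.det = 1 := det_transvection_of_ne j i hij.symm c
    have hgu : IsUnit g.det := by rw [hgd]; exact isUnit_one
    have hgy : ∀ x : ι → A, g *ᵥ x = Function.update x j (x j + c * x i) := by
      intro x
      rw [hg, transvection, add_mulVec, one_mulVec]
      funext k
      by_cases hk : k = j
      · subst hk; simp [single_mulVec]
      · simp [single_mulVec, hk]
    obtain ⟨σ, h1, hσ⟩ := ih (gᵀ * φ * g)
      (by simp [transpose_mul, hφ, Matrix.mul_assoc]) (by simp [hgd, hdet])
    obtain ⟨τ, h3, hτ⟩ := isometry_gen h2 φ hφ hdet o (g *ᵥ Pi.single o 1 - Pi.single o 1) (by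
      rw [hgy]
      by_cases hoj : o = j
      · subst hoj; simp [hij]
      · simp [hoj])
    have hgg : g * g⁻¹ = 1 := mul_nonsing_inv _ hgu
    have hgg' : g⁻¹ * g = 1 := nonsing_inv_mul _ hgu
    have hggt : (g⁻¹)ᵀ * gᵀ = 1 := by rw [← transpose_mul, hgg, transpose_one]
    refine ⟨g * σ * g⁻¹ * τ, ?_, ?_⟩
    · calc (g * σ * g⁻¹ * τ)ᵀ * φ * (g * σ * g⁻¹ * τ)
          = τᵀ * ((g⁻¹)ᵀ * (σᵀ * (gᵀ * φ * g) * σ) * g⁻¹) * τ := by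
            simp only [transpose_mul, Matrix.mul_assoc]
        _ = τᵀ * (((g⁻¹)ᵀ * gᵀ) * φ * (g * g⁻¹)) * τ := by
            rw [h1]; simp only [Matrix.mul_assoc]
        _ = φ := by rw [hggt, hgg]; simpa using h3
    · rw [← mulVec_mulVec, hτ, add_sub_cancel, mulVec_mulVec, Matrix.mul_assoc, hgg',
        Matrix.mul_one, ← mulVec_mulVec, hσ, hgy]

/-- hyperbolic matrix -/
def JJ (A : Type*) [CommRing A] (μ : Type*) [DecidableEq μ] : Matrix (μ ⊕ μ) (μ ⊕ μ) A :=
  Matrix.fromBlocks 0 1 (-1) 0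

theorem JJ_skew (μ : Type*) [DecidableEq μ] : (JJ A μ)ᵀ = - JJ A μ := by
  simp [JJ, fromBlocks_transpose, fromBlocks_neg]

theorem JJ_det (μ : Type*) [DecidableEq μ] [Fintype μ] : IsUnit (JJ A μ).det := by
  rw [← isUnit_iff_isUnit_det]
  have : JJ A μ * (- JJ A μ) = 1 := by
    simp [JJ, fromBlocks_neg, fromBlocks_multiply]
  exact IsUnit.of_mul_eq_one _ this

/-- orthogonal sum -/
def perp {κ μ : Type*} (V : Matrix κ κ A) (W : Matrix μ μ A) : Matrix (κ ⊕ μ) (κ ⊕ μ) A :=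
  fromBlocks V 0 0 W

theorem perp_skew {κ μ : Type*} {V : Matrix κ κ A} {W : Matrix μ μ A} (hV : Vᵀ = -V)
    (hW : Wᵀ = -W) : (perp V W)ᵀ = - perp V W := by
  simp [perp, fromBlocks_transpose, fromBlocks_neg, hV, hW]

theorem perp_det {κ μ : Type*} [Fintype κ] [DecidableEq κ] [Fintype μ] [DecidableEq μ]
    {V : Matrix κ κ A} {W : Matrix μ μ A} (hV : IsUnit V.det) (hW : IsUnit W.det) :
    IsUnit (perp V W).det := by
  rw [perp, det_fromBlocks_zero₂₁]; exact hV.mul hW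

/-- In a congruence one may assume that a given basis vector is fixed. -/
theorem cong_fix (h2 : IsUnit (2 : A)) {ι : Type*} [Fintype ι] [DecidableEq ι]
    (hT : ∀ (y : ι → A), Uni y → ∀ k, EEq y (Pi.single k 1))
    (V φ : Matrix ι ι A) (hφs : φᵀ = -φ) (hφu : IsUnit φ.det) (h : Cong V φ) (o : ι) :
    ∃ η : Matrix ι ι A, IsUnit η.det ∧ V = ηᵀ * φ * η ∧
      ∀ k, η k o = (Pi.single o 1 : ι → A) k := by
  obtain ⟨ε, hε, hVW⟩ := h
  have hcol : Uni (ε *ᵥ Pi.single o 1) := by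
    rw [uni_iff]
    refine ⟨fun k => ε⁻¹ o k, ?_⟩
    have : (ε⁻¹ * ε) o o = 1 := by rw [nonsing_inv_mul _ hε]; simp
    rw [mul_apply] at this
    refine Eq.trans ?_ this
    refine Finset.sum_congr rfl fun k _ => ?_
    rw [mulVec_single_one, mul_comm]; rfl
  obtain ⟨σ, hσ, hσy⟩ := isometry_trans h2 o _ (hT _ hcol o).symm φ hφs hφu
  have hσu : IsUnit σ.det := by
    have := congrArg det hσ
    rw [det_mul, det_mul] at this
    exact isUnit_of_mul_isUnit_right (by rw [this]; exact hφu)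
  refine ⟨σ⁻¹ * ε, ?_, ?_, ?_⟩
  · rw [det_mul]; exact (isUnit_nonsing_inv_det _ hσu).mul hε
  · have e1 : ε = σ * (σ⁻¹ * ε) := by
      rw [← Matrix.mul_assoc, mul_nonsing_inv _ hσu, Matrix.one_mul]
    set η := σ⁻¹ * ε with hη
    calc V = (σ * η)ᵀ * φ * (σ * η) := by rw [← e1]; exact hVW
      _ = ηᵀ * (σᵀ * φ * σ) * η := by simp only [transpose_mul, Matrix.mul_assoc]
      _ = ηᵀ * φ * η := by rw [hσ]
  · have hηo : (σ⁻¹ * ε) *ᵥ Pi.single o 1 = Pi.single o 1 := by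
      rw [← mulVec_mulVec, ← hσy, mulVec_mulVec, nonsing_inv_mul _ hσu, one_mulVec]
    intro k
    have := congrFun hηo k
    rw [mulVec_single_one] at this
    exact this

/-- Cancel one hyperbolic plane. -/
theorem cancel_one (h2 : IsUnit (2 : A)) {κ : Type} [Fintype κ] [DecidableEq κ]
    (hT : ∀ (y : κ ⊕ (Unit ⊕ Unit) → A), Uni y → ∀ k, EEq y (Pi.single k 1))
    (V W : Matrix κ κ A) (hV : IsUnit V.det) (hWs : Wᵀ = -W) (hW : IsUnit W.det)
    (h : Cong (perp V (JJ A Unit)) (perp W (JJ A Unit))) : Cong V W := by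
  obtain ⟨η, hηu, hηφ, hηo⟩ := cong_fix h2 hT _ _ (perp_skew hWs (JJ_skew _))
    (perp_det hW (JJ_det _)) h (Sum.inr (Sum.inl ()))
  have hrow : ∀ i, η (Sum.inr (Sum.inr ())) (Sum.inl i) = 0 := by
    intro i
    have h1 := congrFun (congrFun hηφ (Sum.inr (Sum.inl ()))) (Sum.inl i)
    have h2 : (perp V (JJ A Unit)) (Sum.inr (Sum.inl ())) (Sum.inl i) = 0 := by simp [perp]
    rw [h2, Matrix.mul_assoc, mul_apply] at h1
    simp only [transpose_apply, hηo] at h1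
    simp [mul_apply, perp, JJ, Pi.single_apply] at h1
    exact h1.symm
  set δ := η.toBlocks₁₁ with hδ
  set c := η.toBlocks₂₁ with hc
  have hblk : V = δᵀ * W * δ + cᵀ * JJ A Unit * c := by
    have h1 := congrArg toBlocks₁₁ hηφ
    rw [← fromBlocks_toBlocks η] at h1
    simpa [perp, fromBlocks_transpose, fromBlocks_multiply] using h1
  have hz : cᵀ * JJ A Unit * c = 0 := by
    ext i j
    have e1 : ∀ i, c (Sum.inr ()) i = 0 := fun i => hrow i
    rw [mul_apply]
    simp [mul_apply, JJ, e1]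
  rw [hz, add_zero] at hblk
  refine ⟨δ, ?_, hblk⟩
  rw [hblk, det_mul] at hV
  exact isUnit_of_mul_isUnit_right hV

/-- Cancel a hyperbolic form. -/
theorem cancel_all (h2 : IsUnit (2 : A)) (n0 : ℕ)
    (hT : ∀ (ι : Type) [Fintype ι] [DecidableEq ι], n0 + 2 ≤ Fintype.card ι →
      ∀ (y : ι → A), Uni y → ∀ k, EEq y (Pi.single k 1)) (m : ℕ) :
    ∀ (κ : Type) [Fintype κ] [DecidableEq κ],
    n0 ≤ Fintype.card κ → ∀
    (V W : Matrix κ κ A), Vᵀ = -V → IsUnit V.det → Wᵀ = -W → IsUnit W.det →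
    Cong (perp V (JJ A (Fin m))) (perp W (JJ A (Fin m))) → Cong V W := by
  induction m with
  | zero =>
    intro κ _ _ hκ V W _ _ _ _ h
    have := h.submatrix (Equiv.sumEmpty κ (Fin 0 ⊕ Fin 0)).symm
    exact this
  | succ m ih =>
    intro κ _ _ hκ V W hVs hV hWs hW h
    apply ih κ hκ V W hVs hV hWs hW
    apply cancel_one h2 (hT _ (by simp; omega)) _ _ (perp_det hV (JJ_det _))
      (perp_skew hWs (JJ_skew _)) (perp_det hW (JJ_det _))
    let e : (κ ⊕ (Fin m ⊕ Fin m)) ⊕ (Unit ⊕ Unit) ≃ κ ⊕ (Fin (m + 1) ⊕ Fin (m + 1)) :=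
      { toFun := fun x => match x with
          | Sum.inl (Sum.inl k) => Sum.inl k
          | Sum.inl (Sum.inr (Sum.inl i)) => Sum.inr (Sum.inl i.succ)
          | Sum.inl (Sum.inr (Sum.inr i)) => Sum.inr (Sum.inr i.succ)
          | Sum.inr (Sum.inl _) => Sum.inr (Sum.inl 0)
          | Sum.inr (Sum.inr _) => Sum.inr (Sum.inr 0)
        invFun := fun x => match x with
          | Sum.inl k => Sum.inl (Sum.inl k)
          | Sum.inr (Sum.inl i) => Fin.cases (motive := fun _ =>
              (κ ⊕ (Fin m ⊕ Fin m)) ⊕ (Unit ⊕ Unit)) (Sum.inr (Sum.inl ()))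
              (fun i => Sum.inl (Sum.inr (Sum.inl i))) i
          | Sum.inr (Sum.inr i) => Fin.cases (motive := fun _ =>
              (κ ⊕ (Fin m ⊕ Fin m)) ⊕ (Unit ⊕ Unit)) (Sum.inr (Sum.inr ()))
              (fun i => Sum.inl (Sum.inr (Sum.inr i))) i
        left_inv := by
          rintro ((k | (i | i)) | (i | i)) <;> rfl
        right_inv := by
          rintro (k | (i | i))
          · rfl
          · refine Fin.cases ?_ (fun i => ?_) i <;> rfl
          · refine Fin.cases ?_ (fun i => ?_) i <;> rfl }
    have he : ∀ U : Matrix κ κ A, (perp U (JJ A (Fin (m + 1)))).submatrix e e =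
        perp (perp U (JJ A (Fin m))) (JJ A Unit) := by
      intro U
      ext i j
      rcases i with (k | (i | i)) | (i | i) <;> rcases j with (k' | (j | j)) | (j | j) <;>
        simp [e, perp, JJ, one_apply, Fin.succ_ne_zero, Ne.symm (Fin.succ_ne_zero _)]
    have := h.submatrix e
    rwa [he, he] at this

theorem cancel_any (h2 : IsUnit (2 : A)) (n0 : ℕ)
    (hT : ∀ (ι : Type) [Fintype ι] [DecidableEq ι], n0 + 2 ≤ Fintype.card ι →
      ∀ (y : ι → A), Uni y → ∀ k, EEq y (Pi.single k 1)) (μ : Type) [Fintype μ] [DecidableEq μ]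
    (κ : Type) [Fintype κ] [DecidableEq κ] (hκ : n0 ≤ Fintype.card κ)
    (V W : Matrix κ κ A) (hVs : Vᵀ = -V) (hV : IsUnit V.det) (hWs : Wᵀ = -W) (hW : IsUnit W.det)
    (h : Cong (perp V (JJ A μ)) (perp W (JJ A μ))) : Cong V W := by
  have e := (Fintype.equivFin μ).symm
  apply cancel_all h2 n0 hT _ κ hκ V W hVs hV hWs hW
  have he : ∀ U : Matrix κ κ A, (perp U (JJ A μ)).submatrix
      (Equiv.sumCongr (Equiv.refl κ) (Equiv.sumCongr e e))
      (Equiv.sumCongr (Equiv.refl κ) (Equiv.sumCongr e e)) =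
        perp U (JJ A _) := by
    intro U
    ext i j
    rcases i with (i | (i | i)) <;> rcases j with (j | (j | j)) <;>
      simp [perp, JJ, one_apply]
  have := h.submatrix (Equiv.sumCongr (Equiv.refl κ) (Equiv.sumCongr e e))
  rwa [he, he] at this

end Symplectic

section Karoubi
open Matrix Polynomial

/-- truncated square roots of `1 + Y` -/
theorem exists_sqrt {A : Type*} [CommRing A] (h2 : IsUnit (2 : A)) (k : ℕ) :
    ∃ p : A[X], X ^ (k + 1) ∣ p ^ 2 - (1 + X) ∧ X ∣ p - 1 := by
  obtain ⟨u, hu⟩ := h2.exists_right_inv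
  induction k with
  | zero => exact ⟨1, ⟨-1, by ring⟩, by simp⟩
  | succ k ih =>
    obtain ⟨p, ⟨q, hq⟩, ⟨r, hr⟩⟩ := ih
    refine ⟨p - C u * q * X ^ (k + 1), ⟨- q * r + C u ^ 2 * q ^ 2 * X ^ k, ?_⟩,
      ⟨r - C u * q * X ^ k, ?_⟩⟩
    · have hu' : (2 : A[X]) * C u = 1 := by
        rw [show (2 : A[X]) = C 2 from (map_ofNat C 2).symm, ← C_mul, hu, C_1]
      linear_combination hq - q * X ^ (k+1) * hr - p * q * X ^ (k + 1) * hu'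
    · linear_combination hr

theorem nilp_of_isUnit {R : Type*} [CommRing R] {κ : Type*} [Fintype κ] [DecidableEq κ]
    (N : Matrix κ κ R) (h : IsUnit ((1 : Matrix κ κ R[X]) + (X : R[X]) • N.map C)) :
    IsNilpotent N := by
  obtain ⟨G, hG⟩ := h.exists_right_inv
  have h1 := congrArg matPolyEquiv hG
  rw [map_mul, map_add, map_one] at h1
  have h2 : matPolyEquiv ((X : R[X]) • N.map C) = X * C N := by
    rw [matPolyEquiv_map_smul, matPolyEquiv_map_C, Polynomial.map_X]
  rw [h2] at h1
  set g := matPolyEquiv G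
  have h0 : g.coeff 0 = 1 := by
    have := congrArg (fun p => coeff p 0) h1
    simpa [add_mul, mul_assoc] using this
  have hs : ∀ n, g.coeff (n + 1) = - (N * g.coeff n) := by
    intro n
    have := congrArg (fun p => coeff p (n + 1)) h1
    simp [add_mul, mul_assoc, coeff_one] at this
    exact eq_neg_of_add_eq_zero_left this
  have hn : ∀ n, g.coeff n = (-N) ^ n := by
    intro n
    induction n with
    | zero => simpa using h0
    | succ n ih => rw [hs, ih, pow_succ']; simp
  have : IsNilpotent (-N) := ⟨g.natDegree + 1, by
    rw [← hn]; exact coeff_eq_zero_of_natDegree_lt (by omega)⟩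
  simpa using this.neg

/-- The linear case -/
theorem sqrt_cong {A : Type*} [CommRing A] (h2 : IsUnit (2 : A)) {κ : Type*} [Fintype κ]
    [DecidableEq κ] (V0 M : Matrix κ κ A) (hM : IsNilpotent M) (hMV : Mᵀ * V0 = V0 * M)
    (hV : IsUnit (V0 * (1 + M)).det) : Cong (V0 * (1 + M)) V0 := by
  obtain ⟨k, hk⟩ := hM
  obtain ⟨p, ⟨q, hq⟩, -⟩ := exists_sqrt h2 k
  have hpow : ∀ p : A[X], (aeval M p)ᵀ * V0 = V0 * aeval M p := by
    intro p
    induction p using Polynomial.induction_on' with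
    | add p q hp hq => rw [map_add, transpose_add, add_mul, mul_add, hp, hq]
    | monomial n a =>
      have : ∀ n, (M ^ n)ᵀ * V0 = V0 * M ^ n := by
        intro n
        induction n with
        | zero => simp
        | succ n ih => rw [pow_succ, transpose_mul, Matrix.mul_assoc, ih, ← Matrix.mul_assoc,
            hMV, Matrix.mul_assoc, ← pow_succ', pow_succ]
      rw [aeval_monomial, ← Algebra.smul_def, transpose_smul, Matrix.smul_mul, this, Matrix.mul_smul]
  have hsq : aeval M p * aeval M p = 1 + M := by
    have := congrArg (aeval M) hq
    simp only [map_sub, map_pow, map_add, map_one, aeval_X, map_mul, pow_succ, hk] at this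
    simp at this
    exact sub_eq_zero.1 this
  have e : V0 * (1 + M) = (aeval M p)ᵀ * V0 * aeval M p := by
    rw [hpow, Matrix.mul_assoc, hsq]
  refine ⟨aeval M p, ?_, e⟩
  rw [e, det_mul] at hV
  exact isUnit_of_mul_isUnit_right hV

variable {R : Type*} [CommRing R]

/-- evaluate at zero -/
noncomputable def ev0 (R : Type*) [CommRing R] : R[X] →+* R[X] := C.comp (evalRingHom 0)

theorem linear_case (h2 : IsUnit (2 : R)) {κ : Type} [Fintype κ] [DecidableEq κ]
    (V : Matrix κ κ R[X]) (hVs : Vᵀ = -V) (hV : IsUnit V.det)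
    (hdeg : ∀ i j, (V i j).natDegree ≤ 1) : Cong V (V.map (ev0 R)) := by
  set V0 : Matrix κ κ R := V.map (fun p => coeff p 0) with hV0
  set V1 : Matrix κ κ R := V.map (fun p => coeff p 1) with hV1
  have hV0' : V.map (ev0 R) = V0.map C := by
    ext i j : 2
    simp [ev0, hV0, coeff_zero_eq_eval_zero]
  have hdecomp : V = V0.map C + (X : R[X]) • V1.map C := by
    ext1 i j
    have := eq_X_add_C_of_natDegree_le_one (hdeg i j)
    simp only [Matrix.add_apply, map_apply, Matrix.smul_apply, smul_eq_mul, hV0, hV1]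
    conv_lhs => rw [this]
    ring
  have hs : ∀ i j, V j i = - V i j := fun i j => congrFun (congrFun hVs i) j
  have hV0s : V0ᵀ = -V0 := by
    ext i j; simp [hV0, hs i j]
  have hV1s : V1ᵀ = -V1 := by
    ext i j; simp [hV1, hs i j]
  have hV0u : IsUnit V0.det := by
    have := hV.map (evalRingHom (0 : R))
    rw [RingHom.map_det] at this
    convert this using 2
    ext i j
    simp [hV0, coeff_zero_eq_eval_zero]
  set N := V0⁻¹ * V1 with hN
  have hV0N : V0 * N = V1 := by
    rw [hN, ← Matrix.mul_assoc, mul_nonsing_inv _ hV0u, Matrix.one_mul]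
  have hNV0 : Nᵀ * V0 = V1 := by
    rw [hN, transpose_mul, transpose_nonsing_inv, hV0s, hV1s, Matrix.mul_assoc]
    have : (-V0)⁻¹ * V0 = -1 := by
      have h3 : (-V0)⁻¹ * (-V0) = 1 := nonsing_inv_mul _ (by
        rw [← hV0s, det_transpose]; exact hV0u)
      rw [Matrix.mul_neg] at h3
      exact neg_eq_iff_eq_neg.1 h3
    rw [this]; simp
  have hfac : V = V0.map C * (1 + (X : R[X]) • N.map C) := by
    rw [Matrix.mul_add, Matrix.mul_one, Matrix.mul_smul, ← Matrix.map_mul, hV0N]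
    exact hdecomp
  have hunit : IsUnit ((1 : Matrix κ κ R[X]) + (X : R[X]) • N.map C) := by
    rw [isUnit_iff_isUnit_det]
    rw [hfac, det_mul] at hV
    exact isUnit_of_mul_isUnit_right hV
  obtain ⟨k, hk⟩ := nilp_of_isUnit N hunit
  have h2' : IsUnit (2 : R[X]) := by
    have := h2.map (C : R →+* R[X])
    rwa [map_ofNat] at this
  rw [hV0']
  rw [hfac] at hV ⊢
  apply sqrt_cong h2' _ _ ⟨k, ?_⟩ ?_ hV
  · rw [_root_.smul_pow]
    have : (N.map (C : R →+* R[X])) ^ k = (N ^ k).map C := by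
      exact (map_pow (C : R →+* R[X]).mapMatrix N k).symm
    rw [this, hk]; simp
  · rw [transpose_smul, Matrix.smul_mul, Matrix.mul_smul, ← transpose_map, ← Matrix.map_mul,
      ← Matrix.map_mul, hNV0, hV0N]

theorem karoubi_step (h2 : IsUnit (2 : R)) {κ : Type} [Fintype κ] [DecidableEq κ] (r : ℕ)
    (hr : 1 ≤ r) (V : Matrix κ κ R[X]) (hVs : Vᵀ = -V)
    (hdeg : ∀ i j, (V i j).natDegree ≤ r + 1) :
    ∃ V' : Matrix (κ ⊕ (κ ⊕ κ)) (κ ⊕ (κ ⊕ κ)) R[X], (∀ i j, (V' i j).natDegree ≤ r) ∧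
      V'ᵀ = -V' ∧ Cong V' (perp V (JJ R[X] κ)) := by
  obtain ⟨u, hu⟩ := h2.exists_right_inv
  set Q : Matrix κ κ R[X] := V.map (fun p => C (- (u * p.coeff (r + 1))) * X ^ r) with hQ
  set P : Matrix κ κ R[X] := (X : R[X]) • 1 with hP
  set K : Matrix (κ ⊕ κ) κ R[X] := fromRows P Q with hK
  set E : Matrix (κ ⊕ (κ ⊕ κ)) (κ ⊕ (κ ⊕ κ)) R[X] := fromBlocks 1 0 K 1 with hE
  have hs : ∀ i j, V j i = - V i j := fun i j => congrFun (congrFun hVs i) j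
  have hQs : Qᵀ = -Q := by
    ext1 i j
    simp [hQ, hs i j]
  have hV' : Eᵀ * perp V (JJ R[X] κ) * E = fromBlocks (V + Kᵀ * JJ R[X] κ * K)
      (Kᵀ * JJ R[X] κ) (JJ R[X] κ * K) (JJ R[X] κ) := by
    simp [hE, perp, fromBlocks_transpose, fromBlocks_multiply]
  have hKJ : Kᵀ * JJ R[X] κ = fromCols (-Qᵀ) Pᵀ := by
    rw [hK, JJ, transpose_fromRows, fromCols_mul_fromBlocks]; simp
  have hJK : JJ R[X] κ * K = fromRows Q (-P) := by
    rw [hK, JJ, fromBlocks_mul_fromRows]; simp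
  have hKJK : Kᵀ * JJ R[X] κ * K = (2 * X : R[X]) • Q := by
    rw [hKJ, hK, fromCols_mul_fromRows, hQs, hP]
    simp [two_mul, add_smul]
  have hQd : ∀ i j, (Q i j).natDegree ≤ r := by
    intro i j
    simp only [hQ, map_apply]
    exact natDegree_C_mul_X_pow_le _ _
  have hPd : ∀ i j, (P i j).natDegree ≤ r := by
    intro i j
    rw [hP, Matrix.smul_apply, one_apply]
    split_ifs
    · simpa using natDegree_X_le.trans hr
    · simp
  refine ⟨Eᵀ * perp V (JJ R[X] κ) * E, ?_, ?_, E, ?_, rfl⟩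
  · rw [hV', hKJK, hKJ, hJK, hQs]
    rintro (i | i | i) (j | j | j)
    · simp only [fromBlocks_apply₁₁, Matrix.add_apply, Matrix.smul_apply, smul_eq_mul]
      rw [natDegree_le_iff_coeff_eq_zero]
      intro n hn
      have e : V i j + 2 * X * Q i j = V i j - C ((V i j).coeff (r + 1)) * X ^ (r + 1) := by
        simp only [hQ, map_apply]
        have hu' : (2 : R[X]) * C u = 1 := by
          rw [show (2 : R[X]) = C 2 from (map_ofNat C 2).symm, ← C_mul, hu, C_1]
        simp only [C_neg, C_mul]
        linear_combination - C ((V i j).coeff (r + 1)) * X ^ (r + 1) * hu'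
      rw [e, coeff_sub, coeff_C_mul, coeff_X_pow]
      by_cases hn1 : n = r + 1
      · subst hn1; simp
      · rw [coeff_eq_zero_of_natDegree_lt (lt_of_le_of_lt (hdeg i j) (by omega))]
        simp [hn1]
    · simpa using hQd i j
    · simpa using hPd j i
    · simpa using hQd i j
    · simp [JJ]
    · simp only [fromBlocks_apply₂₂, JJ, fromBlocks_apply₁₂, one_apply]; split_ifs <;> simp
    · simpa using hPd i j
    · simp only [fromBlocks_apply₂₂, JJ, fromBlocks_apply₂₁, Matrix.neg_apply]
      rw [one_apply]
      split_ifs <;> simp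
    · simp [JJ]
  · rw [transpose_mul, transpose_mul, perp_skew hVs (JJ_skew κ)]
    simp [Matrix.mul_assoc]
  · rw [hE, det_fromBlocks_zero₁₂]; simp

theorem perp_map {A B : Type*} [CommRing A] [CommRing B] {κ μ : Type*} (f : A →+* B)
    (V : Matrix κ κ A) (W : Matrix μ μ A) : (perp V W).map f = perp (V.map f) (W.map f) := by
  simp [perp, fromBlocks_map]

theorem JJ_map {A B : Type*} [CommRing A] [CommRing B] {μ : Type*} [DecidableEq μ]
    (f : A →+* B) : (JJ A μ).map f = JJ B μ := by
  rw [JJ, JJ, fromBlocks_map]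
  congr 1
  · simp
  · simp
  · ext i j; simp [one_apply, apply_ite f]
  · simp

theorem karoubi (h2 : IsUnit (2 : R)) (n0 : ℕ)
    (hT : ∀ (ι : Type) [Fintype ι] [DecidableEq ι], n0 + 2 ≤ Fintype.card ι →
      ∀ (y : ι → R[X]), Uni y → ∀ k, EEq y (Pi.single k 1)) (r : ℕ) :
    ∀ (κ : Type) [Fintype κ] [DecidableEq κ], n0 ≤ Fintype.card κ →
    ∀ (V : Matrix κ κ R[X]), Vᵀ = -V → IsUnit V.det →
    (∀ i j, (V i j).natDegree ≤ r + 1) → Cong V (V.map (ev0 R)) := by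
  have h2' : IsUnit (2 : R[X]) := by
    have := h2.map (C : R →+* R[X])
    rwa [map_ofNat] at this
  induction r with
  | zero => intro κ _ _ hκ V hVs hV hdeg; exact linear_case h2 V hVs hV hdeg
  | succ r ih =>
    intro κ _ _ hκ V hVs hV hdeg
    obtain ⟨V', hd', hs', hc⟩ := karoubi_step h2 (r + 1) (by omega) V hVs hdeg
    have hV' : IsUnit V'.det := by
      obtain ⟨E, hE, rfl⟩ := hc
      rw [det_mul, det_mul, det_transpose]
      exact (hE.mul (perp_det hV (JJ_det _))).mul hE
    have h3 := ih _ (by simp; omega) V' hs' hV' hd'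
    have h4 := hc.map (ev0 R)
    rw [perp_map, JJ_map] at h4
    have h5 := (hc.symm.trans h3).trans h4
    refine cancel_any h2' n0 hT κ κ hκ V _ hVs hV ?_ ?_ h5
    · rw [← transpose_map, hVs]; ext i j : 2; simp
    · have := hV.map (ev0 R)
      rwa [RingHom.map_det] at this

end Karoubi

section Base
open Matrix Polynomial

theorem EEq.exists_matrix {A ι : Type*} [CommRing A] [Fintype ι] [DecidableEq ι] {v w : ι → A}
    (h : EEq v w) : ∃ g : Matrix ι ι A, IsUnit g.det ∧ w = v ᵥ* g := by
  induction h with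
  | refl => exact ⟨1, by simp, by simp⟩
  | tail _ hs ih =>
    obtain ⟨g, hg, rfl⟩ := ih
    obtain ⟨i, j, c, hij, rfl⟩ := hs
    refine ⟨g * transvection i j c, by rw [det_mul, det_transvection_of_ne _ _ hij]; simpa using hg, ?_⟩
    rw [← vecMul_vecMul]
    ext k
    rw [transvection, vecMul_add, vecMul_one, Pi.add_apply]
    have : ∀ x : ι → A, (x ᵥ* Matrix.single i j c) k = if k = j then x i * c else 0 := by
      intro x
      simp only [vecMul, dotProduct]
      rw [Finset.sum_eq_single i]
      · by_cases hk : k = j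
        · subst hk; simp
        · rw [single_apply_of_col_ne _ _ (Ne.symm hk)]; simp [hk]
      · intro b _ hb
        rw [single_apply_of_row_ne (Ne.symm hb)]; simp
      · simp
    rw [this]
    by_cases hk : k = j
    · subst hk; simp; ring
    · simp [hk]

variable {R : Type*} [CommRing R] [IsLocalRing R] [IsNoetherianRing R]

theorem base_completion (h2 : IsUnit (2 : R)) (hd : ∀ p : Ideal R, p.IsPrime → p.height ≤ (2 : ℕ))
    (u : Fin 3 → R[X]) (hu : Uni u) :
    ∃ g : Matrix (Fin 3) (Fin 3) R[X], IsUnit g.det ∧ g 0 = u := by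
  obtain ⟨w, hw⟩ := uni_iff.1 hu
  rw [Fin.sum_univ_three] at hw
  set V : Matrix (Fin 4) (Fin 4) R[X] :=
    !![0, u 0, u 1, u 2; -u 0, 0, w 2, -w 1; -u 1, -w 2, 0, w 0; -u 2, w 1, -w 0, 0] with hV
  have hVs : Vᵀ = -V := by
    ext1 i j
    fin_cases i <;> fin_cases j <;> simp [hV]
  have hVd : V.det = 1 := by
    rw [hV, det_succ_row_zero]
    simp [Fin.sum_univ_succ, det_fin_three, Fin.succAbove]
    linear_combination (u 0 * w 0 + u 1 * w 1 + u 2 * w 2 + 1) * hw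
  have h2' : IsUnit (2 : R[X]) := by
    have := h2.map (C : R →+* R[X])
    rwa [map_ofNat] at this
  have hT : ∀ (ι : Type) [Fintype ι] [DecidableEq ι], 2 + 2 ≤ Fintype.card ι →
      ∀ (y : ι → R[X]), Uni y → ∀ k, EEq y (Pi.single k 1) := by
    intro ι _ _ h y hy k
    exact suslin_trans 2 hd (by omega) h y hy k
  have hc := karoubi h2 2 hT (Finset.univ.sup fun i => Finset.univ.sup fun j => (V i j).natDegree)
    (Fin 4) (by simp) V hVs (by simp [hVd]) (fun i j => by
      refine le_trans ?_ (Nat.le_succ _)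
      exact le_trans (Finset.le_sup (f := fun j => (V i j).natDegree) (Finset.mem_univ j))
        (Finset.le_sup (f := fun i => Finset.univ.sup fun j => (V i j).natDegree) (Finset.mem_univ i)))
  obtain ⟨η, hη, hVη, hcol⟩ := cong_fix h2' (hT (Fin 4) (by simp)) V (V.map (ev0 R))
    (by rw [← transpose_map, hVs]; ext i j : 2; simp)
    (by
      have : IsUnit (ev0 R V.det) := by simp [hVd]
      rwa [RingHom.map_det] at this) hc 0
  set η' : Matrix (Fin 3) (Fin 3) R[X] := η.submatrix Fin.succ Fin.succ with hη'
  have hdet : η.det = η'.det := by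
    rw [det_succ_column_zero, Fin.sum_univ_succ]
    simp [hcol, hη']
  have hrow : u = (fun i => ev0 R (u i)) ᵥ* η' := by
    ext1 j
    have h1 : V 0 j.succ = u j := by fin_cases j <;> simp [hV]
    rw [← h1, hVη, Matrix.mul_assoc, mul_apply, Fin.sum_univ_succ]
    simp only [transpose_apply, hcol]
    simp only [Pi.single_eq_same, one_mul, ne_eq, Fin.succ_ne_zero, not_false_eq_true,
      Pi.single_eq_of_ne, zero_mul, Finset.sum_const_zero, add_zero]
    rw [mul_apply, Fin.sum_univ_succ]
    simp only [vecMul, dotProduct]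
    have h00 : V 0 0 = 0 := by simp [hV]
    have hs : ∀ k : Fin 3, V 0 k.succ = u k := by intro k; fin_cases k <;> simp [hV]
    simp [h00, hs, hη']
  have hu0 : Uni (fun i => (evalRingHom 0) (u i) : Fin 3 → R) := hu.map _
  obtain ⟨i, hi⟩ : ∃ i, IsUnit (evalRingHom 0 (u i) : R) := by
    by_contra hcon
    push Not at hcon
    have : Ideal.span (Set.range (fun i => (evalRingHom 0) (u i) : Fin 3 → R)) ≤
        IsLocalRing.maximalIdeal R := by
      rw [Ideal.span_le]; rintro _ ⟨i, rfl⟩; exact hcon i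
    rw [hu0] at this
    exact (IsLocalRing.maximalIdeal.isMaximal R).ne_top (top_le_iff.1 this)
  obtain ⟨j, hij⟩ : ∃ j : Fin 3, i ≠ j := (exists_ne i).imp fun _ h => h.symm
  have he := EEq.of_unit_entry (fun i => ev0 R (u i)) i j 0 hij (by
    have := hi.map (C : R →+* R[X])
    exact this)
  obtain ⟨g, hg, hg'⟩ := he.symm.exists_matrix
  refine ⟨g * η', by rw [det_mul, ← hdet]; exact hg.mul hη, ?_⟩
  rw [hrow, hg', vecMul_vecMul]
  ext1 k
  simp [vecMul, dotProduct, Pi.single_apply]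

end Base

section Heights

theorem exists_lt_of_le_height {T : Type*} [CommRing T] (P : Ideal T) [P.IsPrime] (n : ℕ)
    (h : ((n + 1 : ℕ) : ℕ∞) ≤ P.height) : ∃ Q : Ideal T, Q.IsPrime ∧ Q < P ∧ (n : ℕ∞) ≤ Q.height := by
  have h' : ((n + 1 : ℕ) : ℕ∞) ≤ Order.height (⟨P, inferInstance⟩ : PrimeSpectrum T) := by
    rw [← PrimeSpectrum.height_eq_orderHeight]; exact h
  obtain ⟨s, hs, hl⟩ := Order.exists_series_of_le_height _ h'
  refine ⟨s.eraseLast.last.asIdeal, s.eraseLast.last.2, ?_, ?_⟩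
  · have := s.eraseLast_last_rel_last (by omega)
    rw [hs] at this
    exact this
  · rw [PrimeSpectrum.height_eq_orderHeight]
    exact Order.length_le_height (p := s.eraseLast) le_rfl |>.trans' (by simp [hl])

theorem height_add_le {R T : Type*} [CommRing R] [CommRing T] (f : R →+* T) (k : ℕ)
    (hf : ∀ P Q : Ideal T, P.IsPrime → Q.IsPrime → P < Q → P.comap f < Q.comap f)
    (hk : ∀ P : Ideal T, P.IsPrime → (k : ℕ∞) ≤ (P.comap f).height) (n : ℕ) :
    ∀ P : Ideal T, P.IsPrime → (n : ℕ∞) ≤ P.height → ((n + k : ℕ) : ℕ∞) ≤ (P.comap f).height := by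
  induction n with
  | zero => intro P hP _; simpa using hk P hP
  | succ n ih =>
    intro P hP h
    obtain ⟨Q, hQ, hQP, hn⟩ := exists_lt_of_le_height P n h
    have h1 := ih Q hQ hn
    have := Ideal.height_add_one_le_of_lt_of_isPrime (hf Q P hQ hP hQP)
    refine le_trans ?_ this
    push_cast at h1 ⊢
    calc (n : ℕ∞) + 1 + k = n + k + 1 := by ring
      _ ≤ _ := by gcongr

theorem height_le_of_comap {R T : Type*} [CommRing R] [CommRing T] (f : R →+* T) (k m : ℕ)
    (hf : ∀ P Q : Ideal T, P.IsPrime → Q.IsPrime → P < Q → P.comap f < Q.comap f)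
    (hk : ∀ P : Ideal T, P.IsPrime → (k : ℕ∞) ≤ (P.comap f).height)
    (hR : ∀ P : Ideal R, P.IsPrime → P.height ≤ ((m + k : ℕ) : ℕ∞)) (P : Ideal T) (hP : P.IsPrime) :
    P.height ≤ m := by
  by_contra hcon
  have : ((m + 1 : ℕ) : ℕ∞) ≤ P.height := by
    push_cast
    exact Order.add_one_le_of_lt (not_le.1 hcon)
  have h1 := (height_add_le f k hf hk (m + 1) P hP this).trans (hR _ inferInstance)
  have := Nat.cast_le.1 h1
  omega

theorem height_le_quotient {R : Type*} [CommRing R] (I : Ideal R) (k m : ℕ)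
    (hk : ∀ P : Ideal R, P.IsPrime → I ≤ P → (k : ℕ∞) ≤ P.height)
    (hR : ∀ P : Ideal R, P.IsPrime → P.height ≤ ((m + k : ℕ) : ℕ∞)) (P : Ideal (R ⧸ I))
    (hP : P.IsPrime) : P.height ≤ m := by
  refine height_le_of_comap (Ideal.Quotient.mk I) k m ?_ ?_ hR P hP
  · intro P Q _ _ h
    exact lt_of_le_of_ne (Ideal.comap_mono h.le)
      fun e => h.ne (Ideal.comap_injective_of_surjective _ Ideal.Quotient.mk_surjective e)
  · intro P hP
    refine hk _ inferInstance ?_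
    intro x hx
    rw [Ideal.mem_comap, Ideal.Quotient.eq_zero_iff_mem.2 hx]; exact P.zero_mem

theorem height_le_integral {R T : Type*} [CommRing R] [CommRing T] [Algebra R T]
    [Algebra.IsIntegral R T] (m : ℕ)
    (hR : ∀ P : Ideal R, P.IsPrime → P.height ≤ (m : ℕ∞)) (P : Ideal T)
    (hP : P.IsPrime) : P.height ≤ m := by
  refine height_le_of_comap (algebraMap R T) 0 m ?_ (by simp) (by simpa using hR) P hP
  intro P Q _ _ h
  exact Ideal.IsIntegral.comap_lt_comap h

end Heights

section Excision
open Matrix Polynomial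

variable {R : Type*} [CommRing R]

/-- the doubled ring -/
abbrev Dbl (a : R) := QuadraticAlgebra R 0 a

def dev0 (a : R) : Dbl a →+* R where
  toFun z := z.re
  map_one' := rfl
  map_zero' := rfl
  map_add' := by intro x y; simp
  map_mul' := by intro x y; simp

def dev1 (a : R) : Dbl a →+* R where
  toFun z := z.re + a * z.im
  map_one' := by change (1 : R) + a * 0 = 1; simp
  map_zero' := by change (0 : R) + a * 0 = 0; simp
  map_add' := by intro x y; simp; ring
  map_mul' := by intro x y; simp; ring

theorem dbl_local [IsLocalRing R] (a : R) (ha : a ∈ IsLocalRing.maximalIdeal R) :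
    IsLocalRing (Dbl a) := by
  have : IsLocalHom (dev0 a) := by
    constructor
    intro z hz
    have hz' : IsUnit (z.re) := hz
    have h2 : IsUnit (z.re + a * z.im) := by
      by_contra hcon
      have h3 : z.re + a * z.im ∈ IsLocalRing.maximalIdeal R := hcon
      have := (IsLocalRing.maximalIdeal R).sub_mem h3 (Ideal.mul_mem_right z.im _ ha)
      rw [add_sub_cancel_right] at this
      exact this hz'
    have h4 := (hz'.mul h2).map (algebraMap R (Dbl a))
    have h5 : algebraMap R (Dbl a) (z.re * (z.re + a * z.im)) = z * ⟨z.re + a * z.im, - z.im⟩ := by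
      ext
      · simp
      · simp; ring
    rw [h5] at h4
    exact isUnit_of_mul_isUnit_left h4
  exact RingHom.domain_isLocalRing (dev0 a)

theorem exc_matrix [IsLocalRing R] [IsNoetherianRing R] (h2 : IsUnit (2 : R))
    (hd : ∀ p : Ideal R, p.IsPrime → p.height ≤ (2 : ℕ)) (a : R)
    (ha : a ∈ IsLocalRing.maximalIdeal R)
    (h : Fin 3 → R[X]) (hu : Uni (fun i => (Pi.single 0 1 : Fin 3 → R[X]) i + C a * h i)) :
    ∃ K : Matrix (Fin 3) (Fin 3) R[X], IsUnit (1 + C a • K).det ∧ K 0 = h := by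
  have := dbl_local a ha
  have : IsNoetherianRing (Dbl a) := IsNoetherianRing.of_finite R _
  set j : R[X] →+* (Dbl a)[X] := mapRingHom (algebraMap R (Dbl a)) with hj
  set t : (Dbl a)[X] := C ⟨0, 1⟩ with ht
  have htt : t * t = j (C a) * t := by
    rw [ht, hj, coe_mapRingHom, map_C, ← C_mul, ← C_mul]
    congr 1
    ext <;> simp
  set us : Fin 3 → (Dbl a)[X] := fun i => (Pi.single 0 1 : Fin 3 → (Dbl a)[X]) i + t * j (h i) with hus
  have husU : Uni us := by
    obtain ⟨w, hw⟩ := uni_iff.1 hu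
    rw [uni_iff]
    refine ⟨fun i => j (w i) - (Pi.single 0 1 : Fin 3 → (Dbl a)[X]) i *
      ((t - j (C a)) * j (∑ i, h i * w i)), ?_⟩
    have hw' := congrArg j hw
    simp [Fin.sum_univ_three] at hw'
    simp [hus, Fin.sum_univ_three]
    linear_combination hw' + (- j (h 0) * (j (h 0) * j (w 0) + j (h 1) * j (w 1) + j (h 2) * j (w 2))) * htt
  obtain ⟨gs, hgs, hgs0⟩ := base_completion (by have := h2.map (algebraMap R (Dbl a)); rwa [map_ofNat] at this)
    (height_le_integral (R := R) 2 hd) us husU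
  set p0 := mapRingHom (dev0 a)
  set p1 := mapRingHom (dev1 a)
  have hp0j : ∀ x, p0 (j x) = x := by
    intro x
    have : (dev0 a).comp (algebraMap R (Dbl a)) = RingHom.id R := by ext; simp [dev0]
    simp [p0, hj, Polynomial.map_map, this]
  have hp1j : ∀ x, p1 (j x) = x := by
    intro x
    have : (dev1 a).comp (algebraMap R (Dbl a)) = RingHom.id R := by ext; simp [dev1]
    simp [p1, hj, Polynomial.map_map, this]
  have hp0t : p0 t = 0 := by simp [p0, ht, dev0]
  have hp1t : p1 t = C a := by simp [p1, ht, dev1]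
  set g0 := gs.map p0 with hg0
  set g1 := gs.map p1 with hg1
  have hdg0 : IsUnit g0.det := by
    have := hgs.map p0; rwa [RingHom.map_det] at this
  have hdg1 : IsUnit g1.det := by
    have := hgs.map p1; rwa [RingHom.map_det] at this
  obtain ⟨L, hL⟩ : ∃ L : Matrix (Fin 3) (Fin 3) R[X], g1 = g0 + C a • L := by
    have : ∀ x : (Dbl a)[X], ∃ y, p1 x = p0 x + C a * y := by
      intro x
      induction x using Polynomial.induction_on' with
      | add p q hp hq =>
        obtain ⟨y, hy⟩ := hp
        obtain ⟨z, hz⟩ := hq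
        exact ⟨y + z, by rw [map_add, map_add, hy, hz]; ring⟩
      | monomial n c =>
        refine ⟨monomial n c.im, ?_⟩
        simp [p0, p1, dev0, dev1, C_mul_monomial]
    choose y hy using this
    exact ⟨gs.map y, by ext1 i k; simp [hg0, hg1, hy]⟩
  have hr0 : ∀ k, g0 0 k = (1 : Matrix (Fin 3) (Fin 3) R[X]) 0 k := by
    intro k
    rw [hg0, map_apply, hgs0, hus]
    simp only [map_add, map_mul, hp0t, zero_mul, add_zero]
    fin_cases k <;> simp [one_apply]
  have hr1 : ∀ k, g1 0 k = (1 : Matrix (Fin 3) (Fin 3) R[X]) 0 k + C a * h k := by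
    intro k
    rw [hg1, map_apply, hgs0, hus]
    simp only [map_add, map_mul, hp1t, hp1j]
    fin_cases k <;> simp [one_apply]
  have hi0 : ∀ k, g0⁻¹ 0 k = (1 : Matrix (Fin 3) (Fin 3) R[X]) 0 k := by
    intro k
    have h5 : (g0 * g0⁻¹) 0 k = (1 : Matrix (Fin 3) (Fin 3) R[X]) 0 k := by rw [mul_nonsing_inv _ hdg0]
    rw [mul_apply] at h5
    simp only [hr0] at h5
    rw [← h5]
    simp [one_apply]
  have e1 : g0⁻¹ * g1 = 1 + C a • (g0⁻¹ * L) := by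
    rw [hL, mul_add, nonsing_inv_mul _ hdg0, Matrix.mul_smul]
  have e2 : 1 + C a • ((g0⁻¹ * L).updateRow 0 h) = g0⁻¹ * g1 := by
    ext1 i k
    by_cases hi : i = 0
    · subst hi
      rw [mul_apply]
      simp only [hi0]
      rw [Fin.sum_univ_three]
      simp [hr1]
    · rw [e1]; simp [updateRow_ne hi]
  refine ⟨(g0⁻¹ * L).updateRow 0 h, ?_, ?_⟩
  · rw [e2, det_mul]
    exact (isUnit_nonsing_inv_det _ hdg0).mul hdg1
  · exact updateRow_self

end Excision

section EndStep
open Matrix Polynomial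

variable {R : Type*} [CommRing R]

theorem exists_G [IsLocalRing R] [IsNoetherianRing R] (h2 : IsUnit (2 : R)) (b : Ideal R)
    (hb : ∀ p : Ideal (R ⧸ b), p.IsPrime → p.height ≤ (2 : ℕ)) (a : R)
    (ha : a ∈ IsLocalRing.maximalIdeal R) (h : Fin 3 → R[X])
    (hu : Uni (fun i => mapRingHom (Ideal.Quotient.mk b)
      ((Pi.single 0 1 : Fin 3 → R[X]) i + C a * h i))) :
    ∃ K : Matrix (Fin 3) (Fin 3) R[X], K 0 = h ∧
      IsUnit (mapRingHom (Ideal.Quotient.mk b) (1 + C a • K).det) := by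
  set q := Ideal.Quotient.mk b with hq
  by_cases hbt : b = ⊤
  · refine ⟨Matrix.of fun _ => h, rfl, ?_⟩
    have : Subsingleton (R ⧸ b) := Ideal.Quotient.subsingleton_iff.2 hbt
    exact isUnit_of_subsingleton _
  have : Nontrivial (R ⧸ b) := Ideal.Quotient.nontrivial_iff.2 hbt
  have hl : IsLocalRing (R ⧸ b) := IsLocalRing.of_surjective' q Ideal.Quotient.mk_surjective
  have hal : q a ∈ IsLocalRing.maximalIdeal (R ⧸ b) := by
    have hbm : b ≤ IsLocalRing.maximalIdeal R := IsLocalRing.le_maximalIdeal hbt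
    intro hun
    obtain ⟨c, hc⟩ := hun.exists_right_inv
    obtain ⟨c, rfl⟩ := Ideal.Quotient.mk_surjective c
    have : a * c - 1 ∈ b := by
      rw [← Ideal.Quotient.eq_zero_iff_mem]; simpa [sub_eq_zero] using hc
    have h1 := (IsLocalRing.maximalIdeal R).sub_mem (Ideal.mul_mem_right c _ ha) (hbm this)
    rw [sub_sub_cancel] at h1
    exact h1 isUnit_one
  obtain ⟨K, hK, hK0⟩ := exc_matrix (R := R ⧸ b)
    (by have := h2.map q; rwa [map_ofNat] at this) hb (q a) hal
    (fun i => mapRingHom q (h i)) (by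
      convert hu using 2 with i
      rw [map_add, map_mul, coe_mapRingHom, map_C]
      congr 1
      fin_cases i <;> simp)
  have hs : Function.Surjective (mapRingHom q) := by
    rw [coe_mapRingHom]; exact map_surjective q Ideal.Quotient.mk_surjective
  choose s hs' using hs
  refine ⟨(K.map s).updateRow 0 h, updateRow_self, ?_⟩
  convert hK
  rw [RingHom.map_det]
  congr 1
  ext1 i j
  by_cases hi : i = 0
  · subst hi
    simp [one_apply, apply_ite, hK0]
  · simp [one_apply, apply_ite, updateRow_ne hi]
    congr 1
    exact hs' _

theorem end_step {κ : Type*} [Fintype κ] [DecidableEq κ] (hκ : Even (Fintype.card κ)) (b : Ideal R)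
    (a : R) (c : κ → R) (hab : ∀ x ∈ b, ∃ N : ℕ, a ^ N * x ∈ Ideal.span (Set.range c))
    (h : Fin 3 → R[X]) (K : Matrix (Fin 3) (Fin 3) R[X]) (hK : K 0 = h)
    (hK' : IsUnit (mapRingHom (Ideal.Quotient.mk b) (1 + C a • K).det)) :
    CProp (Sum.elim (fun i => (Pi.single 0 1 : Fin 3 → R[X]) i + C a * h i) (fun k => C (c k))) := by
  obtain ⟨x, hx0, hx⟩ := even_lemma hκ (fun k => C (c k) : κ → R[X])
  set G := 1 + C a • K with hG
  have hadj : G * G.adjugate = G.det • 1 := mul_adjugate G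
  have hrow : ∀ i, G 0 i = (Pi.single 0 1 : Fin 3 → R[X]) i + C a * h i := by
    intro i
    rw [hG, Matrix.add_apply, Matrix.smul_apply, hK]
    fin_cases i <;> simp [one_apply]
  refine ⟨Sum.elim (fun i => G.adjugate i 1) x, ?_, ?_⟩
  · by_contra hcon
    obtain ⟨P, hP, hle⟩ := Ideal.exists_le_maximal _ hcon
    have hxP : ∀ k, x k ∈ P := fun k => hle (Ideal.subset_span ⟨Sum.inr k, rfl⟩)
    have hcP : ∀ k, C (c k) ∈ P := fun k => by
      have : Ideal.span (Set.range x) ≤ P := by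
        rw [Ideal.span_le]; rintro _ ⟨k, rfl⟩; exact hxP k
      exact this (hx k)
    have hdP : G.det ∈ P := by
      have h1 := congrFun (congrFun hadj 1) 1
      rw [mul_apply] at h1
      simp only [Matrix.smul_apply, one_apply_eq, smul_eq_mul, mul_one] at h1
      rw [← h1]
      exact P.sum_mem fun i _ => P.mul_mem_left _ (hle (Ideal.subset_span ⟨Sum.inl i, rfl⟩))
    have haP : C a ∉ P := by
      intro haP
      have h1 : Ideal.Quotient.mk P G.det = 1 := by
        rw [RingHom.map_det, hG]
        have : (Ideal.Quotient.mk P).mapMatrix (1 + C a • K) = 1 := by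
          ext1 i j
          have h0 : Ideal.Quotient.mk P (C a) = 0 := Ideal.Quotient.eq_zero_iff_mem.2 haP
          simp [one_apply, apply_ite, h0]
        rw [this, det_one]
      rw [Ideal.Quotient.eq_zero_iff_mem.2 hdP] at h1
      exact hP.ne_top ((Ideal.eq_top_iff_one _).2 (Ideal.Quotient.eq_zero_iff_mem.1
        ((map_one _).trans h1.symm)))
    have hbP : b.map C ≤ P := by
      rw [Ideal.map_le_iff_le_comap]
      intro y hy
      obtain ⟨N, hN⟩ := hab y hy
      have h1 : Ideal.span (Set.range c) ≤ P.comap C := by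
        rw [Ideal.span_le]; rintro _ ⟨k, rfl⟩; exact hcP k
      have h2 := h1 hN
      rw [Ideal.mem_comap, map_mul, map_pow] at h2
      rcases hP.isPrime.mem_or_mem h2 with h3 | h3
      · exact absurd (hP.isPrime.mem_of_pow_mem _ h3) haP
      · exact h3
    obtain ⟨z, hz⟩ := hK'.exists_right_inv
    obtain ⟨z, rfl⟩ := map_surjective _ Ideal.Quotient.mk_surjective z
    have h3 : G.det * z - 1 ∈ b.map C := by
      rw [← Ideal.mk_ker (I := b), ← ker_mapRingHom, RingHom.mem_ker, map_sub, map_mul, map_one, sub_eq_zero]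
      exact hz
    have h4 := P.sub_mem (P.mul_mem_right z hdP) (hbP h3)
    rw [sub_sub_cancel] at h4
    exact hP.ne_top ((Ideal.eq_top_iff_one _).2 h4)
  · rw [Fintype.sum_sum_type]
    simp only [Sum.elim_inl, Sum.elim_inr, hx0, add_zero, ← hrow]
    have h1 := congrFun (congrFun hadj 0) 1
    rw [mul_apply] at h1
    rw [h1]; simp

end EndStep

section RelRow
set_option linter.unusedSectionVars false
open Polynomial

variable {S ι : Type*} [CommRing S] [Fintype ι] [DecidableEq ι]

/-- elementary equivalence modulo `x0` -/
def REq (x0 : S[X]) (y w : ι → S[X]) : Prop :=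
  EEq (fun i => Ideal.Quotient.mk (Ideal.span {x0}) (y i))
    (fun i => Ideal.Quotient.mk (Ideal.span {x0}) (w i))

/-- unimodular modulo `x0` -/
def RUni (x0 : S[X]) (y : ι → S[X]) : Prop :=
  Uni (fun i => Ideal.Quotient.mk (Ideal.span {x0}) (y i))

theorem REq.runi {x0 : S[X]} {y w : ι → S[X]} (h : REq x0 y w) (hy : RUni x0 y) : RUni x0 w :=
  EEq.uni h hy

theorem REq.trans {x0 : S[X]} {y w z : ι → S[X]} (h : REq x0 y w) (h' : REq x0 w z) : REq x0 y z :=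
  EEq.trans h h'

theorem EEq.req {x0 : S[X]} {y w : ι → S[X]} (h : EEq y w) : REq x0 y w := EEq.map h _

theorem RUni.top {x0 : S[X]} {y : ι → S[X]} (h : RUni x0 y) (J : Ideal S[X]) (hx : x0 ∈ J)
    (hy : ∀ i, y i ∈ J) : J = ⊤ := by
  obtain ⟨w, hw⟩ := uni_iff.1 h
  choose s hs using fun i => Ideal.Quotient.mk_surjective (w i)
  have : ∑ i, y i * s i - 1 ∈ Ideal.span {x0} := by
    rw [← Ideal.Quotient.eq_zero_iff_mem, map_sub, map_sum]
    simp [hs, hw]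
  have h1 : Ideal.span {x0} ≤ J := by rwa [Ideal.span_le, Set.singleton_subset_iff]
  have h2 := J.sub_mem (J.sum_mem (t := Finset.univ) fun i _ => J.mul_mem_right (s i) (hy i)) (h1 this)
  rw [sub_sub_cancel] at h2
  exact (Ideal.eq_top_iff_one _).2 h2

theorem REq.block (x0 : S[X]) (v w : ι → S[X]) (T : Finset ι) (h1 : ∀ i, i ∉ T → w i = v i)
    (h2 : ∀ i ∈ T, w i - v i ∈ Ideal.span {x0} ⊔ Ideal.span (v '' {k | k ∉ T})) : REq x0 v w := by
  refine EEq.block _ _ T (fun i hi => by rw [h1 i hi]) fun i hi => ?_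
  have := Ideal.mem_map_of_mem (Ideal.Quotient.mk (Ideal.span {x0})) (h2 i hi)
  rw [Ideal.map_sup, Ideal.map_quotient_self, bot_sup_eq, Ideal.map_span, ← Set.image_comp,
    map_sub] at this
  exact this

/-- Step (i): make one entry monic. -/
theorem rel_monic [IsNoetherianRing S] [Nontrivial S] (e : ℕ)
    (hS : ∀ p : Ideal S, p.IsPrime → p.height ≤ e) (x0 : S[X])
    (hx0 : ∀ P : Ideal S[X], P.IsPrime → x0 ∈ P → ((1 : ℕ) : ℕ∞) ≤ P.height)
    (hι : Fintype.card ι = e + 1) (y : ι → S[X]) (hy : RUni x0 y) (i0 : ι) :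
    ∃ w : ι → S[X], REq x0 y w ∧ (w i0).Monic ∧ ∃ m, (w i0).natDegree = m + 1 := by
  obtain ⟨l, hl⟩ := gp1 (κ := {i // i ≠ i0}) (Ideal.span {x0}) 1
    (fun P hP h => hx0 P hP (h (Ideal.mem_span_singleton_self _))) (fun i => y i) (y i0) (by
      refine hy.top _ (Ideal.mem_sup_left (Ideal.mem_sup_left (Ideal.mem_span_singleton_self _))) ?_
      intro i
      by_cases hi : i = i0
      · subst hi; exact Ideal.mem_sup_right (Ideal.mem_span_singleton_self _)
      · exact Ideal.mem_sup_left (Ideal.mem_sup_right (Ideal.subset_span ⟨⟨i, hi⟩, rfl⟩)))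
  set y1 : ι → S[X] := fun i => if h : i = i0 then y i0 else y i + l ⟨i, h⟩ * y i0 with hy1
  have h1 : REq x0 y y1 := by
    refine REq.block _ _ _ (Finset.univ.erase i0) ?_ ?_
    · intro i hi
      simp at hi; subst hi; simp [hy1]
    · intro i hi
      have hi' : i ≠ i0 := by simpa using hi
      simp only [hy1, dif_neg hi', add_sub_cancel_left]
      exact Ideal.mem_sup_right (Ideal.mul_mem_left _ _ (Ideal.subset_span ⟨i0, by simp, rfl⟩))
  obtain ⟨F, hF, hFm⟩ := exists_monic_of_height_ideal e hS
    (Ideal.span {x0} ⊔ Ideal.span (y1 '' {k | k ∉ ({i0} : Finset ι)})) (by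
      intro P hP hle
      have hc : 1 + Fintype.card {i // i ≠ i0} = e + 1 := by
        rw [Fintype.card_subtype_compl]; simp; omega
      rw [← hc]
      refine hl P hP (le_sup_left.trans hle) ?_
      rintro ⟨i, hi⟩
      have : y1 i ∈ P := hle (Ideal.mem_sup_right (Ideal.subset_span ⟨i, by simpa using hi, rfl⟩))
      simpa [hy1, hi] using this)
  set N := (y i0).natDegree + 1
  refine ⟨Function.update y1 i0 (y1 i0 + X ^ N * F), h1.trans ?_, ?_⟩
  · refine REq.block _ _ _ {i0} ?_ ?_
    · intro i hi
      rw [Function.update_of_ne (by simpa using hi)]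
    · intro i hi
      obtain rfl := Finset.mem_singleton.1 hi
      rw [Function.update_self, add_sub_cancel_left]
      exact Ideal.mul_mem_left _ _ hF
  · have e1 : y1 i0 = y i0 := by simp [hy1]
    rw [Function.update_self, e1]
    have hm : (X ^ N * F).Monic := (monic_X_pow N).mul hFm
    have hd : (X ^ N * F).natDegree = N + F.natDegree := by
      rw [(monic_X_pow N).natDegree_mul hFm, natDegree_X_pow]
    have hlt : (y i0).natDegree < (X ^ N * F).natDegree := by rw [hd]; omega
    refine ⟨?_, (y i0).natDegree + F.natDegree, ?_⟩
    · exact hm.add_of_right (degree_lt_degree hlt)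
    · rw [natDegree_add_eq_right_of_natDegree_lt hlt, hd]; omega

theorem content_top [IsNoetherianRing S] (x0 : S[X]) (y : ι → S[X]) (hy : RUni x0 y) (i0 i1 : ι)
    (hm : (y i0).Monic) : ∃ ν : S, C ν ∈ Ideal.span {x0, y i0, y i1} ∧
      Ideal.span {c | ∃ i, i ≠ i0 ∧ i ≠ i1 ∧ ∃ j, (y i).coeff j = c} ⊔ Ideal.span {ν} = ⊤ := by
  set N : Ideal S[X] := Ideal.span {x0, y i0, y i1} with hN
  set c : Ideal S := Ideal.span {c | ∃ i, i ≠ i0 ∧ i ≠ i1 ∧ ∃ j, (y i).coeff j = c} with hc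
  have hfin : Algebra.IsIntegral S (S[X] ⧸ N) := by
    have h1 : Module.Finite S (AdjoinRoot (y i0)) := hm.finite_adjoinRoot
    have h2 : Algebra.IsIntegral S (S[X] ⧸ Ideal.span {y i0}) :=
      (inferInstance : Algebra.IsIntegral S (AdjoinRoot (y i0)))
    have h3 : Ideal.span {y i0} ≤ N := Ideal.span_mono (by simp)
    have h4 : Function.Surjective (Ideal.Quotient.factorₐ S h3) := Ideal.Quotient.factor_surjective h3
    exact Algebra.IsIntegral.of_surjective (R := S) (A := S[X] ⧸ Ideal.span {y i0})
      (Ideal.Quotient.factorₐ S h3) h4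
  have key : c ⊔ N.comap C = ⊤ := by
    by_contra hcon
    obtain ⟨p, hp, hle⟩ := Ideal.exists_le_maximal _ hcon
    have hpp := hp.isPrime
    obtain ⟨Q, -, hQ, hQp⟩ := Ideal.exists_ideal_over_prime_of_isIntegral (S := S[X] ⧸ N) p ⊥ (by
      intro x hx
      refine hle (Ideal.mem_sup_right ?_)
      rw [Ideal.mem_comap] at hx ⊢
      rw [← Ideal.Quotient.eq_zero_iff_mem]
      exact hx)
    have hC : ∀ x ∈ p, C x ∈ Q.comap (Ideal.Quotient.mk N) := by
      intro x hx
      rw [← hQp] at hx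
      exact hx
    have hNQ : ∀ x ∈ N, x ∈ Q.comap (Ideal.Quotient.mk N) := by
      intro x hx
      rw [Ideal.mem_comap, Ideal.Quotient.eq_zero_iff_mem.2 hx]; exact Q.zero_mem
    have := hy.top (Q.comap (Ideal.Quotient.mk N)) (hNQ _ (Ideal.subset_span (by simp))) (by
      intro i
      by_cases h0 : i = i0
      · subst h0; exact hNQ _ (Ideal.subset_span (by simp))
      by_cases h1 : i = i1
      · subst h1; exact hNQ _ (Ideal.subset_span (by simp))
      rw [as_sum_support_C_mul_X_pow (y i)]
      refine Ideal.sum_mem _ fun j _ => Ideal.mul_mem_right _ _ (hC _ ?_)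
      exact hle (Ideal.mem_sup_left (Ideal.subset_span ⟨i, h0, h1, j, rfl⟩)))
    have h5 : (Q.comap (Ideal.Quotient.mk N)).IsPrime := inferInstance
    exact h5.ne_top this
  have h1 : (1 : S) ∈ c ⊔ N.comap C := by rw [key]; trivial
  obtain ⟨κ, hκ, ν, hν, h⟩ := Submodule.mem_sup.1 h1
  refine ⟨ν, hν, (Ideal.eq_top_iff_one _).2 ?_⟩
  rw [← h]
  exact Ideal.add_mem _ (Ideal.mem_sup_left hκ) (Ideal.mem_sup_right (Ideal.mem_span_singleton_self _))

/-- Step (ii): lower the degree of the monic entry. -/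
theorem rel_lower [IsNoetherianRing S] (e : ℕ) (he : 3 ≤ e)
    (hS : ∀ p : Ideal S, p.IsPrime → p.height ≤ e) (x0 : S[X])
    (hι : Fintype.card ι = e + 1) (m : ℕ) : ∀ (y : ι → S[X]) (_ : RUni x0 y) (i0 : ι)
    (_ : (y i0).Monic) (_ : (y i0).natDegree = m + 1),
    ∃ (w : ι → S[X]) (i1 : ι), REq x0 y w ∧ (w i1).Monic ∧ (w i1).natDegree = 1 := by
  induction m with
  | zero => intro y _ i0 hm hd; exact ⟨y, i0, EEq.refl _, hm, hd⟩
  | succ m ih =>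
    intro y0 hy0 i0 hm0 hd0
    obtain ⟨y, hy⟩ : ∃ y, y = (fun i => if i = i0 then y0 i0 else y0 i %ₘ y0 i0) := ⟨_, rfl⟩
    have h1 : REq x0 y0 y := by rw [hy]; exact (EEq.reduce y0 i0).req
    have hyU := h1.runi hy0
    have e0 : y i0 = y0 i0 := by simp [hy]
    have hdeg : ∀ i, i ≠ i0 → (y i).natDegree ≤ m + 1 := by
      intro i hi
      simp only [hy, if_neg hi]
      exact natDegree_modByMonic_le' hm0 hd0 _
    have hm : (y i0).Monic := by rw [e0]; exact hm0
    have hd : (y i0).natDegree = m + 1 + 1 := by rw [e0]; exact hd0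
    obtain ⟨i1, h10⟩ : ∃ i1, i1 ≠ i0 := by
      have : Nontrivial ι := Fintype.one_lt_card_iff_nontrivial.1 (by omega)
      exact exists_ne i0
    obtain ⟨ν, hν, htop⟩ := content_top x0 y hyU i0 i1 hm
    obtain ⟨l, hl⟩ := gp1 (κ := {i // i ≠ i0 ∧ i ≠ i1} × Fin (m + 2)) (⊥ : Ideal S) 0 (by simp)
      (fun k => (y k.1).coeff k.2) ν (by
        rw [bot_sup_eq, eq_top_iff, ← htop]
        refine sup_le_sup_right ?_ _
        rw [Ideal.span_le]
        rintro _ ⟨i, h0, h1, j, rfl⟩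
        by_cases hj : j < m + 2
        · exact Ideal.subset_span ⟨(⟨i, h0, h1⟩, ⟨j, hj⟩), rfl⟩
        · have := hdeg i h0
          rw [coeff_eq_zero_of_natDegree_lt (by omega)]; exact Ideal.zero_mem _)
    set pl : {i // i ≠ i0 ∧ i ≠ i1} → S[X] := fun k => ∑ j : Fin (m + 2), C (l (k, j)) * X ^ (j : ℕ) with hpl
    have hplc : ∀ k (j : Fin (m + 2)), (pl k).coeff j = l (k, j) := by
      intro k j
      simp only [hpl, finsetSum_coeff, coeff_C_mul, coeff_X_pow]
      rw [Finset.sum_eq_single j]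
      · simp
      · intro b _ hb
        have : (j : ℕ) ≠ b := fun h => hb (Fin.ext h.symm)
        simp [this]
      · simp
    have hpld : ∀ k, (pl k).natDegree ≤ m + 1 := by
      intro k
      refine natDegree_sum_le_of_forall_le _ _ fun j _ => ?_
      exact (natDegree_C_mul_X_pow_le _ _).trans (by omega)
    set w : ι → S[X] := fun i => if h : i ≠ i0 ∧ i ≠ i1 then y i + C ν * pl ⟨i, h⟩ else y i with hw
    have hw0 : w i0 = y i0 := by simp [hw]
    have hw1 : w i1 = y i1 := by simp [hw]
    have hwi : ∀ i (h : i ≠ i0 ∧ i ≠ i1), w i = y i + C ν * pl ⟨i, h⟩ := by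
      intro i h; simp only [hw, dif_pos h]
    have h2 : REq x0 y w := by
      refine REq.block _ _ _ (Finset.univ.filter fun i => i ≠ i0 ∧ i ≠ i1) ?_ ?_
      · intro i hi
        have : ¬ (i ≠ i0 ∧ i ≠ i1) := by simpa using hi
        simp only [hw, dif_neg this]
      · intro i hi
        have hi' : i ≠ i0 ∧ i ≠ i1 := by simpa using hi
        rw [hwi i hi', add_sub_cancel_left]
        refine Ideal.mul_mem_right _ _ ?_
        have hle : Ideal.span {x0, y i0, y i1} ≤ Ideal.span {x0} ⊔ Ideal.span
            (y '' {k | k ∉ (Finset.univ.filter fun i => i ≠ i0 ∧ i ≠ i1)}) := by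
          rw [Ideal.span_le]
          rintro z (rfl | rfl | rfl)
          · exact Ideal.mem_sup_left (Ideal.mem_span_singleton_self _)
          · exact Ideal.mem_sup_right (Ideal.subset_span ⟨i0, by simp, rfl⟩)
          · exact Ideal.mem_sup_right (Ideal.subset_span ⟨i1, by simp, rfl⟩)
        exact hle hν
    have hwdeg : ∀ i, i ≠ i0 ∧ i ≠ i1 → (w i).natDegree ≤ m + 1 := by
      intro i h
      rw [hwi i h]
      exact (natDegree_add_le _ _).trans (max_le (hdeg i h.1)
        ((natDegree_C_mul_le _ _).trans (hpld _)))
    obtain ⟨q, hqI, hqd, hq1⟩ := ell (w i0) (by rw [hw0]; exact hm) (m + 1) (by rw [hw0]; exact hd)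
      (Ideal.span (w '' {k | k ∉ ({i1} : Finset ι)})) (Ideal.subset_span ⟨i0, by simpa using h10.symm, rfl⟩)
      {g | ∃ i, i ≠ i0 ∧ i ≠ i1 ∧ w i = g} (by
        rintro _ ⟨i, h, h', rfl⟩
        exact ⟨Ideal.subset_span ⟨i, by simpa using h', rfl⟩, hwdeg i ⟨h, h'⟩⟩) (by
        by_contra hcon
        obtain ⟨P, hP, hle⟩ := Ideal.exists_le_maximal _ hcon
        have h3 := hl P hP.isPrime bot_le (by
          rintro ⟨⟨i, hi⟩, j⟩
          have : (w i).coeff j ∈ P := hle (Ideal.subset_span ⟨w i, ⟨i, hi.1, hi.2, rfl⟩, j, rfl⟩)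
          rw [hwi i hi, coeff_add, coeff_C_mul, hplc, mul_comm] at this
          exact this)
        have h4 := Nat.cast_le.1 (h3.trans (hS P hP.isPrime))
        have h5 : Fintype.card {i // i ≠ i0 ∧ i ≠ i1} = e - 1 := by
          rw [Fintype.card_subtype]
          have : (Finset.univ.filter fun i => i ≠ i0 ∧ i ≠ i1) = (Finset.univ.erase i0).erase i1 := by
            ext; simp [and_comm]
          rw [this, Finset.card_erase_of_mem (by simpa using h10), Finset.card_erase_of_mem (by simp),
            Finset.card_univ, hι]; omega
        rw [Fintype.card_prod, h5, Fintype.card_fin] at h4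
        obtain ⟨e', rfl⟩ := Nat.exists_eq_add_of_le he
        have : 3 + e' - 1 = e' + 2 := by omega
        rw [this] at h4
        nlinarith)
    obtain ⟨hM, hMd, hM1⟩ := monic_of_add (w i1) q (m + 1) (by rw [hw1]; exact hdeg i1 h10) hqd hq1
    set w2 := Function.update w i1 (w i1 + C (1 - (w i1).coeff (m + 1)) * q) with hw2
    have h3 : REq x0 w w2 := by
      refine REq.block _ _ _ {i1} ?_ ?_
      · intro i hi
        rw [hw2, Function.update_of_ne (by simpa using hi)]
      · intro i hi
        obtain rfl := Finset.mem_singleton.1 hi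
        rw [hw2, Function.update_self, add_sub_cancel_left]
        exact Ideal.mem_sup_right (Ideal.mul_mem_left _ _ hqI)
    have h4 := (h1.trans h2).trans h3
    have e2 : w2 i1 = w i1 + C (1 - (w i1).coeff (m + 1)) * q := Function.update_self ..
    have hnt : Nontrivial S := by
      by_contra hcon
      rw [not_nontrivial_iff_subsingleton] at hcon
      have : (y i0) = 0 := Subsingleton.elim _ _
      rw [this] at hd; simp at hd
    obtain ⟨w3, i3, h5, h6⟩ := ih w2 (h4.runi hy0) i1 (by rw [e2]; exact hM) (by
      rw [e2]
      exact natDegree_eq_of_le_of_coeff_ne_zero hMd (by rw [hM1]; exact one_ne_zero))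
    exact ⟨w3, i3, h4.trans h5, h6⟩

end RelRow

section RelFinal
open Polynomial

variable {S ι : Type*} [CommRing S] [Fintype ι] [DecidableEq ι]

theorem card_two_compl (e : ℕ) (hι : Fintype.card ι = e + 1) {i0 i1 : ι} (h10 : i1 ≠ i0) :
    Fintype.card {i // i ≠ i0 ∧ i ≠ i1} = e - 1 := by
  rw [Fintype.card_subtype]
  have : (Finset.univ.filter fun i => i ≠ i0 ∧ i ≠ i1) = (Finset.univ.erase i0).erase i1 := by
    ext; simp [and_comm]
  rw [this, Finset.card_erase_of_mem (by simpa using h10), Finset.card_erase_of_mem (by simp),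
    Finset.card_univ, hι]; omega

theorem rel_final [IsNoetherianRing S] [Nontrivial S] (e : ℕ) (he : 3 ≤ e)
    (hS : ∀ p : Ideal S, p.IsPrime → p.height ≤ e) (x0 : S[X])
    (hx0 : ∀ P : Ideal S[X], P.IsPrime → x0 ∈ P → ((1 : ℕ) : ℕ∞) ≤ P.height)
    (hι : Fintype.card ι = e + 1) (y : ι → S[X]) (hy : RUni x0 y) :
    ∃ (i0 i1 : ι) (s : S) (c : ι → S), i1 ≠ i0 ∧
      REq x0 y (fun i => if i = i0 then X - C s else C (c i)) ∧
      ∀ P : Ideal S, P.IsPrime → (∀ i, i ≠ i0 → i ≠ i1 → c i ∈ P) → ((e - 1 : ℕ) : ℕ∞) ≤ P.height := by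
  have hnι : Nontrivial ι := Fintype.one_lt_card_iff_nontrivial.1 (by omega)
  obtain ⟨ii⟩ : Nonempty ι := inferInstance
  obtain ⟨y1, h1, hm1, m, hd1⟩ := rel_monic e hS x0 hx0 hι y hy ii
  obtain ⟨y2, i0, h2, hm2, hd2⟩ := rel_lower e he hS x0 hι m y1 (h1.runi hy) ii hm1 hd1
  obtain ⟨s, hs⟩ : ∃ s, y2 i0 = X - C s := by
    refine ⟨-(y2 i0).coeff 0, ?_⟩
    have := hm2.eq_X_add_C hd2
    rw [C_neg, sub_neg_eq_add]; exact this
  set c : ι → S := fun i => (y2 i %ₘ y2 i0).coeff 0 with hc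
  set y3 : ι → S[X] := fun i => if i = i0 then X - C s else C (c i) with hy3
  have h3 : REq x0 y2 y3 := by
    have : y3 = fun i => if i = i0 then y2 i0 else y2 i %ₘ y2 i0 := by
      ext1 i
      simp only [hy3]
      split_ifs with hi
      · exact hs.symm
      · have := natDegree_modByMonic_le' hm2 (m := 0) hd2 (y2 i)
        exact (eq_C_of_natDegree_le_zero this).symm
    rw [this]; exact (EEq.reduce y2 i0).req
  have h13 := (h1.trans h2).trans h3
  have hU3 := h13.runi hy
  obtain ⟨i1, h10⟩ := exists_ne i0
  set t := x0.eval s with ht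
  have htop : Ideal.span (Set.range fun k : {i // i ≠ i0 ∧ i ≠ i1} => c k) ⊔ Ideal.span {t, c i1} = ⊤ := by
    set J := Ideal.span (Set.range fun k : {i // i ≠ i0 ∧ i ≠ i1} => c k) ⊔ Ideal.span {t, c i1} with hJ
    have h4 := hU3.top (J.comap (evalRingHom s)) (by
      rw [Ideal.mem_comap]; exact Ideal.mem_sup_right (Ideal.subset_span (by simp [ht]))) (by
      intro i
      rw [Ideal.mem_comap]
      by_cases hi0 : i = i0
      · simp [hy3, hi0]
      by_cases hi1 : i = i1
      · simp only [hy3, if_neg hi0, coe_evalRingHom, eval_C]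
        subst hi1
        exact Ideal.mem_sup_right (Ideal.subset_span (by simp))
      · simp only [hy3, if_neg hi0, coe_evalRingHom, eval_C]
        exact Ideal.mem_sup_left (Ideal.subset_span ⟨⟨i, hi0, hi1⟩, rfl⟩))
    rw [Ideal.eq_top_iff_one, Ideal.mem_comap, map_one] at h4
    exact (Ideal.eq_top_iff_one _).2 h4
  obtain ⟨k, hk, z, hz, hkz⟩ := Submodule.mem_sup.1 ((Ideal.eq_top_iff_one _).1 htop)
  obtain ⟨l, hl⟩ := gp1 (κ := {i // i ≠ i0 ∧ i ≠ i1}) (⊥ : Ideal S) 0 (by simp) (fun k => c k) z (by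
    rw [bot_sup_eq, Ideal.eq_top_iff_one, ← hkz]
    exact Ideal.add_mem _ (Ideal.mem_sup_left hk) (Ideal.mem_sup_right (Ideal.mem_span_singleton_self _)))
  refine ⟨i0, i1, s, fun i => if h : i ≠ i0 ∧ i ≠ i1 then c i + l ⟨i, h⟩ * z else c i, h10,
    h13.trans ?_, ?_⟩
  · refine REq.block _ _ _ (Finset.univ.filter fun i => i ≠ i0 ∧ i ≠ i1) ?_ ?_
    · intro i hi
      have : ¬ (i ≠ i0 ∧ i ≠ i1) := by simpa using hi
      simp only [hy3, dif_neg this]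
    · intro i hi
      have hi' : i ≠ i0 ∧ i ≠ i1 := by simpa using hi
      simp only [hy3, dif_pos hi', if_neg hi'.1]
      rw [C_add, add_sub_cancel_left, C_mul]
      refine Ideal.mul_mem_left _ _ ?_
      have hle : Ideal.span {t, c i1} ≤ (Ideal.span {x0} ⊔ Ideal.span
          (y3 '' {k | k ∉ (Finset.univ.filter fun i => i ≠ i0 ∧ i ≠ i1)})).comap C := by
        rw [Ideal.span_le]
        rintro z (rfl | rfl)
        · obtain ⟨p, hp⟩ : X - C s ∣ x0 - C t := by
            rw [dvd_iff_isRoot]; simp [ht]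
          have : C t = x0 - p * (X - C s) := by linear_combination -hp
          rw [SetLike.mem_coe, Ideal.mem_comap, this]
          refine Ideal.sub_mem _ (Ideal.mem_sup_left (Ideal.mem_span_singleton_self _))
            (Ideal.mem_sup_right (Ideal.mul_mem_left _ _ (Ideal.subset_span ⟨i0, by simp, ?_⟩)))
          simp [hy3]
        · exact Ideal.mem_sup_right (Ideal.subset_span ⟨i1, by simp, by simp [hy3, h10]⟩)
      exact hle hz
  · intro P hP h
    have := hl P hP bot_le (by
      rintro ⟨i, hi⟩
      have := h i hi.1 hi.2
      simpa [hi] using this)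
    rwa [card_two_compl e hι h10, zero_add] at this

end RelFinal

section Descend
open Polynomial

theorem EEq.scale {A ι : Type*} [CommRing A] [Fintype ι] [DecidableEq ι] (v : ι → A) (i0 : ι)
    (u : A) (hu : IsUnit u) : ∃ z, EEq v (fun i => if i = i0 then z else u * v i) := by
  obtain ⟨u', huu⟩ := hu.exists_right_inv
  have key : ∀ T : Finset ι, i0 ∉ T →
      ∃ z, EEq v (fun i => if i = i0 then z else if i ∈ T then u * v i else v i) := by
    intro T
    induction T using Finset.induction_on with
    | empty =>
      intro _
      refine ⟨v i0, ?_⟩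
      have : (fun i => if i = i0 then v i0 else if i ∈ (∅ : Finset ι) then u * v i else v i) = v := by
        ext1 i
        by_cases h : i = i0
        · subst h; simp
        · simp [h]
      rw [this]; exact EEq.refl _
    | insert j T hj ih =>
      intro h
      rw [Finset.mem_insert, not_or] at h
      obtain ⟨z, hz⟩ := ih h.2
      refine ⟨u' * z, hz.trans ?_⟩
      have h1 := EEq.whitehead (fun i => if i = i0 then z else if i ∈ T then u * v i else v i)
        (Ne.symm h.1) u u' huu
      convert h1 using 1
      ext1 i
      by_cases hi : i = i0
      · subst hi; simp
      · rw [Function.update_of_ne hi]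
        by_cases hij : i = j
        · subst hij; simp [hi, hj]
        · simp [hi, hij]
  obtain ⟨z, hz⟩ := key (Finset.univ.erase i0) (by simp)
  refine ⟨z, ?_⟩
  convert hz using 2 with i
  by_cases hi : i = i0 <;> simp [hi]

variable {R : Type*} [CommRing R] [IsLocalRing R] [IsNoetherianRing R]

theorem zma {A : Type*} [CommRing A] (x y : A) : 0 * x + y = y := by ring

theorem descend (e : ℕ) (he : 3 ≤ e) (hR : ∀ p : Ideal R, p.IsPrime → p.height ≤ ((e + 1 : ℕ) : ℕ∞))
    (a : R) (ha : a ∈ IsLocalRing.maximalIdeal R) (han : ∀ n, a ^ n ≠ 0)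
    {ι : Type*} [Fintype ι] [DecidableEq ι] (hι : Fintype.card ι = e + 1) (k : R[X]) (y : ι → R[X])
    (hy : Uni (ocons (1 + C a * k) y)) :
    ∃ (i0 i1 : ι) (u : R[X]) (r : ι → R), i1 ≠ i0 ∧
      EEq (ocons (1 + C a * k) y)
        (ocons (1 + C a * k) (fun i => if i = i0 then C a * u else C (a * r i))) ∧
      ∀ P : Ideal R, P.IsPrime → a ∉ P → (∀ i, i ≠ i0 → i ≠ i1 → a * r i ∈ P) →
        ((e - 1 : ℕ) : ℕ∞) ≤ P.height := by
  set x0 : R[X] := 1 + C a * k with hx0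
  let S := Localization.Away a
  have hNS : IsNoetherianRing S := IsLocalization.isNoetherianRing (Submonoid.powers a) S inferInstance
  have hnt : Nontrivial S := by
    rw [← not_subsingleton_iff_nontrivial, IsLocalization.subsingleton_iff (M := Submonoid.powers a)]
    rintro ⟨n, hn⟩
    exact han n hn
  have hau : IsUnit (algebraMap R S a) := IsLocalization.Away.algebraMap_isUnit a
  have hS : ∀ p : Ideal S, p.IsPrime → p.height ≤ e := by
    intro p hp
    rw [← IsLocalization.height_under (Submonoid.powers a) p]
    have hpu : (p.under R).IsPrime := inferInstance
    have hlt : p.under R < IsLocalRing.maximalIdeal R := by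
      refine lt_of_le_of_ne (IsLocalRing.le_maximalIdeal hpu.ne_top) fun h => ?_
      have : a ∈ p.under R := by rw [h]; exact ha
      exact hp.ne_top (Ideal.eq_top_of_isUnit_mem _ this hau)
    have h1 := (Ideal.height_add_one_le_of_lt_of_isPrime hlt).trans (hR _ inferInstance)
    push_cast at h1
    exact (ENat.add_le_add_iff_right (by simp)).1 h1
  set j : R[X] →+* S[X] := mapRingHom (algebraMap R S) with hj
  have hX0 : ∀ P : Ideal S[X], P.IsPrime → j x0 ∈ P → ((1 : ℕ) : ℕ∞) ≤ P.height := by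
    intro P hP hmem
    have hunit : IsUnit (x0.coeff 0) := by
      by_contra hcon
      have h1 : x0.coeff 0 ∈ IsLocalRing.maximalIdeal R := hcon
      have h2 := (IsLocalRing.maximalIdeal R).sub_mem h1 (Ideal.mul_mem_right (k.coeff 0) _ ha)
      rw [hx0, coeff_add, coeff_C_mul, coeff_one_zero, add_sub_cancel_right] at h2
      exact h2 isUnit_one
    have hnz : j x0 ∈ nonZeroDivisors S[X] := by
      rw [Polynomial.mem_nonZeroDivisors_iff]
      intro b hb
      have := congrArg (fun p => coeff p 0) hb
      simp only [coeff_smul, hj, coe_mapRingHom, coeff_map, coeff_zero, smul_eq_mul] at this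
      exact (IsUnit.mul_left_eq_zero (hunit.map (algebraMap R S))).1 this
    have h1 := Ideal.one_le_height_span_singleton_of_mem_nonZeroDivisors hnz
    refine (by simpa using h1 : ((1 : ℕ) : ℕ∞) ≤ _).trans (Ideal.height_mono ?_)
    rwa [Ideal.span_le, Set.singleton_subset_iff]
  have hU : RUni (j x0) (fun i => j (y i)) := by
    obtain ⟨w, hw⟩ := uni_iff.1 hy
    have h1 := congrArg (fun z => Ideal.Quotient.mk (Ideal.span {j x0}) (j z)) hw
    rw [Fintype.sum_option] at h1
    simp only [map_add, map_mul, map_sum, ocons_none, ocons_some, map_one,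
      Ideal.Quotient.mk_singleton_self] at h1
    refine uni_iff.2 ⟨fun i => Ideal.Quotient.mk (Ideal.span {j x0}) (j (w (some i))), ?_⟩
    refine Eq.trans ?_ h1
    exact (zma _ _).symm
  obtain ⟨i0, i1, s, c, h10, hREq, hht⟩ := rel_final e he hS (j x0) hX0 hι _ hU
  set q := Ideal.Quotient.mk (Ideal.span {x0}) with hq
  have hqx : q x0 = 0 := Ideal.Quotient.mk_singleton_self _
  have hqa : IsUnit (q (C a)) := by
    refine IsUnit.of_mul_eq_one (q (-k)) ?_
    have h0 : q (1 + C a * k) = 0 := hqx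
    rw [map_add, map_one, map_mul] at h0
    rw [map_neg]
    linear_combination - h0
  set ψ0 : S →+* R[X] ⧸ Ideal.span {x0} := IsLocalization.Away.lift a (g := q.comp C) hqa with hψ0
  have hψ0' : ∀ z, ψ0 (algebraMap R S z) = q (C z) := fun z => IsLocalization.Away.lift_eq a hqa z
  set ψ : S[X] →+* R[X] ⧸ Ideal.span {x0} := eval₂RingHom ψ0 (q X) with hψ
  have hψj : ∀ z, ψ (j z) = q z := by
    intro z
    have : ψ.comp j = q := by
      refine Polynomial.ringHom_ext ?_ ?_
      · intro z; simp [hψ, hj, hψ0']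
      · simp [hψ, hj]
    rw [← this]; rfl
  set φ := Ideal.Quotient.lift (Ideal.span {j x0}) ψ (by
    intro z hz
    obtain ⟨t, rfl⟩ := Ideal.mem_span_singleton.1 hz
    rw [map_mul, hψj, hqx, zero_mul]) with hφ
  have h1 := EEq.map hREq φ
  simp only [hφ, Ideal.Quotient.lift_mk, hψj] at h1
  obtain ⟨⟨_, N, rfl⟩, hN⟩ := IsLocalization.exist_integer_multiples_of_finite (Submonoid.powers a) c
  choose r hr using hN
  have hr' : ∀ i, algebraMap R S (r i) = algebraMap R S a ^ N * c i := by
    intro i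
    rw [hr i, Algebra.smul_def, map_pow]
  obtain ⟨z, hz⟩ := EEq.scale (fun i => ψ (if i = i0 then X - C s else C (c i))) i0 (q (C a) ^ (N + 1))
    (hqa.pow _)
  obtain ⟨u1, rfl⟩ := Ideal.Quotient.mk_surjective z
  refine ⟨i0, i1, -(k * u1), r, h10, ?_, ?_⟩
  · refine EEq.ocons_lift (f := q) Ideal.Quotient.mk_surjective
      (fun y hy => Ideal.Quotient.eq_zero_iff_mem.1 hy) ?_
    refine (h1.trans hz).trans ?_
    refine (congrArg (EEq _) ?_).mp (EEq.refl _)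
    ext1 i
    by_cases hi : i = i0
    · simp only [hi, if_true]
      change q u1 = _
      have : u1 = x0 * u1 + C a * -(k * u1) := by rw [hx0]; ring
      conv_lhs => rw [this]
      rw [map_add, map_mul, hqx, zero_mul, zero_add]
    · simp only [hi, if_false]
      rw [C_mul, map_mul, ← hψ0' (r i), hr', map_mul, map_pow, hψ0']
      simp only [hψ, coe_eval₂RingHom, eval₂_C]
      ring
  · intro P hP haP h
    have hdis : Disjoint ((Submonoid.powers a : Submonoid R) : Set R) (P : Set R) := by
      rw [Set.disjoint_left]
      rintro _ ⟨n, rfl⟩ h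
      exact haP (hP.mem_of_pow_mem _ h)
    have h2 := IsLocalization.height_map_of_disjoint (S := S) (Submonoid.powers a) P hdis
    rw [← h2]
    have hPp : (P.map (algebraMap R S)).IsPrime :=
      IsLocalization.isPrime_of_isPrime_disjoint (Submonoid.powers a) S P hP hdis
    refine hht _ hPp fun i hi0 hi1 => ?_
    have h3 : r i ∈ P := (hP.mem_or_mem (h i hi0 hi1)).resolve_left haP
    have h4 := Ideal.mem_map_of_mem (algebraMap R S) h3
    rw [hr'] at h4
    rcases hPp.mem_or_mem h4 with h5 | h5
    · exact absurd (Ideal.eq_top_of_isUnit_mem _ h5 (hau.pow N)) hPp.ne_top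
    · exact h5

end Descend

section TheoremThree
open Polynomial

variable {R : Type*} [CommRing R] [IsLocalRing R] [IsNoetherianRing R]

theorem exists_param (hm : (IsLocalRing.maximalIdeal R).height ≠ 0) :
    ∃ a ∈ IsLocalRing.maximalIdeal R, (∀ n, a ^ n ≠ 0) ∧
      ∀ P : Ideal R, P.IsPrime → Ideal.span {a} ≤ P → ((1 : ℕ) : ℕ∞) ≤ P.height := by
  have hfin : (minimalPrimes R).Finite := minimalPrimes.finite_of_isNoetherianRing R
  have hnot : ¬ ((IsLocalRing.maximalIdeal R : Set R) ⊆
      ⋃ i ∈ (↑hfin.toFinset : Set (Ideal R)), ((id i : Ideal R) : Set R)) := by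
    rw [Ideal.subset_union_prime (f := id) ⊥ ⊥
      (fun i hi _ _ => (Ideal.IsMinimalPrime.isPrime (hfin.mem_toFinset.1 hi)))]
    rintro ⟨P, hP, hle⟩
    have hP' := hfin.mem_toFinset.1 hP
    have hPp : P.IsPrime := Ideal.IsMinimalPrime.isPrime hP'
    have : IsLocalRing.maximalIdeal R = P := le_antisymm hle (IsLocalRing.le_maximalIdeal hPp.ne_top)
    rw [this] at hm
    exact hm (Ideal.height_eq_zero_iff.2 hP')
  obtain ⟨a, ha, hna⟩ := Set.not_subset.1 hnot
  have hna' : ∀ P ∈ minimalPrimes R, a ∉ P := by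
    intro P hP h
    exact hna (Set.mem_biUnion (x := P) (by simpa using hP) h)
  refine ⟨a, ha, ?_, ?_⟩
  · intro n hn
    obtain ⟨P, hP, _⟩ := Ideal.exists_minimalPrimes_le (I := (⊥ : Ideal R))
      (J := IsLocalRing.maximalIdeal R) bot_le
    have hPp : P.IsPrime := Ideal.IsMinimalPrime.isPrime hP
    refine hna' P hP (hPp.mem_of_pow_mem n ?_)
    rw [hn]; exact P.zero_mem
  · intro P hP hle
    have h0 : P.height ≠ 0 := fun h =>
      hna' P (Ideal.height_eq_zero_iff.1 h) (hle (Ideal.subset_span rfl))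
    simpa using Order.one_le_iff_ne_zero.2 h0

/-- The saturation of an ideal with respect to `a`. -/
def satIdeal (a : R) (I : Ideal R) : Ideal R where
  carrier := {x | ∃ N : ℕ, a ^ N * x ∈ I}
  zero_mem' := ⟨0, by simp⟩
  add_mem' := by
    rintro x y ⟨N, hN⟩ ⟨M, hM⟩
    refine ⟨N + M, ?_⟩
    have := I.add_mem (I.mul_mem_left (a ^ M) hN) (I.mul_mem_left (a ^ N) hM)
    convert this using 1
    ring
  smul_mem' := by
    rintro c x ⟨N, hN⟩
    refine ⟨N, ?_⟩
    have := I.mul_mem_left c hN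
    convert this using 1
    simp only [smul_eq_mul]
    ring

theorem satIdeal_prime (a : R) (I P : Ideal R) (hP : P.IsPrime) (hle : satIdeal a I ≤ P) :
    ∃ Q : Ideal R, Q.IsPrime ∧ I ≤ Q ∧ Q ≤ P ∧ a ∉ Q := by
  have hdis : Disjoint (satIdeal a I : Set R) ((P.primeCompl ⊔ Submonoid.powers a : Submonoid R) : Set R) := by
    rw [Set.disjoint_left]
    intro x hx hx'
    obtain ⟨s, hs, _, ⟨n, rfl⟩, rfl⟩ := Submonoid.mem_sup.1 hx'
    obtain ⟨N, hN⟩ := hx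
    refine hs (hle ⟨N + n, ?_⟩)
    convert hN using 1
    change _ = a ^ N * (s * a ^ n)
    ring
  obtain ⟨Q, hQ, hIQ, hQd⟩ := Ideal.exists_le_prime_disjoint _ _ hdis
  rw [Set.disjoint_left] at hQd
  refine ⟨Q, hQ, fun x hx => hIQ ⟨0, by simpa using hx⟩, ?_, ?_⟩
  · intro x hx
    by_contra hcon
    exact hQd hx (Submonoid.mem_sup_left (S := P.primeCompl) hcon)
  · intro h
    exact hQd h (Submonoid.mem_sup_right (Submonoid.mem_powers a))

/-- The reindexing. -/
noncomputable def triEquiv {ι : Type*} [DecidableEq ι] (i0 i1 : ι) (h10 : i1 ≠ i0) :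
    Fin 3 ⊕ {i // i ≠ i0 ∧ i ≠ i1} ≃ Option ι :=
  Equiv.ofBijective (Sum.elim ![none, some i0, some i1] (fun i => some i.1)) (by
    constructor
    · rintro (x | ⟨x, hx⟩) (y | ⟨y, hy⟩) h
      · fin_cases x <;> fin_cases y <;> simp_all
      · fin_cases x
        · simp at h
        · exact absurd (Option.some.inj h).symm hy.1
        · exact absurd (Option.some.inj h).symm hy.2
      · fin_cases y
        · simp at h
        · exact absurd (Option.some.inj h) hx.1
        · exact absurd (Option.some.inj h) hx.2
      · simpa using h
    · rintro (_ | x)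
      · exact ⟨Sum.inl 0, rfl⟩
      · by_cases h0 : x = i0
        · exact ⟨Sum.inl 1, by simp [h0]⟩
        · by_cases h1 : x = i1
          · exact ⟨Sum.inl 2, by simp [h1]⟩
          · exact ⟨Sum.inr ⟨x, h0, h1⟩, rfl⟩)

theorem theorem_three (h2 : IsUnit (2 : R)) (e : ℕ) (he : 3 ≤ e) (hodd : Odd e)
    (hR : ∀ p : Ideal R, p.IsPrime → p.height ≤ ((e + 1 : ℕ) : ℕ∞))
    (hm : (IsLocalRing.maximalIdeal R).height ≠ 0)
    {ι : Type*} [Fintype ι] [DecidableEq ι] (hι : Fintype.card ι = e + 1)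
    (v : Option ι → R[X]) (hv : Uni v) : CProp v := by
  obtain ⟨a, ha, han, hha⟩ := exists_param hm
  -- first step
  obtain ⟨v', hvv', k, hk⟩ : ∃ v', EEq v v' ∧ ∃ k, v' none = 1 + C a * k := by
    have hnt : Nontrivial (R ⧸ Ideal.span {a}) := by
      refine Ideal.Quotient.nontrivial_iff.2 fun h => ?_
      exact (IsLocalRing.maximalIdeal.isMaximal R).ne_top
        (top_le_iff.1 (h ▸ (Ideal.span_singleton_le_iff_mem _).2 ha))
    have hloc : IsLocalRing (R ⧸ Ideal.span {a}) :=
      IsLocalRing.of_surjective' (Ideal.Quotient.mk _) Ideal.Quotient.mk_surjective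
    have h1 := suslin_trans (R := R ⧸ Ideal.span {a}) e
      (height_le_quotient _ 1 e hha hR) (ι := Option ι) (by simp; omega) (by simp; omega)
      (fun i => mapRingHom (Ideal.Quotient.mk (Ideal.span {a})) (v i)) (hv.map _) none
    obtain ⟨v', h2, h3⟩ := EEq.lift (f := mapRingHom (Ideal.Quotient.mk (Ideal.span {a})))
      (Polynomial.map_surjective _ Ideal.Quotient.mk_surjective) h1
    refine ⟨v', h2, ?_⟩
    have h4 := h3 none
    rw [Pi.single_eq_same] at h4
    have h5 : v' none - 1 ∈ RingHom.ker (mapRingHom (Ideal.Quotient.mk (Ideal.span {a}))) := by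
      rw [RingHom.mem_ker, map_sub, h4, map_one, sub_self]
    rw [Polynomial.ker_mapRingHom, Ideal.mk_ker, Ideal.map_span, Set.image_singleton,
      Ideal.mem_span_singleton] at h5
    obtain ⟨k, hk⟩ := h5
    exact ⟨k, by rw [← hk]; ring⟩
  refine hvv'.symm.cprop ?_
  have hv' : Uni v' := hvv'.uni hv
  have hoc : v' = ocons (1 + C a * k) (fun i => v' (some i)) := by
    ext1 i
    cases i <;> simp [hk]
  rw [hoc] at hv' ⊢
  obtain ⟨i0, i1, u, r, h10, hE, hht⟩ := descend e he hR a ha han hι k _ hv'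
  refine hE.symm.cprop ?_
  have hv2 := hE.uni hv'
  set c : {i // i ≠ i0 ∧ i ≠ i1} → R := fun i => a * r i with hc
  set h : Fin 3 → R[X] := ![k, u, C (r i1)] with hh
  have hrow : (ocons (1 + C a * k) (fun i => if i = i0 then C a * u else C (a * r i))) ∘
      triEquiv i0 i1 h10 =
      Sum.elim (fun i => (Pi.single 0 1 : Fin 3 → R[X]) i + C a * h i) (fun k => C (c k)) := by
    ext1 i
    rcases i with i | ⟨i, hi⟩
    · fin_cases i
      · change 1 + C a * k = _
        simp [hh]
      · change (if i0 = i0 then C a * u else C (a * r i0)) = _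
        simp [hh]
      · change (if i1 = i0 then C a * u else C (a * r i1)) = _
        simp [hh, h10]
    · change (if i = i0 then C a * u else C (a * r i)) = _
      simp [hc, hi.1]
  refine CProp.of_reindex (triEquiv i0 i1 h10) ?_
  have hv3 := hv2.reindex (triEquiv i0 i1 h10)
  rw [hrow] at hv3 ⊢
  set b := satIdeal a (Ideal.span (Set.range c)) with hb
  have hcb : ∀ i, c i ∈ b := fun i => ⟨0, by
    rw [pow_zero, one_mul]; exact Ideal.subset_span (Set.mem_range_self i)⟩
  have hbP : ∀ P : Ideal R, P.IsPrime → b ≤ P → ((e - 1 : ℕ) : ℕ∞) ≤ P.height := by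
    intro P hP hle
    obtain ⟨Q, hQ, hIQ, hQP, haQ⟩ := satIdeal_prime a _ P hP hle
    exact (hht Q hQ haQ fun i hi0 hi1 => hIQ (Ideal.subset_span ⟨⟨i, hi0, hi1⟩, rfl⟩)).trans
      (Ideal.height_mono hQP)
  have hq2 := height_le_quotient b (e - 1) 2 hbP (by
    have : 2 + (e - 1) = e + 1 := by omega
    rw [this]; exact hR)
  have hU : Uni (fun i => mapRingHom (Ideal.Quotient.mk b)
      ((Pi.single 0 1 : Fin 3 → R[X]) i + C a * h i)) := by
    obtain ⟨w, hw⟩ := uni_iff.1 (hv3.map (mapRingHom (Ideal.Quotient.mk b)))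
    refine uni_iff.2 ⟨fun i => w (Sum.inl i), ?_⟩
    rw [Fintype.sum_sum_type] at hw
    rw [← hw]
    simp only [Sum.elim_inl, Sum.elim_inr]
    symm
    convert add_zero _ using 2
    refine Finset.sum_eq_zero fun i _ => ?_
    rw [coe_mapRingHom, map_C, Ideal.Quotient.eq_zero_iff_mem.2 (hcb i), C_0, zero_mul]
  obtain ⟨K, hK, hK'⟩ := exists_G h2 b hq2 a ha h hU
  refine end_step ?_ b a c (fun x hx => hx) h K hK hK'
  rw [card_two_compl e hι h10]
  obtain ⟨m, rfl⟩ := hodd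
  exact ⟨m, by omega⟩

end TheoremThree

section Final
open Polynomial

theorem final_of_cprop {A : Type*} [CommRing A] {n : ℕ} (v : Fin n → A) (hv : IsUnimodular v)
    (hc : CProp v) : ∃ (S : Matrix (Fin 2) (Fin n) A) (ε : Matrix (Fin n) (Fin n) A),
      RightInvertible S ∧ IsElementary ε ∧ S 0 = Matrix.vecMul v ε := by
  obtain ⟨w, hw⟩ := hv
  obtain ⟨x, hx, hvx⟩ := hc
  obtain ⟨y, hy⟩ := uni_iff.1 hx
  refine ⟨Matrix.of ![v, y], 1, ?_, Submonoid.one_mem _, by rw [Matrix.vecMul_one]; rfl⟩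
  set t := ∑ i, y i * w i with ht
  refine ⟨Matrix.of fun i => ![w i - t * x i, x i], ?_⟩
  have hyx : ∑ i, y i * x i = 1 := by
    rw [← hy]; exact Finset.sum_congr rfl fun i _ => mul_comm _ _
  have e1 : ∑ i, v i * (w i - t * x i) = 1 := by
    have : ∀ i, v i * (w i - t * x i) = v i * w i - t * (v i * x i) := fun i => by ring
    simp only [this, Finset.sum_sub_distrib, ← Finset.mul_sum, hw, hvx]; ring
  have e2 : ∑ i, y i * (w i - t * x i) = 0 := by
    have : ∀ i, y i * (w i - t * x i) = y i * w i - t * (y i * x i) := fun i => by ring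
    simp only [this, Finset.sum_sub_distrib, ← Finset.mul_sum, hyx, ← ht]; ring
  ext i j
  fin_cases i <;> fin_cases j <;> simp [Matrix.mul_apply, e1, e2, hvx, hyx]

theorem cprop_of_matrix {A : Type*} [CommRing A] (g : Matrix (Fin 3) (Fin 3) A) (hg : IsUnit g.det) :
    CProp (g 0) := by
  have h1 : g * g⁻¹ = 1 := Matrix.mul_nonsing_inv g hg
  refine ⟨fun i => g⁻¹ i 1, uni_iff.2 ⟨fun i => g 1 i, ?_⟩, ?_⟩
  · have := congrFun (congrFun h1 1) 1
    rw [Matrix.mul_apply, Matrix.one_apply_eq] at this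
    rw [← this]; exact Finset.sum_congr rfl fun i _ => mul_comm _ _
  · have := congrFun (congrFun h1 0) 1
    rw [Matrix.mul_apply] at this
    simpa using this

theorem cprop_main {R : Type*} [CommRing R] [IsLocalRing R]
    [IsNoetherianRing R] (d : ℕ) (hd : 2 ≤ d) (hdim : ringKrullDim R = d)
    (hfac : IsUnit (d.factorial : R)) (n : ℕ) (hn : d + 1 ≤ n)
    (v : Fin n → R[X]) (hv : IsUnimodular v) : CProp v := by
  have hu : Uni v := uni_iff.2 hv
  have hR : ∀ p : Ideal R, p.IsPrime → p.height ≤ (d : ℕ∞) := by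
    intro p hp
    have := Ideal.height_le_ringKrullDim_of_ne_top hp.ne_top
    rw [hdim] at this
    exact_mod_cast this
  have hm : (IsLocalRing.maximalIdeal R).height = (d : ℕ∞) := by
    have := IsLocalRing.maximalIdeal_height_eq_ringKrullDim (R := R)
    rw [hdim] at this
    exact_mod_cast this
  have h2 : IsUnit (2 : R) := by
    refine isUnit_of_dvd_unit ?_ hfac
    exact_mod_cast Nat.cast_dvd_cast (α := R) (Nat.dvd_factorial (by norm_num : 0 < 2) hd)
  rcases Nat.even_or_odd n with hev | hodd
  · obtain ⟨x, hx, hmem⟩ := even_lemma (κ := Fin n) (by simpa using hev) v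
    refine ⟨x, ?_, hx⟩
    unfold Uni at hu ⊢
    rw [eq_top_iff, ← hu, Ideal.span_le]
    rintro _ ⟨i, rfl⟩
    exact hmem i
  · rcases Nat.lt_or_ge n (d + 2) with hlt | hge
    · obtain rfl : n = d + 1 := by omega
      rcases eq_or_lt_of_le hd with rfl | hd3
      · obtain ⟨g, hg, rfl⟩ := base_completion h2 hR v hu
        exact cprop_of_matrix g hg
      · obtain ⟨m, hm'⟩ := hodd
        obtain ⟨e, rfl⟩ : ∃ e, d = e + 1 := ⟨d - 1, by omega⟩
        refine CProp.of_reindex (finSuccEquiv (e + 1)).symm ?_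
        refine theorem_three h2 e (by omega) ⟨m - 1, by omega⟩ hR ?_ (by simp) _ (hu.reindex _)
        rw [hm]
        simp
    · have h := suslin_trans (R := R) d hR (ι := Fin n) (by simp; omega) (by simpa using hge) v hu
        ⟨0, by omega⟩
      exact h.symm.cprop (CProp.single _ ⟨1, by omega⟩ (by simp))

end Final

open Polynomial in
/-- Let `R` be a local noetherian commutative ring of Krull dimension `d ≥ 2` with `d!`
invertible in `R`, and let `n ≥ d + 1`.  Then
`Row₁ : Um_{2,n}(R[X])/E_n(R[X]) → Um_{1,n}(R[X])/E_n(R[X])` is surjective: for every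
unimodular `v ∈ Um_n(R[X])` there are a right invertible `S ∈ Um_{2,n}(R[X])` and
`ε ∈ E_n(R[X])` such that the first row of `S` equals `vε`. -/
theorem row_one_surjective_of_dim {R : Type*} [CommRing R] [IsLocalRing R]
    [IsNoetherianRing R] (d : ℕ) (hd : 2 ≤ d) (hdim : ringKrullDim R = d)
    (hfac : IsUnit (d.factorial : R)) (n : ℕ) (hn : d + 1 ≤ n)
    (v : Fin n → R[X]) (hv : IsUnimodular v) :
    ∃ (S : Matrix (Fin 2) (Fin n) R[X]) (ε : Matrix (Fin n) (Fin n) R[X]),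
      RightInvertible S ∧ IsElementary ε ∧ S 0 = Matrix.vecMul v ε := by
  exact final_of_cprop v hv (cprop_main d hd hdim hfac n hn v hv)
end
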